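/- arXiv:0911.4136 — 2 statements merged into one kernel-verified Lean document; each statement's English description precedes it below -/
import Mathlib

section
/- The order complex of the proper part of the subgroup lattice of PSL(2,7) is homotopy equivalent to a wedge of 48 circles and 48 two-dimensional spheres: Δ𝓛PSL(2,7) ≃ (⋁^{48} S¹) ∨ (⋁^{48} S²). -/
/-- The geometric realization of the order complex of the subposet of `P` induced on `S`:
functions `P → ℝ` that are nonnegative, finitely supported, sum to `1`, and whose support is
a chain contained in `S`. Simplices are exactly the finite chains of `S`. -/
def ocSet (P : Type) [Preorder P] (S : Set P) : Set (P → ℝ) :=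
  {f | (∀ x, 0 ≤ f x) ∧ (Function.support f).Finite ∧ (∑ᶠ x, f x) = 1 ∧
    Function.support f ⊆ S ∧ IsChain (· ≤ ·) (Function.support f)}

/-- The order complex `Δ S` of the subposet induced on `S`, as a topological space. -/
abbrev ΔSp {P : Type} [Preorder P] (S : Set P) : Type := ↥(ocSet P S)

lemma ocSet_mono {P : Type} [Preorder P] {S T : Set P} (h : S ⊆ T) :
    ocSet P S ⊆ ocSet P T :=
  fun _ hf => ⟨hf.1, hf.2.1, hf.2.2.1, hf.2.2.2.1.trans h, hf.2.2.2.2⟩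

/-- The inclusion of order complexes induced by `S ⊆ T`. -/
def ΔIncl {P : Type} [Preorder P] {S T : Set P} (h : S ⊆ T) : C(ΔSp S, ΔSp T) :=
  ⟨Set.inclusion (ocSet_mono h), continuous_inclusion (ocSet_mono h)⟩
/-- The topological join `X * Y`: the double mapping cylinder of `X ← X × I × Y → Y`
(so that `X * ∅ = X` and `∅ * Y = Y`). -/
abbrev TopJoin (X Y : Type) [TopologicalSpace X] [TopologicalSpace Y] : Type :=
  Quot (fun a b : (X ⊕ (X × unitInterval × Y)) ⊕ Y =>
    (∃ x y, a = Sum.inl (Sum.inr (x, 0, y)) ∧ b = Sum.inl (Sum.inl x)) ∨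
    (∃ x y, a = Sum.inl (Sum.inr (x, 1, y)) ∧ b = Sum.inr y))

/-- The (unreduced) suspension `Σ X = S⁰ * X`. -/
abbrev Susp (X : Type) [TopologicalSpace X] : Type := TopJoin Bool X

/-- The wedge (one-point union) of two pointed spaces. -/
abbrev Wedge (X Y : Type) [TopologicalSpace X] [TopologicalSpace Y] (x0 : X) (y0 : Y) : Type :=
  Quot (fun a b : X ⊕ Y => a = Sum.inl x0 ∧ b = Sum.inr y0)

/-- The wedge of a family of pointed spaces (with an auxiliary base point glued to all the
base points of the family, so that the empty wedge is a one-point space). -/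
abbrev BigWedge {ι : Type} (X : ι → Type) [∀ i, TopologicalSpace (X i)] (pt : ∀ i, X i) : Type :=
  Quot (fun a b : (Σ i, X i) ⊕ Unit => (∃ i, a = Sum.inl ⟨i, pt i⟩) ∧ b = Sum.inr ())

/-- The base point of a wedge of a family. -/
def BigWedge.base {ι : Type} {X : ι → Type} [∀ i, TopologicalSpace (X i)] {pt : ∀ i, X i} :
    BigWedge X pt :=
  Quot.mk _ (Sum.inr ())

/-- `𝓛 G`: the proper part of the subgroup lattice of `G`. -/
def Lset (G : Type) [Group G] : Set (Subgroup G) := {H | ⊥ < H ∧ H < ⊤}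

/-- The projective special linear group `PSL(2,7) = SL(2,𝔽₇)/Z(SL(2,𝔽₇))`. -/
abbrev PSL27 : Type := Matrix.ProjectiveSpecialLinearGroup (Fin 2) (ZMod 7)

/-- The 2-sphere. -/
abbrev TwoSphere : Type := Metric.sphere (0 : EuclideanSpace ℝ (Fin 3)) 1

/-- A base point on the 2-sphere. -/
noncomputable def TwoSphere.pt : TwoSphere :=
  ⟨EuclideanSpace.single (0 : Fin 3) (1 : ℝ), by
    simp [mem_sphere_zero_iff_norm, EuclideanSpace.norm_single]⟩

section Topology

open scoped unitInterval

/-- `K` is obtained from `T` by attaching, for every `i`, the straight cone with apex `b i` over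
the subset `B i` of `T`; the function `η i` measures the height in the `i`-th cone. -/
structure ConeAttach {E ι : Type} [AddCommGroup E] [Module ℝ E] [TopologicalSpace E]
    (T K : Set E) (B : ι → Set E) (b : ι → E) (η : ι → E → ℝ) : Prop where
  isCompact_base : IsCompact T
  isCompact_link : ∀ i, IsCompact (B i)
  link_subset : ∀ i, B i ⊆ T
  base_subset : T ⊆ K
  mem : ∀ i, ∀ y ∈ B i, ∀ s : I, (1 - (s : ℝ)) • y + (s : ℝ) • b i ∈ K
  cover : ∀ f ∈ K, f ∈ T ∨ ∃ i, ∃ y ∈ B i, ∃ s : I, (1 - (s : ℝ)) • y + (s : ℝ) • b i = f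
  height_self : ∀ i, ∀ y ∈ B i, ∀ s : I, η i ((1 - (s : ℝ)) • y + (s : ℝ) • b i) = s
  height_base : ∀ i, ∀ f ∈ T, η i f = 0
  height_ne : ∀ i j, i ≠ j → ∀ y ∈ B j, ∀ s : I, η i ((1 - (s : ℝ)) • y + (s : ℝ) • b j) = 0

namespace ConeAttach

variable {E ι : Type} [AddCommGroup E] [Module ℝ E] [TopologicalSpace E]
  [IsTopologicalAddGroup E] [ContinuousSMul ℝ E]
  {T K : Set E} {B : ι → Set E} {b : ι → E} {η : ι → E → ℝ}

/-- The parametrization of the `i`-th cone. -/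
def cone (h : ConeAttach T K B b η) (i : ι) : C(B i × I, K) where
  toFun z := ⟨(1 - (z.2 : ℝ)) • (z.1 : E) + (z.2 : ℝ) • b i, h.mem i z.1 z.1.2 z.2⟩
  continuous_toFun := by fun_prop

/-- The inclusion of the base. -/
def base (h : ConeAttach T K B b η) : C(T, K) :=
  ⟨Set.inclusion h.base_subset, continuous_inclusion _⟩

/-- The inclusion of a link into the base. -/
def link (h : ConeAttach T K B b η) (i : ι) : C(B i, T) :=
  ⟨Set.inclusion (h.link_subset i), continuous_inclusion _⟩

lemma cone_zero (h : ConeAttach T K B b η) (i : ι) (y : B i) :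
    h.cone i (y, 0) = h.base (h.link i y) := by
  ext; simp [cone, base, link]

lemma cone_one (h : ConeAttach T K B b η) (i : ι) (y y' : B i) :
    h.cone i (y, 1) = h.cone i (y', 1) := by
  ext; simp [cone]

omit [IsTopologicalAddGroup E] [ContinuousSMul ℝ E] in
lemma base_injective (h : ConeAttach T K B b η) {t t' : T} (e : h.base t = h.base t') : t = t' := by
  simpa [base, Subtype.ext_iff] using e

lemma cone_injective (h : ConeAttach T K B b η) {i : ι} {y y' : B i} {s s' : I}
    (e : h.cone i (y, s) = h.cone i (y', s')) : s = s' ∧ (s = 1 ∨ y = y') := by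
  have e1 : (1 - (s : ℝ)) • (y : E) + (s : ℝ) • b i = (1 - (s' : ℝ)) • (y' : E) + (s' : ℝ) • b i :=
    congrArg Subtype.val e
  have hs : s = s' := by
    have := congrArg (η i) e1
    rw [h.height_self i y y.2, h.height_self i y' y'.2] at this
    exact Subtype.ext this
  subst hs
  refine ⟨rfl, ?_⟩
  by_cases h1 : s = 1
  · exact Or.inl h1
  · right
    have h2 : (1 - (s : ℝ)) ≠ 0 := fun h3 =>
      h1 (Subtype.ext (by simpa using (sub_eq_zero.1 h3).symm))
    exact Subtype.ext (smul_right_injective E h2 (add_right_cancel e1))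

lemma cone_eq_base (h : ConeAttach T K B b η) {i : ι} {y : B i} {s : I} {t : T}
    (e : h.cone i (y, s) = h.base t) : s = 0 ∧ h.link i y = t := by
  have e1 : (1 - (s : ℝ)) • (y : E) + (s : ℝ) • b i = t := congrArg Subtype.val e
  have hs : s = 0 := by
    have := congrArg (η i) e1
    rw [h.height_self i y y.2, h.height_base i t t.2] at this
    exact Subtype.ext this
  subst hs
  rw [cone_zero] at e
  exact ⟨rfl, h.base_injective e⟩

lemma cone_eq_cone (h : ConeAttach T K B b η) {i j : ι} (hij : i ≠ j) {y : B i} {y' : B j}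
    {s s' : I} (e : h.cone i (y, s) = h.cone j (y', s')) :
    s = 0 ∧ s' = 0 ∧ h.link i y = h.link j y' := by
  have e1 : (1 - (s : ℝ)) • (y : E) + (s : ℝ) • b i = (1 - (s' : ℝ)) • (y' : E) + (s' : ℝ) • b j :=
    congrArg Subtype.val e
  have hs : s = 0 := by
    have := congrArg (η i) e1
    rw [h.height_self i y y.2, h.height_ne i j hij y' y'.2] at this
    exact Subtype.ext this
  have hs' : s' = 0 := by
    have := congrArg (η j) e1
    rw [h.height_self j y' y'.2, h.height_ne j i hij.symm y y.2] at this
    exact Subtype.ext this.symm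
  subst hs hs'
  rw [cone_zero, cone_zero] at e
  exact ⟨rfl, rfl, h.base_injective e⟩

/-- A continuous family of maps on the base and on the cones which agree on the links and on the
apices descends to `K`. -/
lemma exists_descend [T2Space E] [Finite ι] (h : ConeAttach T K B b η) {P Y : Type}
    [TopologicalSpace P] [CompactSpace P] [T2Space P] [TopologicalSpace Y]
    (gT : C(T × P, Y)) (gc : ∀ i, C((B i × I) × P, Y))
    (c0 : ∀ i y p, gc i ((y, 0), p) = gT (h.link i y, p))
    (c1 : ∀ i y y' p, gc i ((y, 1), p) = gc i ((y', 1), p)) :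
    ∃ G : C(K × P, Y), (∀ t p, G (h.base t, p) = gT (t, p)) ∧
      ∀ i z p, G (h.cone i z, p) = gc i (z, p) := by
  have : CompactSpace T := isCompact_iff_compactSpace.1 h.isCompact_base
  have : ∀ i, CompactSpace (B i) := fun i => isCompact_iff_compactSpace.1 (h.isCompact_link i)
  let π : C((T × P) ⊕ (Σ i, (B i × I) × P), K × P) :=
    ⟨Sum.elim (fun z => (h.base z.1, z.2)) fun z => (h.cone z.1 z.2.1, z.2.2),
      Continuous.sumElim (by fun_prop) (continuous_sigma fun i =>
        ((h.cone i).continuous.comp continuous_fst).prodMk continuous_snd)⟩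
  have hπs : Function.Surjective π := by
    rintro ⟨⟨f, hf⟩, p⟩
    rcases h.cover f hf with ht | ⟨i, y, hy, s, rfl⟩
    · exact ⟨Sum.inl (⟨f, ht⟩, p), rfl⟩
    · exact ⟨Sum.inr ⟨i, (⟨y, hy⟩, s), p⟩, rfl⟩
  have hπ : Topology.IsQuotientMap π := π.continuous.isClosedMap.isQuotientMap π.continuous hπs
  let g : C((T × P) ⊕ (Σ i, (B i × I) × P), Y) :=
    ⟨Sum.elim gT fun z => gc z.1 z.2,
      Continuous.sumElim gT.continuous (continuous_sigma fun i => (gc i).continuous)⟩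
  have key : Function.FactorsThrough g π := by
    rintro (⟨t, p⟩ | ⟨i, ⟨y, s⟩, p⟩) (⟨t', p'⟩ | ⟨j, ⟨y', s'⟩, p'⟩) e
    · obtain ⟨e1, e2⟩ := Prod.ext_iff.1 e
      obtain rfl := h.base_injective e1
      obtain rfl : p = p' := e2
      rfl
    · obtain ⟨e1, e2⟩ := Prod.ext_iff.1 e
      obtain rfl : p = p' := e2
      obtain ⟨rfl, rfl⟩ := h.cone_eq_base (e1 : h.base t = h.cone j (y', s')).symm
      exact (c0 j y' p).symm
    · obtain ⟨e1, e2⟩ := Prod.ext_iff.1 e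
      obtain rfl : p = p' := e2
      obtain ⟨rfl, rfl⟩ := h.cone_eq_base (e1 : h.cone i (y, s) = h.base t')
      exact c0 i y p
    · obtain ⟨e1, e2⟩ := Prod.ext_iff.1 e
      obtain rfl : p = p' := e2
      by_cases hij : i = j
      · subst hij
        obtain ⟨rfl, rfl | rfl⟩ := h.cone_injective (e1 : h.cone i (y, s) = h.cone i (y', s'))
        · exact c1 i y y' p
        · rfl
      · obtain ⟨rfl, rfl, e3⟩ := h.cone_eq_cone hij (e1 : h.cone i (y, s) = h.cone j (y', s'))
        change gc i ((y, 0), p) = gc j ((y', 0), p)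
        rw [c0, c0, e3]
  refine ⟨hπ.lift g key, fun t p => ?_, fun i z p => ?_⟩
  · exact DFunLike.congr_fun (hπ.lift_comp g key) (Sum.inl (t, p))
  · exact DFunLike.congr_fun (hπ.lift_comp g key) (Sum.inr ⟨i, z, p⟩)

lemma ext_on (h : ConeAttach T K B b η) {Y : Type} {f g : K → Y}
    (hT : ∀ t, f (h.base t) = g (h.base t)) (hc : ∀ i z, f (h.cone i z) = g (h.cone i z)) :
    f = g := by
  funext ⟨k, hk⟩
  rcases h.cover k hk with ht | ⟨i, y, hy, s, rfl⟩
  · exact hT ⟨k, ht⟩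
  · exact hc i (⟨y, hy⟩, s)

/-- Attaching cones over contractible links does not change the homotopy type. -/
theorem homotopyEquiv_of_contractible_link [T2Space E] [Finite ι] (h : ConeAttach T K B b η)
    (hB : ∀ i, ContractibleSpace (B i)) : Nonempty (ContinuousMap.HomotopyEquiv T K) := by
  choose c hc using fun i => (id_nullhomotopic (B i))
  have H : ∀ i, (ContinuousMap.id (B i)).Homotopy (ContinuousMap.const (B i) (c i)) :=
    fun i => (hc i).some
  obtain ⟨r, hr0, hr1⟩ := h.exists_descend (P := Unit) (Y := T)
    (ContinuousMap.fst) (fun i => ⟨fun z => h.link i (H i (z.1.2, z.1.1)), by fun_prop⟩)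
    (by intro i y p; simp) (by intro i y y' p; simp)
  obtain ⟨G, hG0, hG1⟩ := h.exists_descend (P := I) (Y := K)
    (h.base.comp ContinuousMap.fst)
    (fun i => ⟨fun z => h.cone i (H i (Set.projIcc 0 1 zero_le_one (2 * (z.2 : ℝ)) * z.1.2, z.1.1),
      z.1.2 * Set.projIcc 0 1 zero_le_one (2 - 2 * (z.2 : ℝ))), by
        have := (continuous_projIcc (a := (0 : ℝ)) (b := 1) (h := zero_le_one))
        fun_prop⟩)
    (by intro i y p; simp [cone_zero])
    (by
      intro i y y' t
      rcases le_total (1 / 2 : ℝ) t with ht | ht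
      · have : Set.projIcc (0 : ℝ) 1 zero_le_one (2 * (t : ℝ)) = 1 :=
          Set.projIcc_of_right_le _ (by linarith)
        simp [this]
      · have : Set.projIcc (0 : ℝ) 1 zero_le_one (2 - 2 * (t : ℝ)) = 1 :=
          Set.projIcc_of_right_le _ (by linarith)
        simp only [ContinuousMap.coe_mk, this, mul_one]
        exact h.cone_one i _ _)
  let r' : C(K, T) := r.comp ((ContinuousMap.id K).prodMk (ContinuousMap.const K ()))
  refine ⟨⟨h.base, r', ?_, ?_⟩⟩
  · have : r'.comp h.base = ContinuousMap.id T := by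
      ext1 t
      exact hr0 t ()
    rw [this]
  · refine ContinuousMap.Homotopic.symm ⟨⟨G.comp ContinuousMap.prodSwap, fun k => ?_, fun k => ?_⟩⟩
    · refine congrFun (h.ext_on (f := fun k => G (k, 0)) (g := id) (fun t => ?_) fun i z => ?_) k
      · exact hG0 t 0
      · simp only [hG1]
        have : Set.projIcc (0 : ℝ) 1 zero_le_one 2 = 1 :=
          Set.projIcc_of_right_le _ (by linarith)
        simp [this]
    · refine congrFun (h.ext_on (f := fun k => G (k, 1)) (g := fun k => h.base (r' k))
        (fun t => ?_) fun i z => ?_) k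
      · simp only [hG0]
        exact congrArg h.base (hr0 t ()).symm
      · simp only [hG1]
        have : Set.projIcc (0 : ℝ) 1 zero_le_one 2 = 1 :=
          Set.projIcc_of_right_le _ (by linarith)
        have e : r' (h.cone i z) = h.link i (H i (z.2, z.1)) := hr1 i z ()
        rw [e, ← cone_zero]
        simp [this]

/-- The path which runs through a contraction of the base for negative parameters and through a
cone for positive ones. -/
lemma exists_extend (h : ConeAttach T K B b η) (H : C(I × T, T)) (H0 : ∀ t, H (0, t) = t) (i : ι) :
    ∃ q : C(B i × ℝ, K), (∀ y (s : I), q (y, s) = h.cone i (y, s)) ∧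
      ∀ y (s : I), q (y, -s) = h.base (H (s, h.link i y)) := by
  have hI := (continuous_projIcc (a := (0 : ℝ)) (b := 1) (h := zero_le_one))
  refine ⟨⟨fun z => if 0 ≤ z.2 then h.cone i (z.1, Set.projIcc 0 1 zero_le_one z.2) else
    h.base (H (Set.projIcc 0 1 zero_le_one (-z.2), h.link i z.1)), ?_⟩, ?_, ?_⟩
  · refine Continuous.if_le (by fun_prop) (by fun_prop) (by fun_prop) (by fun_prop) ?_
    rintro ⟨y, s⟩ hs
    obtain rfl : 0 = s := hs
    simp [cone_zero, H0]
  · intro y s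
    simp [s.2.1]
  · intro y s
    by_cases hs : s = 0
    · subst hs
      simp [cone_zero, H0]
    · have : ¬ (0 : ℝ) ≤ -s := by
        have := unitInterval.pos_iff_ne_zero.2 hs
        have : (0 : ℝ) < s := this
        linarith
      simp [this]

/-- If the base is contractible and the cone over `B i`, with its base collapsed to a point, is
the space `X i`, then `K` is homotopy equivalent to the wedge of the `X i`. -/
theorem homotopyEquiv_bigWedge [T2Space E] [Finite ι] (h : ConeAttach T K B b η)
    (hT : ContractibleSpace T) (X : ι → Type) [∀ i, TopologicalSpace (X i)] [∀ i, T2Space (X i)]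
    (pt : ∀ i, X i) (p : ∀ i, C(B i × I, X i)) (hp : ∀ i, Function.Surjective (p i))
    (p0 : ∀ i y, p i (y, 0) = pt i) (p1 : ∀ i y y', p i (y, 1) = p i (y', 1))
    (pinj : ∀ i y y' s s', p i (y, s) = p i (y', s') → s = s' ∧ (s = 0 ∨ s = 1 ∨ y = y')) :
    Nonempty (ContinuousMap.HomotopyEquiv K (BigWedge X pt)) := by
  have : ∀ i, CompactSpace (B i) := fun i => isCompact_iff_compactSpace.1 (h.isCompact_link i)
  have hq : ∀ i, Topology.IsQuotientMap (p i) := fun i =>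
    (p i).continuous.isClosedMap.isQuotientMap (p i).continuous (hp i)
  have hmk : ∀ i (x : X i), x = pt i →
      (Quot.mk _ (Sum.inl ⟨i, x⟩) : BigWedge X pt) = BigWedge.base := by
    rintro i x rfl
    exact Quot.sound ⟨⟨i, rfl⟩, rfl⟩
  let inc : ∀ i, C(X i, BigWedge X pt) := fun i =>
    ⟨fun x => Quot.mk _ (Sum.inl ⟨i, x⟩), continuous_quot_mk.comp
      (continuous_inl.comp continuous_sigmaMk)⟩
  have inc_pt : ∀ i, inc i (pt i) = BigWedge.base := fun i => hmk i _ rfl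
  have desc : ∀ {Z : Type} [TopologicalSpace Z] (g : ∀ i, C(B i × I, Z)) (z : Z),
      (∀ i y, g i (y, 0) = z) → (∀ i y y', g i (y, 1) = g i (y', 1)) →
      ∃ G : C(BigWedge X pt, Z), G BigWedge.base = z ∧ ∀ i w, G (inc i (p i w)) = g i w := by
    intro Z _ g z g0 g1
    have key : ∀ i, Function.FactorsThrough (g i) (p i) := by
      rintro i ⟨y, s⟩ ⟨y', s'⟩ e
      obtain ⟨rfl, rfl | rfl | rfl⟩ := pinj i y y' s s' e
      · rw [g0, g0]
      · exact g1 i y y'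
      · rfl
    have kk : ∀ i w, (hq i).lift (g i) (key i) (p i w) = g i w := fun i w =>
      DFunLike.congr_fun ((hq i).lift_comp (g i) (key i)) w
    have kpt : ∀ i, (hq i).lift (g i) (key i) (pt i) = z := by
      intro i
      obtain ⟨⟨y, s⟩, -⟩ := hp i (pt i)
      rw [← p0 i y, kk, g0]
    have hr : ∀ a b : (Σ i, X i) ⊕ Unit, ((∃ i, a = Sum.inl ⟨i, pt i⟩) ∧ b = Sum.inr ()) →
        Sum.elim (fun x : Σ i, X i => (hq x.1).lift (g x.1) (key x.1) x.2) (fun _ => z) a =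
        Sum.elim (fun x : Σ i, X i => (hq x.1).lift (g x.1) (key x.1) x.2) (fun _ => z) b := by
      rintro _ _ ⟨⟨i, rfl⟩, rfl⟩
      exact kpt i
    exact ⟨⟨Quot.lift _ hr, continuous_quot_lift hr (Continuous.sumElim
      (continuous_sigma fun i => ((hq i).lift (g i) (key i)).continuous) continuous_const)⟩,
      rfl, kk⟩
  have ext : ∀ {Z : Type} (f g : BigWedge X pt → Z), f BigWedge.base = g BigWedge.base →
      (∀ i w, f (inc i (p i w)) = g (inc i (p i w))) → ∀ x, f x = g x := by
    rintro Z f g hb hi ⟨⟨i, x⟩ | ⟨⟩⟩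
    · obtain ⟨w, rfl⟩ := hp i x
      exact hi i w
    · exact hb
  obtain ⟨t₀, ⟨H⟩⟩ := id_nullhomotopic T
  choose q q0 q1 using h.exists_extend H.toContinuousMap (by simp)
  have qz : ∀ i y, q i (y, 0) = h.base (h.link i y) := fun i y => by
    have := q0 i y 0
    rwa [cone_zero] at this
  have qo : ∀ i y y', q i (y, 1) = q i (y', 1) := fun i y y' => by
    rw [show (1 : ℝ) = ((1 : I) : ℝ) from rfl, q0, q0, h.cone_one i y y']
  have qm : ∀ i y, q i (y, -1) = h.base t₀ := fun i y => by
    have := q1 i y 1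
    rw [show ((1 : I) : ℝ) = 1 from rfl] at this
    rw [this]
    simp
  obtain ⟨β, βb, βp⟩ := desc (fun i => ⟨fun z => q i (z.1, 2 * (z.2 : ℝ) - 1), by fun_prop⟩)
    (h.base t₀) (by intro i y; simp [qm]) (by
      intro i y y'
      have : 2 * ((1 : I) : ℝ) - 1 = 1 := by simp; norm_num
      simp only [ContinuousMap.coe_mk, this, qo i y y'])
  obtain ⟨α', α0, α1⟩ := h.exists_descend (P := Unit) (Y := BigWedge X pt)
    (ContinuousMap.const _ BigWedge.base)
    (fun i => ⟨fun z => inc i (p i z.1), by fun_prop⟩)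
    (by intro i y _; simp [p0, inc_pt]) (by intro i y y' _; simp [p1 i y y'])
  let α : C(K, BigWedge X pt) := α'.comp ((ContinuousMap.id K).prodMk (ContinuousMap.const K ()))
  have αb : ∀ t, α (h.base t) = BigWedge.base := fun t => α0 t ()
  have αc : ∀ i w, α (h.cone i w) = inc i (p i w) := fun i w => α1 i w ()
  obtain ⟨G, Gb, Gc⟩ := h.exists_descend (P := I) (Y := K)
    ⟨fun z => h.base (H (z.2, z.1)), by fun_prop⟩
    (fun i => ⟨fun z => q i (z.1.1, (1 + (z.2 : ℝ)) * (z.1.2 : ℝ) - z.2), by fun_prop⟩)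
    (by
      intro i y t
      simpa using q1 i y t)
    (by
      intro i y y' t
      simpa using qo i y y')
  have hI := (continuous_projIcc (a := (0 : ℝ)) (b := 1) (h := zero_le_one))
  have proj1 : Set.projIcc (0 : ℝ) 1 zero_le_one 1 = 1 := Set.projIcc_right zero_le_one
  obtain ⟨F, Fb, Fp⟩ := desc (Z := C(I, BigWedge X pt)) (fun i => ContinuousMap.curry
      ⟨fun z : (B i × I) × I => inc i (p i (z.1.1, Set.projIcc 0 1 zero_le_one
        ((1 + (z.2 : ℝ)) * (z.1.2 : ℝ) - z.2))), by fun_prop⟩)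
    (ContinuousMap.const _ BigWedge.base)
    (by
      intro i y
      ext1 t
      have : Set.projIcc (0 : ℝ) 1 zero_le_one (-t) = 0 :=
        Set.projIcc_of_le_left _ (by simpa using t.2.1)
      simp [this, p0, inc_pt])
    (by
      intro i y y'
      ext1 t
      simp [p1 i y y'])
  have hG : (ContinuousMap.id K).Homotopic (β.comp α) := by
    refine ⟨⟨G.comp ContinuousMap.prodSwap, fun k => ?_, fun k => ?_⟩⟩
    · refine congrFun (h.ext_on (f := fun k => G (k, 0)) (g := id) (fun t => ?_) fun i z => ?_) k
      · simp [Gb]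
      · simp [Gc, q0]
    · refine congrFun (h.ext_on (f := fun k => G (k, 1)) (g := fun k => β (α k))
        (fun t => ?_) fun i z => ?_) k
      · simp [Gb, αb, βb]
      · simp only [Gc, αc, βp]
        have : (1 + ((1 : I) : ℝ)) * (z.2 : ℝ) - ((1 : I) : ℝ) = 2 * z.2 - 1 := by simp; norm_num
        simp only [ContinuousMap.coe_mk, this]
  have hF : (ContinuousMap.id _).Homotopic (α.comp β) := by
    refine ⟨⟨F.uncurry.comp ContinuousMap.prodSwap, fun x => ?_, fun x => ?_⟩⟩
    · refine ext (fun x => F x 0) id (by simp [Fb]) (fun i w => ?_) x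
      simp [Fp]
    · refine ext (fun x => F x 1) (fun x => α (β x)) (by simp [Fb, βb, αb]) (fun i w => ?_) x
      have e : (1 + ((1 : I) : ℝ)) * (w.2 : ℝ) - ((1 : I) : ℝ) = 2 * w.2 - 1 := by simp; norm_num
      simp only [Fp, βp, ContinuousMap.coe_mk, ContinuousMap.curry_apply, e]
      rcases le_total (1 / 2 : ℝ) w.2 with hw | hw
      · have hw' : 2 * (w.2 : ℝ) - 1 ∈ Set.Icc (0 : ℝ) 1 :=
          ⟨by linarith, by linarith [w.2.2.2]⟩
        rw [Set.projIcc_of_mem _ hw']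
        have := q0 i w.1 ⟨_, hw'⟩
        rw [show q i (w.1, 2 * (w.2 : ℝ) - 1) = _ from this, αc]
      · have hw' : 1 - 2 * (w.2 : ℝ) ∈ Set.Icc (0 : ℝ) 1 :=
          ⟨by linarith, by linarith [w.2.2.1]⟩
        have := q1 i w.1 ⟨_, hw'⟩
        rw [show -(1 - 2 * (w.2 : ℝ)) = 2 * w.2 - 1 by ring] at this
        rw [this, αb, Set.projIcc_of_le_left _ (by linarith)]
        exact (congrArg (inc i) (p0 i _)).trans (inc_pt i)
  exact ⟨⟨α, β, hG.symm, hF.symm⟩⟩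

end ConeAttach

section Geom

variable {V W : Type} [Fintype V] [Fintype W]

/-- The geometric realization of a finite simplicial complex, given by its set of simplices. -/
def geom (K : Set (Set V)) : Set (V → ℝ) :=
  {f | (∀ x, 0 ≤ f x) ∧ ∑ x, f x = 1 ∧ Function.support f ∈ K}

lemma ocSet_eq_geom {P : Type} [Preorder P] [Fintype P] (S : Set P) :
    ocSet P S = geom {s | s ⊆ S ∧ IsChain (· ≤ ·) s} := by
  ext f
  simp [ocSet, geom, finsum_eq_sum_of_fintype, Set.toFinite]

namespace geom

omit [Fintype V] in
lemma support_lineMap (f g : V → ℝ) (t : I) :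
    Function.support ((1 - (t : ℝ)) • f + (t : ℝ) • g) ⊆
      Function.support f ∪ Function.support g := by
  intro x hx
  by_contra h
  simp only [Set.mem_union, Function.mem_support, not_or, not_not] at h
  exact hx (by simp [h.1, h.2])

lemma lineMap_mem {K : Set (Set V)} (hK : IsLowerSet K) {f g : V → ℝ} (hf0 : ∀ x, 0 ≤ f x)
    (hf1 : ∑ x, f x = 1) (hg0 : ∀ x, 0 ≤ g x) (hg1 : ∑ x, g x = 1)
    (h : Function.support f ∪ Function.support g ∈ K) (t : I) :
    (1 - (t : ℝ)) • f + (t : ℝ) • g ∈ geom K := by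
  refine ⟨fun x => ?_, ?_, hK (support_lineMap f g t) h⟩
  · have := t.2.1
    have := t.2.2
    exact add_nonneg (mul_nonneg (by linarith) (hf0 x)) (mul_nonneg (by linarith) (hg0 x))
  · simp [Finset.sum_add_distrib, ← Finset.mul_sum, hf1, hg1]

lemma isCompact {K : Set (Set V)} (hK : IsLowerSet K) : IsCompact (geom K) := by
  have : geom K = stdSimplex ℝ V ∩ ⋃ s ∈ K, {f | ∀ x ∈ sᶜ, f x = 0} := by
    ext f
    simp only [geom, stdSimplex, Set.mem_inter_iff, Set.mem_ofPred_eq, Set.mem_iUnion, and_assoc,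
      exists_prop]
    refine and_congr_right fun _ => and_congr_right fun _ => ⟨fun h => ⟨_, h, by simp⟩, ?_⟩
    rintro ⟨s, hs, h⟩
    exact hK (fun x hx => by_contra fun h' => hx (h x h')) hs
  rw [this]
  refine (isCompact_stdSimplex ℝ V).inter_right (Set.toFinite K |>.isClosed_biUnion fun s _ => ?_)
  simp only [Set.ofPred_forall]
  exact isClosed_biInter fun x _ => isClosed_eq (continuous_apply x) continuous_const

/-- Two maps which send each point into a common simplex are homotopic. -/
lemma homotopic_of_union {Z : Type} [TopologicalSpace Z] {K : Set (Set V)} (hK : IsLowerSet K)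
    (F G : C(Z, geom K))
    (h : ∀ z, Function.support (F z : V → ℝ) ∪ Function.support (G z : V → ℝ) ∈ K) :
    F.Homotopic G :=
  ⟨{ toFun := fun z => ⟨(1 - (z.1 : ℝ)) • (F z.2 : V → ℝ) + (z.1 : ℝ) • (G z.2 : V → ℝ),
      lineMap_mem hK (F z.2).2.1 (F z.2).2.2.1 (G z.2).2.1 (G z.2).2.2.1 (h z.2) z.1⟩
     continuous_toFun := by fun_prop
     map_zero_left := fun z => by ext; simp
     map_one_left := fun z => by ext; simp }⟩

open Classical in
/-- The linear map induced by a map on vertices. -/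
noncomputable def push (φ : V → W) (f : V → ℝ) (w : W) : ℝ := ∑ v, if φ v = w then f v else 0

omit [Fintype W] in
lemma support_push (φ : V → W) {f : V → ℝ} (hf : ∀ x, 0 ≤ f x) :
    Function.support (push φ f) = φ '' Function.support f := by
  classical
  ext w
  have h0 : ∀ v ∈ Finset.univ, 0 ≤ if φ v = w then f v else 0 := by
    intro v _
    split_ifs
    exacts [hf v, le_rfl]
  rw [Function.mem_support, push, Ne, Finset.sum_eq_zero_iff_of_nonneg h0]
  simp [and_comm]

lemma exists_eq_lineMap {f b : V → ℝ} (hf : ∑ x, f x = 1) (hb : ∑ x, b x = 1) (s : I) (hs : s ≠ 1)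
    (h : ∀ x, s * b x ≤ f x) :
    ∃ y : V → ℝ, (∀ x, 0 ≤ y x) ∧ ∑ x, y x = 1 ∧ Function.support y = {x | f x ≠ s * b x} ∧
      (1 - (s : ℝ)) • y + (s : ℝ) • b = f := by
  have h1 : 0 < 1 - (s : ℝ) := by
    have : (s : ℝ) < 1 := unitInterval.lt_one_iff_ne_one.2 hs
    linarith
  refine ⟨fun x => (1 - (s : ℝ))⁻¹ * (f x - s * b x), fun x => ?_, ?_, ?_, ?_⟩
  · exact mul_nonneg (inv_nonneg.2 h1.le) (sub_nonneg.2 (h x))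
  · rw [← Finset.mul_sum, Finset.sum_sub_distrib, ← Finset.mul_sum, hf, hb, mul_one,
      inv_mul_cancel₀ h1.ne']
  · ext x
    simp [h1.ne', sub_eq_zero]
  · ext x
    simp [mul_inv_cancel_left₀ h1.ne']

/-- The map of geometric realizations induced by a simplicial map. -/
noncomputable def map {K : Set (Set V)} {L : Set (Set W)} (φ : V → W) (h : ∀ s ∈ K, φ '' s ∈ L) :
    C(geom K, geom L) where
  toFun f := ⟨push φ f, by
    classical
    refine ⟨fun w => Finset.sum_nonneg fun v _ => ?_, ?_, ?_⟩
    · split_ifs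
      exacts [f.2.1 v, le_rfl]
    · simp only [push]
      rw [Finset.sum_comm]
      simpa using f.2.2.1
    · rw [support_push φ f.2.1]
      exact h _ f.2.2.2⟩
  continuous_toFun := by
    refine Continuous.subtype_mk (continuous_pi fun w => continuous_finsetSum _ fun v _ => ?_) _
    split_ifs
    exacts [(continuous_apply v).comp continuous_subtype_val, continuous_const]

lemma support_map {K : Set (Set V)} {L : Set (Set W)} (φ : V → W) (h : ∀ s ∈ K, φ '' s ∈ L)
    (f : geom K) : Function.support (map φ h f : W → ℝ) = φ '' Function.support (f : V → ℝ) :=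
  support_push φ f.2.1

/-- A vertex as a point of the geometric realization. -/
lemma single_mem {K : Set (Set V)} [DecidableEq V] {c : V} (hc : {c} ∈ K) :
    Pi.single c (1 : ℝ) ∈ geom K := by
  refine ⟨fun x => ?_, by simp, by simpa [Pi.support_single_of_ne] using hc⟩
  by_cases h : x = c
  · subst h; simp
  · simp [h]

/-- A cone is contractible. -/
theorem contractibleSpace_of_cone {K : Set (Set V)} (hK : IsLowerSet K) (c : V) (hc : {c} ∈ K)
    (h : ∀ s ∈ K, insert c s ∈ K) : ContractibleSpace (geom K) := by
  classical
  refine (contractible_iff_id_nullhomotopic _).2 ⟨⟨_, single_mem hc⟩, ?_⟩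
  refine homotopic_of_union hK _ _ fun f => ?_
  rw [ContinuousMap.const_apply, Pi.support_single_of_ne one_ne_zero, Set.union_comm]
  exact h _ f.2.2.2

/-- Removing pairwise non-adjacent vertices with contractible links does not change the homotopy
type. -/
theorem homotopyEquiv_of_contractible_link {K : Set (Set V)} (hK : IsLowerSet K) (A : Set V)
    (hA : ∀ s ∈ K, ∀ v ∈ A, ∀ w ∈ A, v ∈ s → w ∈ s → v = w) (hv : ∀ v ∈ A, {v} ∈ K)
    (hlk : ∀ v ∈ A, ContractibleSpace (geom {s | v ∉ s ∧ insert v s ∈ K})) :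
    Nonempty (ContinuousMap.HomotopyEquiv (geom {s ∈ K | Disjoint s A}) (geom K)) := by
  classical
  have key : ConeAttach (ι := A) (geom {s ∈ K | Disjoint s A}) (geom K)
      (fun v => geom {s | (v : V) ∉ s ∧ insert (v : V) s ∈ K}) (fun v => Pi.single v 1)
      (fun v f => f v) := by
    have ev : ∀ v : A, ∀ y ∈ geom {s | (v : V) ∉ s ∧ insert (v : V) s ∈ K}, y v = 0 :=
      fun v y hy => by simpa using hy.2.2.1
    have ew : ∀ v w : A, v ≠ w → ∀ y ∈ geom {s | (v : V) ∉ s ∧ insert (v : V) s ∈ K}, y w = 0 := by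
      intro v w hvw y hy
      by_contra hw
      exact hvw (Subtype.ext (hA _ hy.2.2.2 v v.2 w w.2 (by simp) (Or.inr hw)))
    refine ⟨isCompact ?_, fun v => isCompact ?_, ?_, fun f hf => ⟨hf.1, hf.2.1, hf.2.2.1⟩, ?_, ?_,
      ?_, ?_, ?_⟩
    · exact fun s t hst hs => ⟨hK hst hs.1, hs.2.mono_left hst⟩
    · exact fun s t hst hs => ⟨fun h => hs.1 (hst h), hK (Set.insert_subset_insert hst) hs.2⟩
    · intro v f hf
      refine ⟨hf.1, hf.2.1, hK (Set.subset_insert _ _) hf.2.2.2, Set.disjoint_left.2 ?_⟩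
      intro w hw hwA
      by_cases hvw : v = ⟨w, hwA⟩
      · subst hvw; exact hf.2.2.1 hw
      · exact hw (ew v ⟨w, hwA⟩ hvw f hf)
    · intro v y hy s
      have hs := single_mem (hv v v.2)
      refine lineMap_mem hK hy.1 hy.2.1 hs.1 hs.2.1 ?_ s
      rw [Pi.support_single_of_ne one_ne_zero, Set.union_comm]
      exact hy.2.2.2
    · intro f hf
      by_cases hd : Disjoint (Function.support f) A
      · exact Or.inl ⟨hf.1, hf.2.1, hf.2.2, hd⟩
      · obtain ⟨v, hvf, hvA⟩ := Set.not_disjoint_iff.1 hd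
        refine Or.inr ⟨⟨v, hvA⟩, ?_⟩
        have hle := Finset.single_le_sum (fun x _ => hf.1 x) (Finset.mem_univ v)
        rw [hf.2.1] at hle
        have hz : ∀ x ≠ v, f v = 1 → f x = 0 := by
          intro x hx h1
          have h2 := Finset.sum_le_sum_of_subset_of_nonneg (Finset.subset_univ {v, x})
            fun y _ _ => hf.1 y
          rw [hf.2.1, Finset.sum_pair hx.symm, h1] at h2
          linarith [hf.1 x]
        by_cases h1 : f v = 1
        · have := hlk v hvA
          obtain ⟨y, hy⟩ := Classical.arbitrary (geom {s | v ∉ s ∧ insert v s ∈ K})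
          refine ⟨y, hy, 1, ?_⟩
          ext x
          by_cases hx : x = v
          · subst hx; simp [h1]
          · simp [hx, hz x hx h1]
        · obtain ⟨y, y0, y1, y2, y3⟩ := exists_eq_lineMap hf.2.1 (b := Pi.single v 1) (by simp)
            ⟨f v, hf.1 v, hle⟩ (fun h => h1 (congrArg Subtype.val h)) (fun x => by
              by_cases hx : x = v
              · subst hx; simp
              · simpa [hx] using hf.1 x)
          refine ⟨y, ⟨y0, y1, ?_⟩, _, y3⟩
          have : Function.support y = Function.support f \ {v} := by
            rw [y2]
            ext x
            by_cases hx : x = v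
            · subst hx; simp
            · simp [hx]
          simp only [this, Set.mem_ofPred_eq, Set.insert_sdiff_singleton, Set.insert_eq_of_mem hvf]
          exact ⟨by simp, hf.2.2⟩
    · intro v y hy s
      simp [ev v y hy]
    · intro v f hf
      by_contra h
      exact Set.disjoint_left.1 hf.2.2.2 h v.2
    · intro v w hvw y hy s
      have : (v : V) ≠ w := fun h => hvw (Subtype.ext h)
      simp [ew w v hvw.symm y hy, this]
  exact key.homotopyEquiv_of_contractible_link fun v => hlk v v.2

/-- The barycenter of a simplex. -/
noncomputable def barycenter [DecidableEq V] (τ : Finset V) (x : V) : ℝ :=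
  if x ∈ τ then (τ.card : ℝ)⁻¹ else 0

omit [Fintype V] in
lemma barycenter_nonneg [DecidableEq V] (τ : Finset V) (x : V) : 0 ≤ barycenter τ x := by
  rw [barycenter]
  split_ifs <;> positivity

lemma sum_barycenter [DecidableEq V] {τ : Finset V} (h : τ.Nonempty) :
    ∑ x, barycenter τ x = 1 := by
  have : (τ.card : ℝ) ≠ 0 := by exact_mod_cast h.card_ne_zero
  simp [barycenter, this]

omit [Fintype V] in
lemma support_barycenter [DecidableEq V] (τ : Finset V) :
    Function.support (barycenter τ) = τ := by
  ext x
  by_cases h : x ∈ τ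
  · simpa [barycenter, h] using Finset.ne_empty_of_mem h
  · simp [barycenter, h]

omit [Fintype V] in
lemma card_mul_inf'_lineMap [DecidableEq V] {τ : Finset V} (h : τ.Nonempty) {y : V → ℝ}
    (hy : ∀ x, 0 ≤ y x) {x₀ : V} (hx₀ : x₀ ∈ τ) (hyx : y x₀ = 0) (s : I) :
    τ.card * τ.inf' h ((1 - (s : ℝ)) • y + (s : ℝ) • barycenter τ) = s := by
  have hc : (τ.card : ℝ) ≠ 0 := by exact_mod_cast h.card_ne_zero
  have : τ.inf' h ((1 - (s : ℝ)) • y + (s : ℝ) • barycenter τ) = s * (τ.card : ℝ)⁻¹ := by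
    refine le_antisymm ((Finset.inf'_le _ hx₀).trans ?_) (Finset.le_inf' _ _ fun x hx => ?_)
    · simp [hyx, barycenter, hx₀]
    · have := mul_nonneg (sub_nonneg.2 s.2.2) (hy x)
      simpa [barycenter, hx] using this
  rw [this]
  field_simp

/-- A complex is obtained by attaching a family of maximal simplices to the rest. -/
theorem coneAttach {ι : Type} [DecidableEq V] {K : Set (Set V)} (hK : IsLowerSet K)
    (τ : ι → Finset V) (h2 : ∀ i, (τ i).Nontrivial)
    (hτ : ∀ i, (τ i : Set V) ∈ K) (hmax : ∀ i, ∀ s ∈ K, (τ i : Set V) ⊆ s → s = τ i)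
    (hinj : Function.Injective τ) :
    ConeAttach (geom {s ∈ K | ∀ i, ¬ (τ i : Set V) ⊆ s}) (geom K)
      (fun i => geom {s | s ⊂ (τ i : Set V)}) (fun i => barycenter (τ i))
      (fun i f => (τ i).card * (τ i).inf' (h2 i).nonempty f) := by
  have hne := fun i => (h2 i).nonempty
  have hzero : ∀ i (f : V → ℝ), (∀ x, 0 ≤ f x) → ¬ (τ i : Set V) ⊆ Function.support f →
      (τ i).card * (τ i).inf' (hne i) f = 0 := by
    intro i f hf hi
    obtain ⟨x, hx, hxf⟩ := Set.not_subset.1 hi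
    rw [Function.mem_support, not_not] at hxf
    simpa using card_mul_inf'_lineMap (hne i) hf hx hxf 0
  refine ⟨isCompact fun s t hst hs => ⟨hK hst hs.1, fun i h => hs.2 i (h.trans hst)⟩,
    fun i => isCompact fun s t hst hs => lt_of_le_of_lt hst hs, ?_,
    fun f hf => ⟨hf.1, hf.2.1, hf.2.2.1⟩, ?_, ?_, ?_, ?_, ?_⟩
  · intro i f hf
    refine ⟨hf.1, hf.2.1, hK hf.2.2.subset (hτ i), fun j hj => ?_⟩
    have := hmax j _ (hτ i) (hj.trans hf.2.2.subset)
    rw [← this] at hj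
    exact hf.2.2.not_subset hj
  · intro i y hy s
    refine lineMap_mem hK hy.1 hy.2.1 (barycenter_nonneg _) (sum_barycenter (hne i)) ?_ s
    rw [support_barycenter, Set.union_eq_self_of_subset_left hy.2.2.subset]
    exact hτ i
  · intro f hf
    by_cases hd : ∀ i, ¬ (τ i : Set V) ⊆ Function.support f
    · exact Or.inl ⟨hf.1, hf.2.1, hf.2.2, hd⟩
    push Not at hd
    obtain ⟨i, hi⟩ := hd
    have hs := hmax i _ hf.2.2 hi
    refine Or.inr ⟨i, ?_⟩
    have hc : (0 : ℝ) < (τ i).card := by exact_mod_cast (hne i).card_pos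
    obtain ⟨x₀, hx₀, hm⟩ := (τ i).exists_mem_eq_inf' (hne i) f
    have hmin : ∀ x ∈ τ i, f x₀ ≤ f x := fun x hx => hm ▸ Finset.inf'_le _ hx
    have hle : (τ i).card * f x₀ ≤ 1 := by
      rw [← hf.2.1, ← nsmul_eq_mul]
      exact (Finset.card_nsmul_le_sum _ _ _ hmin).trans
        (Finset.sum_le_sum_of_subset_of_nonneg (Finset.subset_univ _) fun x _ _ => hf.1 x)
    have hb : ∀ x, (τ i).card * f x₀ * barycenter (τ i) x ≤ f x := by
      intro x
      by_cases hx : x ∈ τ i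
      · simp only [barycenter, hx, if_true]
        have := hmin x hx
        field_simp
        exact this
      · simpa [barycenter, hx] using hf.1 x
    by_cases h1 : (τ i).card * f x₀ = 1
    · obtain ⟨a, ha⟩ := hne i
      refine ⟨Pi.single a 1, ⟨(single_mem (K := Set.univ) trivial).1, by simp, ?_⟩, 1, ?_⟩
      · rw [Pi.support_single_of_ne one_ne_zero]
        refine ⟨by simpa using ha, fun h => ?_⟩
        exact (h2 i).not_subset_singleton (by exact_mod_cast h)
      · have h3 : ∀ x, 0 ≤ f x - barycenter (τ i) x := fun x => by
          have := hb x
          rw [h1, one_mul] at this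
          linarith
        have h4 : ∑ x, (f x - barycenter (τ i) x) = 0 := by
          rw [Finset.sum_sub_distrib, hf.2.1, sum_barycenter (hne i), sub_self]
        ext x
        have := (Finset.sum_eq_zero_iff_of_nonneg fun x _ => h3 x).1 h4 x (Finset.mem_univ x)
        simp only [Set.Icc.coe_one, sub_self, zero_smul, one_smul, zero_add]
        linarith
    · obtain ⟨y, y0, y1, y2, y3⟩ := exists_eq_lineMap hf.2.1 (sum_barycenter (hne i))
        ⟨_, mul_nonneg hc.le (hf.1 x₀), hle⟩ (fun h => h1 (congrArg Subtype.val h)) hb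
      refine ⟨y, ⟨y0, y1, ?_⟩, _, y3⟩
      refine Set.ssubset_iff_subset_ne.2 ⟨fun x hx => ?_, fun h => ?_⟩
      · by_contra hxi
        rw [y2] at hx
        refine hx ?_
        have : f x = 0 := by
          by_contra h'
          exact hxi (hs ▸ h')
        simp only [SetLike.mem_coe] at hxi
        simp [barycenter, hxi, this]
      · have : x₀ ∈ Function.support y := h ▸ hx₀
        rw [y2] at this
        refine this ?_
        simp only [barycenter, hx₀, if_true]
        field_simp
  · intro i y hy s
    obtain ⟨x, hx, hxy⟩ := Set.not_subset.1 hy.2.2.not_subset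
    exact card_mul_inf'_lineMap (hne i) hy.1 hx (by simpa using hxy) s
  · intro i f hf
    exact hzero i f hf.1 (hf.2.2.2 i)
  · intro i j hij y hy s
    refine hzero i _ (fun x => ?_) fun h => hij ?_
    · exact add_nonneg (mul_nonneg (sub_nonneg.2 s.2.2) (hy.1 x))
        (mul_nonneg s.2.1 (barycenter_nonneg _ x))
    · refine hinj (Finset.coe_injective ?_)
      refine (hmax i _ (hτ j) (h.trans ((support_lineMap _ _ s).trans ?_))).symm
      rw [support_barycenter, Set.union_eq_self_of_subset_left hy.2.2.subset]

end geom

end Geom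

section Spheres

/-- The map `p` exhibits `X` as the cone over `B` with its base collapsed to the point `pt`. -/
structure IsConeQuotient {B X : Type} [TopologicalSpace B] [TopologicalSpace X] (pt : X)
    (p : C(B × I, X)) : Prop where
  surjective : Function.Surjective p
  map_zero : ∀ y, p (y, 0) = pt
  map_one : ∀ y y', p (y, 1) = p (y', 1)
  injective : ∀ y y' s s', p (y, s) = p (y', s') → s = s' ∧ (s = 0 ∨ s = 1 ∨ y = y')

lemma cos_pi_mul_injective {s s' : I} (h : Real.cos (Real.pi * s) = Real.cos (Real.pi * s')) :
    s = s' := by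
  have hpi := Real.pi_pos
  have mem : ∀ s : I, Real.pi * s ∈ Set.Icc 0 Real.pi := fun s =>
    ⟨mul_nonneg hpi.le s.2.1, by nlinarith [s.2.2]⟩
  exact Subtype.ext (mul_left_cancel₀ hpi.ne' (Real.injOn_cos (mem s) (mem s') h))

lemma sin_pi_mul_eq_zero {s : I} (h : Real.sin (Real.pi * s) = 0) : s = 0 ∨ s = 1 := by
  have hpi := Real.pi_pos
  rcases Real.sin_eq_zero_iff_cos_eq.1 h with h | h
  · exact Or.inl (cos_pi_mul_injective (by simpa using h))
  · exact Or.inr (cos_pi_mul_injective (by simpa using h))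

lemma exists_cos_pi_mul {x : ℝ} (h : x ^ 2 ≤ 1) :
    ∃ s : I, Real.cos (Real.pi * s) = x ∧ Real.sin (Real.pi * s) = √(1 - x ^ 2) := by
  have hpi := Real.pi_pos
  have h1 := abs_le.1 ((sq_le_one_iff_abs_le_one x).1 h)
  refine ⟨⟨Real.arccos x / Real.pi, div_nonneg (Real.arccos_nonneg x) hpi.le,
    (div_le_one hpi).2 (Real.arccos_le_pi x)⟩, ?_⟩
  rw [mul_div_cancel₀ _ hpi.ne']
  exact ⟨Real.cos_arccos h1.1 h1.2, Real.sin_arccos x⟩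

variable {V : Type} [Fintype V] [DecidableEq V]

omit [DecidableEq V] in
lemma mem_geom_boundary {τ : Finset V} {f : V → ℝ} (hf : f ∈ geom {s | s ⊂ (τ : Set V)}) :
    (∀ x ∉ τ, f x = 0) ∧ ∑ x ∈ τ, f x = 1 ∧ ∃ x ∈ τ, f x = 0 := by
  have hss : Function.support f ⊂ (τ : Set V) := hf.2.2
  have h0 : ∀ x ∉ τ, f x = 0 := fun x hx => by_contra fun h => hx (by simpa using hss.subset h)
  refine ⟨h0, ?_, ?_⟩
  · rw [← hf.2.1, ← Finset.sum_subset (Finset.subset_univ τ)]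
    exact fun x _ hx => h0 x hx
  · obtain ⟨x, hx, h⟩ := Set.not_subset.1 hss.not_subset
    exact ⟨x, hx, by simpa using h⟩

lemma exists_isConeQuotient_circle {τ : Finset V} (hτ : τ.card = 2) :
    ∃ p : C(geom {s | s ⊂ (τ : Set V)} × I, Circle), IsConeQuotient 1 p := by
  obtain ⟨a, b, hab, rfl⟩ := Finset.card_eq_two.1 hτ
  have hev : ∀ c : V, Continuous fun z : geom {s | s ⊂ (({a, b} : Finset V) : Set V)} × I =>
      (z.1 : V → ℝ) c := fun c =>
    (continuous_apply c).comp (continuous_subtype_val.comp continuous_fst)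
  have hdich : ∀ f ∈ geom {s | s ⊂ (({a, b} : Finset V) : Set V)},
      (f a = 1 ∧ f b = 0) ∨ (f a = 0 ∧ f b = 1) := by
    intro f hf
    obtain ⟨-, h1, x, hx, h2⟩ := mem_geom_boundary hf
    rw [Finset.sum_pair hab] at h1
    rcases Finset.mem_insert.1 hx with rfl | hx
    · exact Or.inr ⟨h2, by linarith⟩
    · rw [Finset.mem_singleton.1 hx] at h2
      exact Or.inl ⟨by linarith, h2⟩
  have hmem : ∀ c d : V, c ≠ d → ({a, b} : Finset V) = {c, d} →
      Pi.single c (1 : ℝ) ∈ geom {s | s ⊂ (({a, b} : Finset V) : Set V)} := by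
    intro c d hcd h
    refine geom.single_mem ?_
    rw [h]
    refine Set.ssubset_iff_exists.2 ⟨by simp, d, by simp, by simp [hcd.symm]⟩
  have hcoe : ∀ t : ℝ, ((Circle.exp t : Circle) : ℂ) = ⟨Real.cos t, Real.sin t⟩ := by
    intro t
    rw [Circle.coe_exp]
    apply Complex.ext <;> simp [Complex.exp_ofReal_mul_I_re, Complex.exp_ofReal_mul_I_im]
  refine ⟨⟨fun z => Circle.exp (Real.pi * z.2 * ((z.1 : V → ℝ) a - (z.1 : V → ℝ) b)),
    Circle.exp.continuous.comp (by fun_prop)⟩, ?_, ?_, ?_, ?_⟩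
  · intro z
    have hz : (z : ℂ).re ^ 2 + (z : ℂ).im ^ 2 = 1 := by
      have := z.normSq_coe
      rw [Complex.normSq_apply] at this
      nlinarith
    obtain ⟨s, hs1, hs2⟩ := exists_cos_pi_mul (x := (z : ℂ).re) (by nlinarith)
    rw [show 1 - (z : ℂ).re ^ 2 = (z : ℂ).im ^ 2 by linarith, Real.sqrt_sq_eq_abs] at hs2
    rcases le_total 0 (z : ℂ).im with h | h
    · refine ⟨(⟨_, hmem a b hab rfl⟩, s), ?_⟩
      apply Circle.ext
      rw [abs_of_nonneg h] at hs2
      simp only [ContinuousMap.coe_mk, hcoe]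
      apply Complex.ext <;> simp [hab.symm, hs1, hs2]
    · refine ⟨(⟨_, hmem b a hab.symm (Finset.pair_comm a b)⟩, s), ?_⟩
      apply Circle.ext
      rw [abs_of_nonpos h] at hs2
      simp only [ContinuousMap.coe_mk, hcoe]
      apply Complex.ext <;> simp [hab, hs1, hs2]
  · intro y
    simp
  · intro y y'
    apply Circle.ext
    simp only [ContinuousMap.coe_mk, hcoe]
    rcases hdich y y.2 with h | h <;> rcases hdich y' y'.2 with h' | h' <;>
      simp [h.1, h.2, h'.1, h'.2]
  · intro y y' s s' e
    have e' := congrArg (fun z : Circle => (z : ℂ)) e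
    simp only [ContinuousMap.coe_mk, hcoe, Complex.mk.injEq] at e'
    have hs : s = s' := by
      refine cos_pi_mul_injective ?_
      rcases hdich y y.2 with h | h <;> rcases hdich y' y'.2 with h' | h' <;>
        simpa [h.1, h.2, h'.1, h'.2] using e'.1
    subst hs
    refine ⟨rfl, ?_⟩
    by_cases h0 : Real.sin (Real.pi * s) = 0
    · exact (sin_pi_mul_eq_zero h0).imp_right Or.inl
    have hab' : (y : V → ℝ) a = (y' : V → ℝ) a ∧ (y : V → ℝ) b = (y' : V → ℝ) b := by
      rcases hdich y y.2 with h | h <;> rcases hdich y' y'.2 with h' | h'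
      · simp [h, h']
      · exact (h0 (by have := e'.2; simp [h.1, h.2, h'.1, h'.2] at this; linarith)).elim
      · exact (h0 (by have := e'.2; simp [h.1, h.2, h'.1, h'.2] at this; linarith)).elim
      · simp [h, h']
    refine Or.inr (Or.inr (Subtype.ext (funext fun x => ?_)))
    by_cases hxa : x = a
    · rw [hxa, hab'.1]
    by_cases hxb : x = b
    · rw [hxb, hab'.2]
    rw [(mem_geom_boundary y.2).1 x (by simp [hxa, hxb]),
      (mem_geom_boundary y'.2).1 x (by simp [hxa, hxb])]

lemma exists_isConeQuotient_twoSphere {τ : Finset V} (hτ : τ.card = 3) :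
    ∃ p : C(geom {s | s ⊂ (τ : Set V)} × I, TwoSphere), IsConeQuotient TwoSphere.pt p := by
  obtain ⟨a, b, c, hab, hac, hbc, rfl⟩ := Finset.card_eq_three.1 hτ
  set B := geom {s | s ⊂ (({a, b, c} : Finset V) : Set V)} with hB
  have hsum : ∀ f ∈ B, f a + f b + f c = 1 ∧ (f a = 0 ∨ f b = 0 ∨ f c = 0) := by
    intro f hf
    obtain ⟨-, h1, h2⟩ := mem_geom_boundary hf
    rw [Finset.sum_insert (by simp [hab, hac]), Finset.sum_pair hbc] at h1
    exact ⟨by linarith, by simpa using h2⟩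
  have hev : ∀ d : V, Continuous fun z : B × I => (z.1 : V → ℝ) d := fun d =>
    (continuous_apply d).comp (continuous_subtype_val.comp continuous_fst)
  let N : (V → ℝ) → ℝ := fun f => √((f a - f c) ^ 2 + (f b - f c) ^ 2)
  have hN : ∀ f ∈ B, 0 < (f a - f c) ^ 2 + (f b - f c) ^ 2 := by
    intro f hf
    obtain ⟨h1, h2⟩ := hsum f hf
    by_contra! h
    have e1 : f a - f c = 0 := by nlinarith [sq_nonneg (f a - f c), sq_nonneg (f b - f c)]
    have e2 : f b - f c = 0 := by nlinarith [sq_nonneg (f a - f c), sq_nonneg (f b - f c)]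
    rcases h2 with h2 | h2 | h2 <;> linarith
  have hNp : ∀ f ∈ B, 0 < N f := fun f hf => Real.sqrt_pos.2 (hN f hf)
  have hNs : ∀ f ∈ B, N f ^ 2 = (f a - f c) ^ 2 + (f b - f c) ^ 2 := fun f hf =>
    Real.sq_sqrt (hN f hf).le
  have hNc : Continuous fun z : B × I => N z.1 := by
    have := hev a
    have := hev b
    have := hev c
    fun_prop
  have hsph : ∀ x y z : ℝ, x ^ 2 + y ^ 2 + z ^ 2 = 1 →
      !₂[x, y, z] ∈ Metric.sphere (0 : EuclideanSpace ℝ (Fin 3)) 1 := by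
    intro x y z h
    simp [EuclideanSpace.norm_eq, Fin.sum_univ_three, h]
  let p : C(B × I, TwoSphere) :=
    ⟨fun z => ⟨!₂[Real.cos (Real.pi * z.2),
      Real.sin (Real.pi * z.2) * ((((z.1 : V → ℝ) a - (z.1 : V → ℝ) c)) / N z.1),
      Real.sin (Real.pi * z.2) * ((((z.1 : V → ℝ) b - (z.1 : V → ℝ) c)) / N z.1)], hsph _ _ _ (by
        have h1 := hNs z.1 z.1.2
        have h2 := (hNp z.1 z.1.2).ne'
        rw [mul_pow, mul_pow, div_pow, div_pow, add_assoc, ← mul_add, ← add_div, ← h1,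
          div_self (pow_ne_zero 2 h2), mul_one, Real.cos_sq_add_sin_sq])⟩, by
      have := hev a
      have := hev b
      have := hev c
      refine Continuous.subtype_mk ((PiLp.continuous_toLp 2 _).comp (continuous_pi fun i => ?_)) _
      fin_cases i
      · exact Real.continuous_cos.comp (by fun_prop)
      · refine Continuous.mul (Real.continuous_sin.comp (by fun_prop)) (Continuous.div (by fun_prop)
          hNc fun z => (hNp z.1 z.1.2).ne')
      · refine Continuous.mul (Real.continuous_sin.comp (by fun_prop)) (Continuous.div (by fun_prop)
          hNc fun z => (hNp z.1 z.1.2).ne')⟩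
  have hext : ∀ x y : TwoSphere, (x : EuclideanSpace ℝ (Fin 3)) 0 = y.1 0 → x.1 1 = y.1 1 →
      x.1 2 = y.1 2 → x = y := by
    intro x y h0 h1 h2
    ext i
    fin_cases i
    exacts [h0, h1, h2]
  have q0 : ∀ z, (p z).1 0 = Real.cos (Real.pi * z.2) := fun z => rfl
  have q1 : ∀ z, (p z).1 1 = Real.sin (Real.pi * z.2) *
      ((((z.1 : V → ℝ) a - (z.1 : V → ℝ) c)) / N z.1) := fun z => rfl
  have q2 : ∀ z, (p z).1 2 = Real.sin (Real.pi * z.2) *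
      ((((z.1 : V → ℝ) b - (z.1 : V → ℝ) c)) / N z.1) := fun z => rfl
  refine ⟨p, ?_, ?_, ?_, ?_⟩
  · intro x
    have hx : x.1 0 ^ 2 + x.1 1 ^ 2 + x.1 2 ^ 2 = 1 := by
      have := x.2
      rw [mem_sphere_zero_iff_norm, EuclideanSpace.norm_eq, Real.sqrt_eq_one,
        Fin.sum_univ_three] at this
      simpa using this
    generalize h0 : x.1 0 = x0 at hx
    generalize h1 : x.1 1 = x1 at hx
    generalize h2 : x.1 2 = x2 at hx
    obtain ⟨s, hs1, hs2⟩ := exists_cos_pi_mul (x := x0) (by nlinarith [sq_nonneg x1, sq_nonneg x2])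
    rw [show 1 - x0 ^ 2 = x1 ^ 2 + x2 ^ 2 by linarith] at hs2
    by_cases hr : x1 ^ 2 + x2 ^ 2 = 0
    · have e1 : x1 = 0 := by nlinarith [sq_nonneg x1, sq_nonneg x2]
      have e2 : x2 = 0 := by nlinarith [sq_nonneg x1, sq_nonneg x2]
      rw [hr, Real.sqrt_zero] at hs2
      refine ⟨(⟨Pi.single a 1, geom.single_mem ?_⟩, s), ?_⟩
      · exact Set.ssubset_iff_exists.2 ⟨by simp, b, by simp, by simp [hab.symm]⟩
      · apply hext <;> simp [q0, q1, q2, h0, h1, h2, hs1, hs2, e1, e2]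
    · obtain ⟨m, hm1, hm2, hm0, hm⟩ : ∃ m, m ≤ x1 ∧ m ≤ x2 ∧ m ≤ 0 ∧
          (x1 - m = 0 ∨ x2 - m = 0 ∨ -m = 0) := by
        rcases le_total x1 x2 with h | h <;> rcases le_total x1 0 with h' | h' <;>
          rcases le_total x2 0 with h'' | h''
        all_goals first
          | exact ⟨x1, by linarith, by linarith, by linarith, Or.inl (by linarith)⟩
          | exact ⟨x2, by linarith, by linarith, by linarith, Or.inr (Or.inl (by linarith))⟩
          | exact ⟨0, by linarith, by linarith, by linarith, Or.inr (Or.inr (by linarith))⟩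
      have hS : 0 < x1 + x2 - 3 * m := by
        by_contra! h
        have e1 : x1 = 0 := by linarith
        have e2 : x2 = 0 := by linarith
        exact hr (by rw [e1, e2]; norm_num)
      set S := x1 + x2 - 3 * m with hSdef
      let f : V → ℝ := fun v => if v = a then (x1 - m) / S else if v = b then (x2 - m) / S else
        if v = c then -m / S else 0
      have fa : f a = (x1 - m) / S := by simp [f]
      have fb : f b = (x2 - m) / S := by simp [f, hab.symm]
      have fc : f c = -m / S := by simp [f, hac.symm, hbc.symm]
      have fo : ∀ v, v ≠ a → v ≠ b → v ≠ c → f v = 0 := fun v h h' h'' => by simp [f, h, h', h'']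
      have hf : f ∈ B := by
        refine ⟨fun v => ?_, ?_, ?_⟩
        · simp only [f]
          split_ifs
          · exact div_nonneg (by linarith) hS.le
          · exact div_nonneg (by linarith) hS.le
          · exact div_nonneg (by linarith) hS.le
          · exact le_rfl
        · rw [← Finset.sum_subset (Finset.subset_univ {a, b, c}),
            Finset.sum_insert (by simp [hab, hac]), Finset.sum_pair hbc, fa, fb, fc]
          · field_simp
            linarith
          · intro v _ hv
            simp only [Finset.mem_insert, Finset.mem_singleton, not_or] at hv
            exact fo v hv.1 hv.2.1 hv.2.2
        · refine Set.ssubset_iff_exists.2 ⟨fun v hv => ?_, ?_⟩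
          · by_contra h
            simp only [Finset.coe_insert, Finset.coe_singleton, Set.mem_insert_iff,
              Set.mem_singleton_iff, not_or] at h
            exact hv (fo v h.1 h.2.1 h.2.2)
          · rcases hm with hm | hm | hm
            · exact ⟨a, by simp, by simp [fa, hm]⟩
            · exact ⟨b, by simp, by simp [fb, hm]⟩
            · exact ⟨c, by simp, by rw [Function.mem_support, fc, hm]; simp⟩
      have hr' : 0 < √(x1 ^ 2 + x2 ^ 2) :=
        Real.sqrt_pos.2 (lt_of_le_of_ne (by positivity) (Ne.symm hr))
      have hNf : N f = √(x1 ^ 2 + x2 ^ 2) / S := by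
        simp only [N, fa, fb, fc]
        rw [← Real.sqrt_sq hS.le, ← Real.sqrt_div' _ (sq_nonneg S), Real.sqrt_sq hS.le]
        congr 1
        field_simp
        ring
      refine ⟨(⟨f, hf⟩, s), ?_⟩
      apply hext
      · rw [q0, hs1, h0]
      · rw [q1, hs2, h1]
        simp only [hNf, fa, fc]
        field_simp
        ring
      · rw [q2, hs2, h2]
        simp only [hNf, fb, fc]
        field_simp
        ring
  · intro y
    apply hext <;> simp [q0, q1, q2, TwoSphere.pt]
  · intro y y'
    apply hext <;> simp [q0, q1, q2]
  · intro y y' s s' e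
    have hs : s = s' := cos_pi_mul_injective (by rw [← q0 (y, s), e, q0])
    subst hs
    refine ⟨rfl, ?_⟩
    by_cases h0 : Real.sin (Real.pi * s) = 0
    · exact (sin_pi_mul_eq_zero h0).imp_right Or.inl
    have e1 := q1 (y, s)
    rw [e, q1] at e1
    have e2 := q2 (y, s)
    rw [e, q2] at e2
    replace e1 := mul_left_cancel₀ h0 e1
    replace e2 := mul_left_cancel₀ h0 e2
    refine Or.inr (Or.inr (Subtype.ext (funext fun x => ?_)))
    obtain ⟨f, hf⟩ := y
    obtain ⟨g, hg⟩ := y'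
    simp only at e1 e2 ⊢
    have hNf := hNp f hf
    have hNg := hNp g hg
    obtain ⟨k, hk, hka, hkb⟩ : ∃ k > 0, f a - f c = k * (g a - g c) ∧
        f b - f c = k * (g b - g c) := by
      refine ⟨N f / N g, div_pos hNf hNg, ?_, ?_⟩
      · rw [div_mul_eq_mul_div, mul_div_assoc, e1, mul_div_cancel₀ _ hNf.ne']
      · rw [div_mul_eq_mul_div, mul_div_assoc, e2, mul_div_cancel₀ _ hNf.ne']
    obtain ⟨f1, f2⟩ := hsum f hf
    obtain ⟨g1, g2⟩ := hsum g hg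
    have hkg : ∀ v, 0 ≤ k * g v := fun v => mul_nonneg hk.le (hg.1 v)
    have ht : f c - k * g c = 0 := by
      refine le_antisymm ?_ ?_
      · rcases f2 with h | h | h
        · linarith [hkg a]
        · linarith [hkg b]
        · linarith [hkg c]
      · rcases g2 with h | h | h
        · have := hf.1 a
          rw [h] at hka
          linarith
        · have := hf.1 b
          rw [h] at hkb
          linarith
        · have := hf.1 c
          rw [h]
          linarith
    have k1 : k = 1 := by
      have : k * (g a + g b + g c) = 1 := by linarith
      rwa [g1, mul_one] at this
    subst k1
    by_cases hxa : x = a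
    · rw [hxa]; linarith
    by_cases hxb : x = b
    · rw [hxb]; linarith
    by_cases hxc : x = c
    · rw [hxc]; linarith
    rw [(mem_geom_boundary hf).1 x (by simp [hxa, hxb, hxc]),
      (mem_geom_boundary hg).1 x (by simp [hxa, hxb, hxc])]

end Spheres

/-- A wedge indexed by a sum is the wedge of the two partial wedges. -/
theorem nonempty_homeomorph_wedge {ι κ : Type} (X : ι ⊕ κ → Type) [∀ i, TopologicalSpace (X i)]
    (pt : ∀ i, X i) :
    Nonempty (BigWedge X pt ≃ₜ Wedge (BigWedge (fun i => X (Sum.inl i)) fun i => pt (Sum.inl i))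
      (BigWedge (fun j => X (Sum.inr j)) fun j => pt (Sum.inr j)) BigWedge.base BigWedge.base) := by
  set L := BigWedge (fun i => X (Sum.inl i)) fun i => pt (Sum.inl i)
  set R := BigWedge (fun j => X (Sum.inr j)) fun j => pt (Sum.inr j)
  let fwd' : (Σ i, X i) ⊕ Unit → Wedge L R BigWedge.base BigWedge.base := Sum.elim
    (fun z => match z with
      | ⟨Sum.inl i, x⟩ => Quot.mk _ (Sum.inl (Quot.mk _ (Sum.inl ⟨i, x⟩)))
      | ⟨Sum.inr j, x⟩ => Quot.mk _ (Sum.inr (Quot.mk _ (Sum.inl ⟨j, x⟩))))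
    fun _ => Quot.mk _ (Sum.inl BigWedge.base)
  have hL : ∀ i, (Quot.mk _ (Sum.inl ⟨i, pt (Sum.inl i)⟩) : L) = BigWedge.base := fun i =>
    Quot.sound ⟨⟨i, rfl⟩, rfl⟩
  have hR : ∀ j, (Quot.mk _ (Sum.inl ⟨j, pt (Sum.inr j)⟩) : R) = BigWedge.base := fun j =>
    Quot.sound ⟨⟨j, rfl⟩, rfl⟩
  have hX : ∀ i, (Quot.mk _ (Sum.inl ⟨i, pt i⟩) : BigWedge X pt) = BigWedge.base := fun i =>
    Quot.sound ⟨⟨i, rfl⟩, rfl⟩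
  have hLR : (Quot.mk _ (Sum.inl BigWedge.base) : Wedge L R BigWedge.base BigWedge.base) =
      Quot.mk _ (Sum.inr BigWedge.base) := Quot.sound ⟨rfl, rfl⟩
  have fwd_eq : ∀ a b, ((∃ i, a = Sum.inl ⟨i, pt i⟩) ∧ b = Sum.inr ()) → fwd' a = fwd' b := by
    rintro _ _ ⟨⟨i | j, rfl⟩, rfl⟩
    · exact congrArg (fun z => Quot.mk _ (Sum.inl z)) (hL i)
    · exact (congrArg (fun z => Quot.mk _ (Sum.inr z)) (hR j)).trans hLR.symm
  have fwd_c : Continuous fwd' := by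
    refine Continuous.sumElim (continuous_sigma fun i => ?_) continuous_const
    rcases i with i | j
    · exact continuous_quot_mk.comp (continuous_inl.comp (continuous_quot_mk.comp
        (continuous_inl.comp (@continuous_sigmaMk ι (fun i => X (Sum.inl i)) _ i))))
    · exact continuous_quot_mk.comp (continuous_inr.comp (continuous_quot_mk.comp
        (continuous_inl.comp (@continuous_sigmaMk κ (fun j => X (Sum.inr j)) _ j))))
  let bl' : (Σ i, X (Sum.inl i)) ⊕ Unit → BigWedge X pt :=
    Sum.elim (fun z => Quot.mk _ (Sum.inl ⟨Sum.inl z.1, z.2⟩)) fun _ => BigWedge.base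
  have bl_eq : ∀ a b, ((∃ i, a = Sum.inl ⟨i, pt (Sum.inl i)⟩) ∧ b = Sum.inr ()) →
      bl' a = bl' b := by
    rintro _ _ ⟨⟨i, rfl⟩, rfl⟩
    exact hX _
  have bl_c : Continuous bl' := Continuous.sumElim (continuous_sigma fun i =>
    continuous_quot_mk.comp (continuous_inl.comp continuous_sigmaMk)) continuous_const
  let br' : (Σ j, X (Sum.inr j)) ⊕ Unit → BigWedge X pt :=
    Sum.elim (fun z => Quot.mk _ (Sum.inl ⟨Sum.inr z.1, z.2⟩)) fun _ => BigWedge.base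
  have br_eq : ∀ a b, ((∃ i, a = Sum.inl ⟨i, pt (Sum.inr i)⟩) ∧ b = Sum.inr ()) →
      br' a = br' b := by
    rintro _ _ ⟨⟨i, rfl⟩, rfl⟩
    exact hX _
  have br_c : Continuous br' := Continuous.sumElim (continuous_sigma fun i =>
    continuous_quot_mk.comp (continuous_inl.comp continuous_sigmaMk)) continuous_const
  let bwd' : L ⊕ R → BigWedge X pt := Sum.elim (Quot.lift bl' bl_eq) (Quot.lift br' br_eq)
  have bwd_eq : ∀ a b, (a = Sum.inl BigWedge.base ∧ b = Sum.inr BigWedge.base) →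
      bwd' a = bwd' b := by
    rintro _ _ ⟨rfl, rfl⟩
    rfl
  have bwd_c : Continuous bwd' :=
    (continuous_quot_lift bl_eq bl_c).sumElim (continuous_quot_lift br_eq br_c)
  refine ⟨{ toFun := Quot.lift fwd' fwd_eq
            invFun := Quot.lift bwd' bwd_eq
            left_inv := ?_
            right_inv := ?_
            continuous_toFun := continuous_quot_lift fwd_eq fwd_c
            continuous_invFun := continuous_quot_lift bwd_eq bwd_c }⟩
  · rintro ⟨⟨i | j, x⟩ | ⟨⟩⟩ <;> rfl
  · rintro ⟨⟨⟨i, x⟩ | ⟨⟩⟩ | ⟨⟨j, x⟩ | ⟨⟩⟩⟩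
    · rfl
    · rfl
    · rfl
    · exact hLR

namespace geom

variable {V : Type} [Fintype V] [DecidableEq V]

theorem homotopyEquiv_bigWedge {ι : Type} [Finite ι] {K : Set (Set V)} (hK : IsLowerSet K)
    (τ : ι → Finset V) (hn : ∀ i, (τ i).Nontrivial) (hτ : ∀ i, (τ i : Set V) ∈ K)
    (hmax : ∀ i, ∀ s ∈ K, (τ i : Set V) ⊆ s → s = τ i) (hinj : Function.Injective τ)
    (hT : ContractibleSpace (geom {s ∈ K | ∀ i, ¬ (τ i : Set V) ⊆ s}))
    (X : ι → Type) [∀ i, TopologicalSpace (X i)] [∀ i, T2Space (X i)] (pt : ∀ i, X i)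
    (hp : ∀ i, ∃ p : C(geom {s | s ⊂ (τ i : Set V)} × I, X i), IsConeQuotient (pt i) p) :
    Nonempty (ContinuousMap.HomotopyEquiv (geom K) (BigWedge X pt)) := by
  choose p hp using hp
  exact (coneAttach hK τ hn hτ hmax hinj).homotopyEquiv_bigWedge hT X pt p
    (fun i => (hp i).surjective) (fun i => (hp i).map_zero) (fun i => (hp i).map_one)
    fun i => (hp i).injective

/-- A complex obtained from a contractible one by attaching edges and triangles along their
boundaries is homotopy equivalent to a wedge of circles and `2`-spheres. -/
theorem homotopyEquiv_wedge {ι κ : Type} [Finite ι] [Finite κ] {K : Set (Set V)}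
    (hK : IsLowerSet K) (τ : ι ⊕ κ → Finset V) (h2 : ∀ i, (τ (Sum.inl i)).card = 2)
    (h3 : ∀ j, (τ (Sum.inr j)).card = 3) (hτ : ∀ i, (τ i : Set V) ∈ K)
    (hmax : ∀ i, ∀ s ∈ K, (τ i : Set V) ⊆ s → s = τ i) (hinj : Function.Injective τ)
    (hT : ContractibleSpace (geom {s ∈ K | ∀ i, ¬ (τ i : Set V) ⊆ s})) :
    Nonempty (ContinuousMap.HomotopyEquiv (geom K)
      (Wedge (BigWedge (fun _ : ι => Circle) fun _ => 1)
        (BigWedge (fun _ : κ => TwoSphere) fun _ => TwoSphere.pt)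
        BigWedge.base BigWedge.base)) := by
  let X : ι ⊕ κ → Type := Sum.elim (fun _ => Circle) fun _ => TwoSphere
  let instX : ∀ i, TopologicalSpace (X i) :=
    Sum.rec (fun _ => (inferInstance : TopologicalSpace Circle))
      fun _ => (inferInstance : TopologicalSpace TwoSphere)
  have instT : ∀ i, T2Space (X i) :=
    Sum.rec (fun _ => (inferInstance : T2Space Circle)) fun _ => (inferInstance : T2Space TwoSphere)
  let pt : ∀ i, X i := Sum.rec (fun _ => (1 : Circle)) fun _ => TwoSphere.pt
  have hn : ∀ i, (τ i).Nontrivial := by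
    rintro (i | j)
    · exact Finset.one_lt_card_iff_nontrivial.1 (by simp [h2])
    · exact Finset.one_lt_card_iff_nontrivial.1 (by simp [h3])
  have hp : ∀ i, ∃ p : C(geom {s | s ⊂ (τ i : Set V)} × I, X i), IsConeQuotient (pt i) p := by
    rintro (i | j)
    · exact exists_isConeQuotient_circle (h2 i)
    · exact exists_isConeQuotient_twoSphere (h3 j)
  obtain ⟨e⟩ := @homotopyEquiv_bigWedge V _ _ _ _ K hK τ hn hτ hmax hinj hT X instX instT pt hp
  obtain ⟨e'⟩ := nonempty_homeomorph_wedge X pt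
  exact ⟨e.trans e'.toHomotopyEquiv⟩

end geom

end Topology

section Poset

variable {P : Type} [PartialOrder P] [Fintype P]

/-- An increasing monotone self-map of a finite poset induces a map of order complexes homotopic to
the identity. -/
theorem geom.homotopic_id_of_le {S : Set P} {c : P → P} (hS : Set.MapsTo c S S)
    (hc : MonotoneOn c S) (hle : ∀ x ∈ S, x ≤ c x)
    (G : C(geom {s : Set P | s ⊆ S ∧ IsChain (· ≤ ·) s},
      geom {s : Set P | s ⊆ S ∧ IsChain (· ≤ ·) s}))
    (hG : ∀ z, Function.support (G z : P → ℝ) = c '' Function.support (z : P → ℝ)) :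
    G.Homotopic (ContinuousMap.id _) := by
  classical
  let K := {s : Set P | s ⊆ S ∧ IsChain (· ≤ ·) s}
  have hlow : IsLowerSet K := fun s t hst hs => ⟨hst.trans hs.1, hs.2.mono hst⟩
  let r (x : P) : ℕ := (Set.Iic x).ncard
  have hr : ∀ {x y : P}, x < y → r x < r y := fun h =>
    Set.ncard_lt_ncard (Set.Iic_ssubset_Iic.2 h)
  let d (n : ℕ) (x : P) : P := if n ≤ r x then c x else x
  have hdS : ∀ n, Set.MapsTo (d n) S S := fun n x hx => by
    by_cases h : n ≤ r x
    · simpa [d, h] using hS hx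
    · simpa [d, h] using hx
  have hd : ∀ n m, n ≤ m → m ≤ n + 1 → ∀ x ∈ S, ∀ y ∈ S, x ≤ y →
      d m x ≤ d n y ∧ (d n x ≤ d m y ∨ d m y ≤ d n x) := by
    intro n m hnm hmn x hx y hy hxy
    have hcxy := hc hx hy hxy
    rcases hxy.eq_or_lt with rfl | hlt
    · have : d m x ≤ d n x := by
        by_cases h1 : m ≤ r x
        · simp [d, h1, hnm.trans h1]
        · by_cases h2 : n ≤ r x <;> simp [d, h1, h2, hle x hx]
      exact ⟨this, Or.inr this⟩
    · have := hr hlt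
      constructor
      · by_cases h1 : m ≤ r x
        · simpa [d, h1, show n ≤ r y by omega] using hcxy
        · by_cases h2 : n ≤ r y
          · simpa [d, h1, h2] using hxy.trans (hle y hy)
          · simpa [d, h1, h2] using hxy
      · left
        by_cases h1 : n ≤ r x
        · simpa [d, h1, show m ≤ r y by omega] using hcxy
        · by_cases h2 : m ≤ r y
          · simpa [d, h1, h2] using hxy.trans (hle y hy)
          · simpa [d, h1, h2] using hxy
  have hchain : ∀ n m, n ≤ m → m ≤ n + 1 → ∀ s ∈ K, d n '' s ∪ d m '' s ∈ K := by
    intro n m hnm hmn s hs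
    refine ⟨?_, ?_⟩
    · rintro _ (⟨x, hx, rfl⟩ | ⟨x, hx, rfl⟩)
      exacts [hdS n (hs.1 hx), hdS m (hs.1 hx)]
    · have hn := fun x (hx : x ∈ s) y (hy : y ∈ s) (h : x ≤ y) =>
        (hd n n le_rfl (by omega) x (hs.1 hx) y (hs.1 hy) h).1
      have hm := fun x (hx : x ∈ s) y (hy : y ∈ s) (h : x ≤ y) =>
        (hd m m le_rfl (by omega) x (hs.1 hx) y (hs.1 hy) h).1
      have hnm' := fun x (hx : x ∈ s) y (hy : y ∈ s) (h : x ≤ y) =>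
        hd n m hnm hmn x (hs.1 hx) y (hs.1 hy) h
      rintro _ (⟨x, hx, rfl⟩ | ⟨x, hx, rfl⟩) _ (⟨y, hy, rfl⟩ | ⟨y, hy, rfl⟩) - <;>
        rcases hs.2.total hx hy with h | h
      · exact Or.inl (hn x hx y hy h)
      · exact Or.inr (hn y hy x hx h)
      · exact (hnm' x hx y hy h).2
      · exact Or.inr (hnm' y hy x hx h).1
      · exact Or.inl (hnm' x hx y hy h).1
      · exact (hnm' y hy x hx h).2.symm
      · exact Or.inl (hm x hx y hy h)
      · exact Or.inr (hm y hy x hx h)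
  have hmap : ∀ n, ∀ s ∈ K, d n '' s ∈ K := fun n s hs => by
    simpa using hchain n n le_rfl (by omega) s hs
  have hstep : ∀ n, G.Homotopic (geom.map (d n) (hmap n)) := by
    intro n
    induction n with
    | zero =>
      refine geom.homotopic_of_union hlow _ _ fun z => ?_
      have : d 0 = c := by ext x; simp [d]
      rw [hG, geom.support_map, this, Set.union_self, ← this]
      exact hmap 0 _ z.2.2.2
    | succ n ih =>
      refine ih.trans (geom.homotopic_of_union hlow _ _ fun z => ?_)
      rw [geom.support_map, geom.support_map]
      exact hchain n (n + 1) (by omega) le_rfl _ z.2.2.2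
  refine (hstep (Fintype.card P + 1)).trans (geom.homotopic_of_union hlow _ _ fun z => ?_)
  have : d (Fintype.card P + 1) = id := by
    ext x
    have : r x ≤ Fintype.card P := by
      simpa [Set.ncard_univ] using Set.ncard_le_ncard (Set.subset_univ (Set.Iic x))
    simp [d, show ¬ Fintype.card P + 1 ≤ r x by omega]
  rw [geom.support_map, this, Set.image_id, ContinuousMap.id_apply, Set.union_self]
  exact z.2.2.2

/-- A finite poset with a closure operator has the homotopy type of any complex which is a model
for the order complex of the closed elements. -/
theorem geom.nonempty_homotopyEquiv_of_closure {W : Type} [Fintype W] {S : Set P} {L : Set (Set W)}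
    (hL : IsLowerSet L) (φ : P → W) (ψ : W → P)
    (hφ : ∀ s : Set P, s ⊆ S → IsChain (· ≤ ·) s → φ '' s ∈ L)
    (hψ : ∀ s ∈ L, ψ '' s ⊆ S ∧ IsChain (· ≤ ·) (ψ '' s))
    (hφψ : ∀ s ∈ L, φ '' (ψ '' s) ∪ s ∈ L) (hS : Set.MapsTo (ψ ∘ φ) S S)
    (hmono : MonotoneOn (ψ ∘ φ) S) (hle : ∀ x ∈ S, x ≤ ψ (φ x)) :
    Nonempty (ContinuousMap.HomotopyEquiv (geom {s : Set P | s ⊆ S ∧ IsChain (· ≤ ·) s})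
      (geom L)) := by
  refine ⟨⟨geom.map φ fun s hs => hφ s hs.1 hs.2, geom.map ψ hψ, ?_, ?_⟩⟩
  · refine geom.homotopic_id_of_le hS hmono hle _ fun z => ?_
    rw [ContinuousMap.comp_apply, geom.support_map, geom.support_map, Set.image_comp]
  · refine geom.homotopic_of_union hL _ _ fun z => ?_
    rw [ContinuousMap.comp_apply, geom.support_map, geom.support_map]
    exact hφψ _ z.2.2.2

end Poset

namespace geom

section Cliques

variable {V : Type}

/-- The cliques of a relation which are contained in a list. -/
def cliques (r : V → V → Bool) (S : List V) : Set (Set V) :=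
  {s | (∀ x ∈ s, x ∈ S) ∧ ∀ x ∈ s, ∀ y ∈ s, r x y}

lemma isLowerSet_cliques (r : V → V → Bool) (S : List V) : IsLowerSet (cliques r S) :=
  fun _ _ h hs => ⟨fun x hx => hs.1 x (h hx), fun x hx y hy => hs.2 x (h hx) y (h hy)⟩

lemma cliques_congr (r : V → V → Bool) {S T : List V} (h : ∀ x, x ∈ S ↔ x ∈ T) :
    cliques r S = cliques r T := by
  simp [cliques, h]

variable [DecidableEq V]

/-- The neighbours of a vertex. -/
def link (r : V → V → Bool) (S : List V) (v : V) : List V :=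
  S.filter fun z => z != v && r v z

/-- Remove dominated vertices as long as possible, and test whether one vertex remains. -/
def dismantles (r : V → V → Bool) : ℕ → List V → Bool
  | 0, _ => false
  | n + 1, S => S.length == 1 ||
    match S.find? fun x => S.any fun y => y != x && S.all fun z => !r x z || r y z with
    | none => false
    | some x => dismantles r n (S.filter (· != x))

/-- Remove the given vertices one after another, and test whether the links dismantle. -/
def removable (r : V → V → Bool) : List V → List V → Bool
  | [], _ => true
  | v :: vs, S => S.contains v && dismantles r 200 (link r S v) &&
    removable r vs (S.filter (· != v))

variable [Fintype V] {r : V → V → Bool}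

omit [DecidableEq V] in
lemma contractibleSpace_cliques_of_cone (hs : ∀ x y, r x y = r y x) (hr : ∀ x, r x x) {S : List V}
    {c : V} (hc : c ∈ S) (h : ∀ x ∈ S, r c x) : ContractibleSpace (geom (cliques r S)) := by
  refine contractibleSpace_of_cone (isLowerSet_cliques r S) c ⟨by simpa, by simpa using hr c⟩ ?_
  rintro s ⟨h1, h2⟩
  refine ⟨?_, ?_⟩
  · rintro x (rfl | hx)
    exacts [hc, h1 x hx]
  · rintro x (rfl | hx) y (rfl | hy)
    exacts [hr _, h _ (h1 _ hy), hs _ _ ▸ h _ (h1 _ hx), h2 x hx y hy]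

lemma homotopyEquiv_cliques (hs : ∀ x y, r x y = r y x) (hr : ∀ x, r x x) {S : List V}
    {v : V} (hv : v ∈ S) (h : ContractibleSpace (geom (cliques r (link r S v)))) :
    Nonempty (ContinuousMap.HomotopyEquiv (geom (cliques r (S.filter (· != v))))
      (geom (cliques r S))) := by
  have e1 : {s | s ∈ cliques r S ∧ Disjoint s {v}} = cliques r (S.filter (· != v)) := by
    ext s
    simp only [cliques, Set.disjoint_singleton_right, List.mem_filter, bne_iff_ne,
      Set.mem_ofPred_eq]
    grind
  have e2 : {s | v ∉ s ∧ insert v s ∈ cliques r S} = cliques r (link r S v) := by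
    ext s
    simp only [cliques, link, Set.mem_insert_iff, List.mem_filter, Bool.and_eq_true, bne_iff_ne,
      Set.mem_ofPred_eq]
    grind
  have := homotopyEquiv_of_contractible_link (isLowerSet_cliques r S) {v} (by simp_all)
    (by simpa [cliques] using ⟨hv, hr v⟩) (by
      rintro _ rfl
      rwa [e2])
  rwa [e1] at this

theorem contractibleSpace_of_dismantles (hs : ∀ x y, r x y = r y x) (hr : ∀ x, r x x) (n : ℕ)
    {S : List V} (h : dismantles r n S) : ContractibleSpace (geom (cliques r S)) := by
  induction n generalizing S with
  | zero => simp [dismantles] at h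
  | succ n ih =>
    rw [dismantles, Bool.or_eq_true] at h
    rcases h with h | h
    · obtain ⟨c, rfl⟩ := List.length_eq_one_iff.1 (by simpa using h)
      exact contractibleSpace_cliques_of_cone hs hr (c := c) (by simp) (by simpa using hr c)
    · split at h
      · simp at h
      · rename_i x hx
        have hx1 := List.mem_of_find?_eq_some hx
        have hx2 := List.find?_some hx
        simp only [List.any_eq_true, Bool.and_eq_true, bne_iff_ne, List.all_eq_true,
          Bool.or_eq_true, Bool.not_eq_true'] at hx2
        obtain ⟨y, hy, hyx, hxy⟩ := hx2
        have := ih h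
        obtain ⟨e⟩ := homotopyEquiv_cliques hs hr hx1 (contractibleSpace_cliques_of_cone hs hr
          (c := y) (by simp only [link, List.mem_filter]; grind)
          (by simp only [link, List.mem_filter]; grind))
        exact e.symm.contractibleSpace

theorem homotopyEquiv_of_removable (hs : ∀ x y, r x y = r y x) (hr : ∀ x, r x x) {vs S : List V}
    (h : removable r vs S) : Nonempty (ContinuousMap.HomotopyEquiv
      (geom (cliques r (S.filter fun x => !vs.contains x))) (geom (cliques r S))) := by
  induction vs generalizing S with
  | nil =>
    rw [show S.filter (fun x => !([] : List V).contains x) = S by simp]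
    exact ⟨ContinuousMap.HomotopyEquiv.refl _⟩
  | cons v vs ih =>
    simp only [removable, Bool.and_eq_true, List.contains_iff_mem] at h
    obtain ⟨e⟩ := ih h.2
    obtain ⟨e'⟩ := homotopyEquiv_cliques hs hr h.1.1
      (contractibleSpace_of_dismantles hs hr _ h.1.2)
    rw [cliques_congr (T := (S.filter (· != v)).filter fun x => !vs.contains x)]
    · exact ⟨e.trans e'⟩
    · simp only [List.mem_filter]
      grind

end Cliques

end geom

namespace Lattice27

/-- The elements of `PSL(2,7)` act on the `7` points and the `7` lines of the Fano plane and on the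
`8` points of the projective line over `𝔽₇`. The `22` bits in position `i` of this number
list the members of the `i`-th set among the `134` nonempty fixed sets of nontrivial subgroups. -/
def nodeTable : ℕ :=
  871151371466939699764702437875400239769606385797688502859818513394877976395172701079797537143267409373998297726261188784068861821697687970927587545246666140518376852420647804843616573782370014354201773902577230962168329224162241553296506589905172783120878632446995504809353467760068739112790534827150263595771538690139897179272424213826897565724452485852553822564087185244121048405883136730418056269373770842882735128679999538981995094221212906386251691766874280357880621333828888143116105134840747422695147398320520202181662036599922338587451482474486234240297688625672196635482889225881711350984941936122508283780858272699159181246195773293197411430465681061492686507222639108996160777913593994542511031770564659907951626375187245701172131617329178680050526313530204500328486394814659440378807163063578703627451241794517137853659620308515334789975294514198118192466156983520759644161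

/-- The fixed set of a node, as a bit mask. -/
def mask (x : Fin 134) : ℕ :=
  nodeTable >>> (22 * x.1) % 2 ^ 22

/-- Comparability of nodes. -/
def comparable (x y : Fin 134) : Bool :=
  mask x &&& mask y == mask x || mask x &&& mask y == mask y

/-- Edges whose removal together with `triangles` makes the complex of nodes contractible. -/
def edges : List (Fin 134 × Fin 134) :=
  [(112, 89), (112, 92), (112, 97), (112, 103), (112, 105), (112, 110), (113, 91), (113, 94),
   (113, 96), (113, 102), (113, 104), (113, 110), (114, 90), (114, 92), (114, 98), (114, 101),
   (114, 107), (114, 109), (115, 90), (115, 95), (115, 96), (115, 103), (115, 106), (115, 108),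
   (116, 89), (116, 95), (116, 99), (116, 101), (116, 104), (116, 111), (117, 88), (117, 94),
   (117, 99), (117, 100), (117, 106), (117, 109), (118, 91), (118, 93), (118, 98), (118, 100),
   (118, 105), (118, 111), (119, 88), (119, 93), (119, 97), (119, 102), (119, 107), (119, 108)]

/-- Triangles whose removal together with `edges` makes the complex of nodes contractible. -/
def triangles : List (Fin 134 × Fin 134 × Fin 134) :=
  [(2, 29, 67), (2, 29, 68), (2, 29, 69), (2, 29, 83), (2, 30, 69), (2, 30, 70), (2, 30, 71), (2,
   30, 83), (2, 31, 70), (2, 31, 81), (2, 33, 71), (2, 33, 81), (4, 43, 67), (4, 43, 68), (4, 43,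
   73), (4, 43, 75), (4, 44, 72), (4, 44, 76), (4, 45, 72), (4, 45, 73), (4, 45, 74), (4, 45, 75),
   (4, 47, 74), (4, 47, 76), (5, 50, 75), (5, 50, 80), (5, 51, 70), (5, 51, 71), (5, 51, 76), (5,
   51, 78), (5, 52, 75), (5, 52, 79), (5, 54, 76), (5, 54, 78), (5, 54, 79), (5, 54, 80), (6, 57,
   80), (6, 57, 83), (6, 58, 78), (6, 58, 83), (6, 59, 73), (6, 59, 74), (6, 59, 79), (6, 59, 81),
   (6, 61, 78), (6, 61, 79), (6, 61, 80), (6, 61, 81)]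

/-- All nodes but the last `14`, which have contractible links. -/
def core : List (Fin 134) :=
  (List.finRange 134).filter (· < 120)

/-- The nodes on which all the `edges` and `triangles` are based. -/
def apexes : List (Fin 134) :=
  (List.finRange 134).filter fun x => x ∈ [2, 4, 5, 6] || 112 ≤ x && x < 120

/-- The neighbours of `v` not joined to `v` by an edge of `edges`. -/
def openLink (v : Fin 134) : List (Fin 134) :=
  (geom.link comparable core v).filter fun z => !edges.contains (v, z)

/-- Comparability of nodes which do not form a triangle of `triangles` together with `v`. -/
def openRel (v x y : Fin 134) : Bool :=
  comparable x y && !(triangles.contains (v, x, y) || triangles.contains (v, y, x))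

lemma comparable_comm (x y : Fin 134) : comparable x y = comparable y x := by
  simp only [comparable, Nat.land_comm (mask y), Bool.or_comm]

lemma comparable_self (x : Fin 134) : comparable x x := by
  simp [comparable]

lemma removable_late :
    geom.removable comparable ((List.finRange 134).filter (120 ≤ ·)) (List.finRange 134) := by
  decide +kernel

lemma dismantles_openLink : ∀ v ∈ apexes, geom.dismantles (openRel v) 200 (openLink v) := by
  decide +kernel

/-- The nodes removed after `apexes`. -/
def middle : List (Fin 134) :=
  (List.finRange 134).filter (fun x => 84 ≤ x ∧ x < 112) ++
    (List.finRange 134).filter (fun x => 28 ≤ x ∧ x < 35 ∨ 42 ≤ x ∧ x < 63) ++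
    (List.finRange 134).filter fun x => 66 ≤ x ∧ x < 84

lemma removable_middle :
    geom.removable comparable middle (core.filter fun x => !apexes.contains x) := by
  decide +kernel

lemma dismantles_rest : geom.dismantles comparable 200
    ((core.filter fun x => !apexes.contains x).filter fun x => !middle.contains x) := by
  decide +kernel

lemma edges_spec {e : Fin 134 × Fin 134} (he : e ∈ edges) : e.1 ∈ apexes ∧ e.2 ∈ core ∧
    e.2 ∉ apexes ∧ comparable e.1 e.2 := by
  have : edges.all fun e => apexes.contains e.1 && (core.contains e.2 &&
      (!apexes.contains e.2 && comparable e.1 e.2)) := by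
    decide +kernel
  simpa only [Bool.and_eq_true, List.contains_iff_mem, Bool.not_eq_true', ← Bool.not_eq_true]
    using List.all_eq_true.1 this e he

lemma edges_maximal {e : Fin 134 × Fin 134} (he : e ∈ edges) {z : Fin 134} (hz : z ∈ core)
    (h1 : comparable e.1 z) (h2 : comparable e.2 z) : z = e.1 ∨ z = e.2 := by
  have : edges.all fun e => core.all fun z =>
      !comparable e.1 z || !comparable e.2 z || z == e.1 || z == e.2 := by
    decide +kernel
  have := List.all_eq_true.1 (List.all_eq_true.1 this e he) z hz
  simpa [h1, h2] using this

lemma triangles_spec {t : Fin 134 × Fin 134 × Fin 134} (ht : t ∈ triangles) : t.1 ∈ apexes ∧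
    t.2.1 ∈ core ∧ t.2.1 ∉ apexes ∧ t.2.2 ∈ core ∧ t.2.2 ∉ apexes ∧ t.2.1 < t.2.2 ∧
    comparable t.1 t.2.1 ∧ comparable t.1 t.2.2 ∧ comparable t.2.1 t.2.2 := by
  have : triangles.all fun t => apexes.contains t.1 && (core.contains t.2.1 &&
      (!apexes.contains t.2.1 && (core.contains t.2.2 && (!apexes.contains t.2.2 &&
      (decide (t.2.1 < t.2.2) && (comparable t.1 t.2.1 && (comparable t.1 t.2.2 &&
      comparable t.2.1 t.2.2))))))) := by
    decide +kernel
  simpa only [Bool.and_eq_true, List.contains_iff_mem, Bool.not_eq_true', ← Bool.not_eq_true,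
    decide_eq_true_eq] using List.all_eq_true.1 this t ht

lemma triangles_maximal {t : Fin 134 × Fin 134 × Fin 134} (ht : t ∈ triangles) {z : Fin 134}
    (hz : z ∈ core) (h1 : comparable t.1 z) (h2 : comparable t.2.1 z) (h3 : comparable t.2.2 z) :
    z = t.1 ∨ z = t.2.1 ∨ z = t.2.2 := by
  have : triangles.all fun t => core.all fun z => !comparable t.1 z || !comparable t.2.1 z ||
      !comparable t.2.2 z || z == t.1 || z == t.2.1 || z == t.2.2 := by
    decide +kernel
  have := List.all_eq_true.1 (List.all_eq_true.1 this t ht) z hz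
  simpa [h1, h2, h3, or_assoc] using this

lemma mem_core_of_mem_apexes : ∀ v ∈ apexes, v ∈ core := by
  decide +kernel

lemma eq_of_comparable_apexes : ∀ v ∈ apexes, ∀ w ∈ apexes, comparable v w → v = w := by
  decide +kernel

lemma nodup_edges : edges.Nodup := by
  decide +kernel

lemma nodup_triangles : triangles.Nodup := by
  decide +kernel

/-- The vertex sets of `edges` and `triangles`. -/
def cell : Fin edges.length ⊕ Fin triangles.length → Finset (Fin 134) :=
  Sum.elim (fun i => {(edges.get i).1, (edges.get i).2})
    fun j => {(triangles.get j).1, (triangles.get j).2.1, (triangles.get j).2.2}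

lemma card_cell_inl (i : Fin edges.length) : (cell (Sum.inl i)).card = 2 := by
  obtain ⟨h1, h2, h3, -⟩ := edges_spec (edges.get_mem i)
  exact Finset.card_pair (by grind)

lemma card_cell_inr (j : Fin triangles.length) : (cell (Sum.inr j)).card = 3 := by
  obtain ⟨h1, h2, h3, h4, h5, h6, -⟩ := triangles_spec (triangles.get_mem j)
  exact Finset.card_eq_three.2 ⟨_, _, _, by grind, by grind, h6.ne, rfl⟩

lemma cell_mem (i) : (cell i : Set (Fin 134)) ∈ geom.cliques comparable core := by
  have hc := comparable_comm
  have hs := comparable_self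
  have ha := mem_core_of_mem_apexes
  rcases i with i | j
  · obtain ⟨h1, h2, h3, h4⟩ := edges_spec (edges.get_mem i)
    simp only [cell, geom.cliques, Sum.elim_inl, Finset.coe_insert, Finset.coe_singleton,
      Set.mem_insert_iff, Set.mem_singleton_iff, Set.mem_ofPred_eq]
    grind
  · obtain ⟨h1, h2, h3, h4, h5, h6, h7, h8, h9⟩ := triangles_spec (triangles.get_mem j)
    simp only [cell, geom.cliques, Sum.elim_inr, Finset.coe_insert, Finset.coe_singleton,
      Set.mem_insert_iff, Set.mem_singleton_iff, Set.mem_ofPred_eq]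
    grind

lemma eq_cell (i) (s) (hs : s ∈ geom.cliques comparable core) (h : (cell i : Set (Fin 134)) ⊆ s) :
    s = cell i := by
  refine Set.Subset.antisymm (fun z hz => ?_) h
  rcases i with i | j
  · simp only [cell, Sum.elim_inl, Finset.coe_insert, Finset.coe_singleton, Set.insert_subset_iff,
      Set.singleton_subset_iff, Set.mem_insert_iff, Set.mem_singleton_iff] at h ⊢
    exact edges_maximal (edges.get_mem i) (hs.1 z hz) (hs.2 _ h.1 _ hz) (hs.2 _ h.2 _ hz)
  · simp only [cell, Sum.elim_inr, Finset.coe_insert, Finset.coe_singleton, Set.insert_subset_iff,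
      Set.singleton_subset_iff, Set.mem_insert_iff, Set.mem_singleton_iff] at h ⊢
    exact triangles_maximal (triangles.get_mem j) (hs.1 z hz) (hs.2 _ h.1 _ hz) (hs.2 _ h.2.1 _ hz)
      (hs.2 _ h.2.2 _ hz)

lemma cell_injective : Function.Injective cell := by
  rintro (i | i) (j | j) h
  · congr 1
    refine nodup_edges.injective_get (Prod.ext_iff.2 ?_)
    obtain ⟨h1, h2, h3, -⟩ := edges_spec (edges.get_mem i)
    obtain ⟨h1', h2', h3', -⟩ := edges_spec (edges.get_mem j)
    simp only [cell, Sum.elim_inl, Finset.ext_iff, Finset.mem_insert, Finset.mem_singleton] at h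
    have := h (edges.get i).1
    have := h (edges.get i).2
    grind
  · simpa [card_cell_inl, card_cell_inr] using congrArg Finset.card h
  · simpa [card_cell_inl, card_cell_inr] using congrArg Finset.card h
  · congr 1
    refine nodup_triangles.injective_get (Prod.ext_iff.2 ?_)
    rw [Prod.ext_iff]
    obtain ⟨h1, -, h3, -, h5, h6, -⟩ := triangles_spec (triangles.get_mem i)
    obtain ⟨h1', -, h3', -, h5', h6', -⟩ := triangles_spec (triangles.get_mem j)
    simp only [cell, Sum.elim_inr, Finset.ext_iff, Finset.mem_insert, Finset.mem_singleton] at h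
    generalize triangles.get i = t at *
    generalize triangles.get j = t' at *
    have := h t.1
    have := h t.2.1
    have := h t.2.2
    have := h t'.2.1
    have := h t'.2.2
    grind

lemma exists_apex_mem_cell (i) : ∃ a ∈ apexes, a ∈ cell i := by
  rcases i with i | j
  · exact ⟨_, (edges_spec (edges.get_mem i)).1, by simp [cell]⟩
  · exact ⟨_, (triangles_spec (triangles.get_mem j)).1, by simp [cell]⟩

lemma forall_not_cell_subset_iff (s : Set (Fin 134)) : (∀ i, ¬ (cell i : Set (Fin 134)) ⊆ s) ↔
    (∀ e ∈ edges, e.1 ∈ s → e.2 ∉ s) ∧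
      ∀ t ∈ triangles, t.1 ∈ s → t.2.1 ∈ s → t.2.2 ∉ s := by
  simp only [List.forall_mem_iff_get, Sum.forall, cell, Sum.elim_inl, Sum.elim_inr,
    Finset.coe_insert, Finset.coe_singleton, Set.insert_subset_iff, Set.singleton_subset_iff,
    not_and]

lemma edge_notMem_iff {v : Fin 134} (hv : v ∈ apexes) {s : Set (Fin 134)}
    (hs : ∀ x ∈ s, x ≠ v ∧ comparable v x) :
    (∀ i, ¬ (cell i : Set (Fin 134)) ⊆ insert v s) ↔
    (∀ x ∈ s, (v, x) ∉ edges) ∧ ∀ x ∈ s, ∀ y ∈ s, (v, x, y) ∉ triangles := by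
  have ha : ∀ a ∈ apexes, a ∈ insert v s → a = v := by
    rintro a h (rfl | h')
    exacts [rfl, (eq_of_comparable_apexes _ hv _ h (hs a h').2).symm]
  have hn : ∀ a ∉ apexes, a ∈ insert v s → a ∈ s := by
    rintro a h (rfl | h')
    exacts [absurd hv h, h']
  rw [forall_not_cell_subset_iff]
  refine ⟨fun h => ⟨fun x hx hvx => h.1 _ hvx (Or.inl rfl) (Or.inr hx), fun x hx y hy ht =>
    h.2 _ ht (Or.inl rfl) (Or.inr hx) (Or.inr hy)⟩, fun h => ⟨?_, ?_⟩⟩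
  · rintro ⟨a, x⟩ he h1 h2
    obtain ⟨h3, -, h4, -⟩ := edges_spec he
    obtain rfl := ha a h3 h1
    exact h.1 x (hn x h4 h2) he
  · rintro ⟨a, x, y⟩ ht h1 h2 h3
    obtain ⟨h4, -, h5, -, h6, -⟩ := triangles_spec ht
    obtain rfl := ha a h4 h1
    exact h.2 x (hn x h5 h2) y (hn y h6 h3) ht

lemma link_eq {v : Fin 134} (hv : v ∈ apexes) :
    {s | v ∉ s ∧ insert v s ∈
      {s | s ∈ geom.cliques comparable core ∧ ∀ i, ¬ (cell i : Set (Fin 134)) ⊆ s}} =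
    geom.cliques (openRel v) (openLink v) := by
  have hc := comparable_comm
  have hs := comparable_self
  have ha := mem_core_of_mem_apexes v hv
  ext s
  constructor
  · rintro ⟨hvs, hs', h⟩
    have hn : ∀ x ∈ s, x ≠ v ∧ comparable v x := fun x hx =>
      ⟨fun e => hvs (e ▸ hx), hs'.2 v (Or.inl rfl) x (Or.inr hx)⟩
    rw [edge_notMem_iff hv hn] at h
    refine ⟨fun x hx => ?_, fun x hx y hy => ?_⟩
    · have := hn x hx
      have := h.1 x hx
      have := hs'.1 x (Or.inr hx)
      simp_all [openLink, geom.link]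
    · have := h.2 x hx y hy
      have := h.2 y hy x hx
      have := hs'.2 x (Or.inr hx) y (Or.inr hy)
      simp_all [openRel]
  · rintro ⟨h1, h2⟩
    simp only [openLink, geom.link, List.mem_filter, Bool.and_eq_true, bne_iff_ne,
      Bool.not_eq_true', ← Bool.not_eq_true, List.contains_iff_mem] at h1
    simp only [openRel, Bool.and_eq_true, Bool.not_eq_true', ← Bool.not_eq_true, Bool.or_eq_true,
      List.contains_iff_mem, not_or] at h2
    have hn : ∀ x ∈ s, x ≠ v ∧ comparable v x := fun x hx => (h1 x hx).1.2
    refine ⟨fun h => (hn v h).1 rfl, ⟨?_, ?_⟩, (edge_notMem_iff hv hn).2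
      ⟨fun x hx => (h1 x hx).2, fun x hx y hy => (h2 x hx y hy).2.1⟩⟩
    · rintro x (rfl | hx)
      exacts [ha, (h1 x hx).1.1]
    · rintro x (rfl | hx) y (rfl | hy)
      exacts [hs _, (hn _ hy).2, hc _ _ ▸ (hn _ hx).2, (h2 x hx y hy).1]

theorem contractibleSpace_open : ContractibleSpace (geom
    {s | s ∈ geom.cliques comparable core ∧ ∀ i, ¬ (cell i : Set (Fin 134)) ⊆ s}) := by
  have hK := geom.isLowerSet_cliques comparable core
  have hl : IsLowerSet
      {s | s ∈ geom.cliques comparable core ∧ ∀ i, ¬ (cell i : Set (Fin 134)) ⊆ s} :=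
    fun s t hst hs => ⟨hK hst hs.1, fun i h => hs.2 i (h.trans hst)⟩
  obtain ⟨e⟩ := geom.homotopyEquiv_of_contractible_link hl {v | v ∈ apexes}
    (fun s hs v hv w hw hvs hws => eq_of_comparable_apexes v hv w hw (hs.1.2 v hvs w hws))
    (fun v hv => ⟨⟨by simpa using mem_core_of_mem_apexes v hv, by simp [comparable_self]⟩,
      fun i h => by
        have := Finset.card_le_card (Finset.coe_subset_singleton.1 h)
        rcases i with i | j <;> simp [card_cell_inl, card_cell_inr] at this⟩)
    fun v hv => by
      rw [link_eq hv]
      exact geom.contractibleSpace_of_dismantles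
        (fun x y => by simp only [openRel, comparable_comm x y, Bool.or_comm])
        (fun x => by
          simp only [openRel, comparable_self, Bool.true_and, Bool.or_self, Bool.not_eq_true',
            ← Bool.not_eq_true, List.contains_iff_mem]
          exact fun h => (triangles_spec h).2.2.2.2.2.1.false)
        _ (dismantles_openLink v hv)
  have e1 : {s | s ∈ {s | s ∈ geom.cliques comparable core ∧
      ∀ i, ¬ (cell i : Set (Fin 134)) ⊆ s} ∧ Disjoint s {v | v ∈ apexes}} =
      geom.cliques comparable (core.filter fun x => !apexes.contains x) := by
    ext s
    constructor
    · rintro ⟨⟨hs, -⟩, hd⟩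
      refine ⟨fun x hx => ?_, hs.2⟩
      have := Set.disjoint_left.1 hd hx
      simp_all [hs.1 x hx]
    · rintro ⟨h1, h2⟩
      have hd : ∀ a ∈ apexes, a ∉ s := fun a ha has => by simpa [ha] using h1 a has
      refine ⟨⟨⟨fun x hx => (List.mem_filter.1 (h1 x hx)).1, h2⟩, fun i hi => ?_⟩,
        Set.disjoint_right.2 hd⟩
      obtain ⟨a, ha, hai⟩ := exists_apex_mem_cell i
      exact hd a ha (hi hai)
  rw [e1] at e
  obtain ⟨e'⟩ := geom.homotopyEquiv_of_removable comparable_comm comparable_self removable_middle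
  have := geom.contractibleSpace_of_dismantles comparable_comm comparable_self _ dismantles_rest
  exact (e'.trans e).symm.contractibleSpace

/-- The complex of chains of nodes is a wedge of `48` circles and `48` two-spheres. -/
theorem homotopyEquiv_wedge :
    Nonempty (ContinuousMap.HomotopyEquiv (geom (geom.cliques comparable (List.finRange 134)))
      (Wedge (BigWedge (fun _ : Fin 48 => Circle) fun _ => 1)
        (BigWedge (fun _ : Fin 48 => TwoSphere) fun _ => TwoSphere.pt)
        BigWedge.base BigWedge.base)) := by
  obtain ⟨e⟩ := geom.homotopyEquiv_of_removable comparable_comm comparable_self removable_late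
  rw [geom.cliques_congr (T := core)] at e
  · obtain ⟨e'⟩ := geom.homotopyEquiv_wedge (geom.isLowerSet_cliques comparable core) cell
      card_cell_inl card_cell_inr cell_mem eq_cell cell_injective contractibleSpace_open
    exact ⟨e.symm.trans e'⟩
  · simp [core]

/-- Quadruples of residues modulo `7`, standing for the matrices `!![a, b; c, d]`. -/
abbrev Code : Type := ℕ × ℕ × ℕ × ℕ

/-- The matrix product. -/
def cmul : Code → Code → Code
  | (a, b, c, d), (e, f, g, h) =>
    ((a * e + b * g) % 7, (a * f + b * h) % 7, (c * e + d * g) % 7, (c * f + d * h) % 7)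

/-- The inverse of a matrix of determinant `1`. -/
def cinv : Code → Code
  | (a, b, c, d) => (d, (7 - b) % 7, (7 - c) % 7, a)

/-- The negative of a matrix. -/
def cneg : Code → Code
  | (a, b, c, d) => ((7 - a) % 7, (7 - b) % 7, (7 - c) % 7, (7 - d) % 7)

/-- The matrices of determinant `1`, up to sign. -/
def codes : List Code :=
  [(0, 1, 6, 0), (0, 1, 6, 1), (0, 1, 6, 2), (0, 1, 6, 3), (0, 1, 6, 4), (0, 1, 6, 5), (0, 1, 6,
   6), (0, 2, 3, 0), (0, 2, 3, 1), (0, 2, 3, 2), (0, 2, 3, 3), (0, 2, 3, 4), (0, 2, 3, 5), (0, 2,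
   3, 6), (0, 3, 2, 0), (0, 3, 2, 1), (0, 3, 2, 2), (0, 3, 2, 3), (0, 3, 2, 4), (0, 3, 2, 5), (0,
   3, 2, 6), (1, 0, 0, 1), (1, 0, 1, 1), (1, 0, 2, 1), (1, 0, 3, 1), (1, 0, 4, 1), (1, 0, 5, 1),
   (1, 0, 6, 1), (1, 1, 0, 1), (1, 1, 1, 2), (1, 1, 2, 3), (1, 1, 3, 4), (1, 1, 4, 5), (1, 1, 5,
   6), (1, 1, 6, 0), (1, 2, 0, 1), (1, 2, 1, 3), (1, 2, 2, 5), (1, 2, 3, 0), (1, 2, 4, 2), (1, 2,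
   5, 4), (1, 2, 6, 6), (1, 3, 0, 1), (1, 3, 1, 4), (1, 3, 2, 0), (1, 3, 3, 3), (1, 3, 4, 6), (1,
   3, 5, 2), (1, 3, 6, 5), (1, 4, 0, 1), (1, 4, 1, 5), (1, 4, 2, 2), (1, 4, 3, 6), (1, 4, 4, 3),
   (1, 4, 5, 0), (1, 4, 6, 4), (1, 5, 0, 1), (1, 5, 1, 6), (1, 5, 2, 4), (1, 5, 3, 2), (1, 5, 4,
   0), (1, 5, 5, 5), (1, 5, 6, 3), (1, 6, 0, 1), (1, 6, 1, 0), (1, 6, 2, 6), (1, 6, 3, 5), (1, 6,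
   4, 4), (1, 6, 5, 3), (1, 6, 6, 2), (2, 0, 0, 4), (2, 0, 1, 4), (2, 0, 2, 4), (2, 0, 3, 4), (2,
   0, 4, 4), (2, 0, 5, 4), (2, 0, 6, 4), (2, 1, 0, 4), (2, 1, 1, 1), (2, 1, 2, 5), (2, 1, 3, 2),
   (2, 1, 4, 6), (2, 1, 5, 3), (2, 1, 6, 0), (2, 2, 0, 4), (2, 2, 1, 5), (2, 2, 2, 6), (2, 2, 3,
   0), (2, 2, 4, 1), (2, 2, 5, 2), (2, 2, 6, 3), (2, 3, 0, 4), (2, 3, 1, 2), (2, 3, 2, 0), (2, 3,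
   3, 5), (2, 3, 4, 3), (2, 3, 5, 1), (2, 3, 6, 6), (2, 4, 0, 4), (2, 4, 1, 6), (2, 4, 2, 1), (2,
   4, 3, 3), (2, 4, 4, 5), (2, 4, 5, 0), (2, 4, 6, 2), (2, 5, 0, 4), (2, 5, 1, 3), (2, 5, 2, 2),
   (2, 5, 3, 1), (2, 5, 4, 0), (2, 5, 5, 6), (2, 5, 6, 5), (2, 6, 0, 4), (2, 6, 1, 0), (2, 6, 2,
   3), (2, 6, 3, 6), (2, 6, 4, 2), (2, 6, 5, 5), (2, 6, 6, 1), (3, 0, 0, 5), (3, 0, 1, 5), (3, 0,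
   2, 5), (3, 0, 3, 5), (3, 0, 4, 5), (3, 0, 5, 5), (3, 0, 6, 5), (3, 1, 0, 5), (3, 1, 1, 3), (3,
   1, 2, 1), (3, 1, 3, 6), (3, 1, 4, 4), (3, 1, 5, 2), (3, 1, 6, 0), (3, 2, 0, 5), (3, 2, 1, 1),
   (3, 2, 2, 4), (3, 2, 3, 0), (3, 2, 4, 3), (3, 2, 5, 6), (3, 2, 6, 2), (3, 3, 0, 5), (3, 3, 1,
   6), (3, 3, 2, 0), (3, 3, 3, 1), (3, 3, 4, 2), (3, 3, 5, 3), (3, 3, 6, 4), (3, 4, 0, 5), (3, 4,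
   1, 4), (3, 4, 2, 3), (3, 4, 3, 2), (3, 4, 4, 1), (3, 4, 5, 0), (3, 4, 6, 6), (3, 5, 0, 5), (3,
   5, 1, 2), (3, 5, 2, 6), (3, 5, 3, 3), (3, 5, 4, 0), (3, 5, 5, 4), (3, 5, 6, 1), (3, 6, 0, 5),
   (3, 6, 1, 0), (3, 6, 2, 2), (3, 6, 3, 4), (3, 6, 4, 6), (3, 6, 5, 1), (3, 6, 6, 3)]

/-- The fixed sets of the matrices of determinant `1`. -/
def fixTable : ℕ :=
  7296764733361449803759680105928634512562228744227513457329110402899400396006030627094591347459529920564442751521322510398910337872810861440290195854749900980936939953524644350593412494626719683379729555197272908894151529046238612213043239399793041526422590136718028526866048873353609848614226210240322333251835481652230427729191391999931708861881329863596783898694413450154120080900893629668412420504114673039677343065464168228157723627803106685188529590327418958082058076408982451946845712716076466346802409320244306874708609353156912517281183976211959397506994421286217140176895204127256211804565561755129639431381895461729049060980031825722163350958015625995782084025190858018128163900937753387668103850879263181817855466684444751240962773753081675825846899031919321493472355699959907966235131783778086691289867250333730920896521600997380906559026529752624300580018747776408946218017261615676949340622289145612991545111102273734034419345846766550760752973527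554246829158549594846610303293171735257315533473853078172980614258789120646788785843324715446665003627624320088505078128139663892229704510881277682373291951110369927692580378367317656780172111043472653108335431456030250862909096218493388072625276927051802085889640102164328142108961474632296218184988712185109287721547963380485676427014927190391345781212958205177089778429376063798455058368492521123880372978162262455440779080960272062698904192779954934346694939048180659643636946057594789669956266673805051062049066435167819954017490360196236551709496588108111888065841420444679779720387678094408819112950787532396464523609531170669433308669201842619557645390652184705567842043515606823789827569306263658960006065915090410895800497263430470375522311607897450499518591837236757359271355952899966397950281276410129340100447948797053325142112749019945735760280362720256016020533935032132591390665195917218952196031921018906369004796547149072640840589001097902516912857090856785704374139025114866265989557761967626319959228527232443605438626179261014654793976128924196288159012726747538585898591740104445640107634225608085916148771183740421006414572746300703827061647899327684907425101113733752066760097253581823588687915652079782479031186681619823971591758865458762025432724892099212319100129992465319708327936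

/-- The set of fixed points, lines and points of the projective line, as a bit mask. -/
def fix : Code → ℕ
  | (a, b, c, d) => fixTable >>> (22 * if a = 0 then b * 7 + d else a * 49 + b * 7 + c) % 2 ^ 22

/-- A number which depends only on the order of the image in `PSL(2,7)`: it is `0`, `1`, `2`, `3`,
`4` for elements of order `1`, `2`, `4`, `3`, `7`. -/
def rank : Code → ℕ
  | (a, b, c, d) => if b = 0 ∧ c = 0 ∧ a = d then 0 else 54666289 >>> (4 * ((a + d) % 7)) % 16

/-- The elements whose image in `PSL(2,7)` has order `7`. -/
def sevens : List Code :=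
  codes.filter fun x => rank x == 4

lemma fix_mul : codes.all fun x => codes.all fun y =>
    fix x &&& fix y &&& fix (cmul x y) == fix x &&& fix y := by
  decide +kernel

lemma fix_inv : codes.all fun x => fix (cinv x) == fix x := by
  decide +kernel

lemma fix_neg : codes.all fun x => fix (cneg x) == fix x && rank (cneg x) == rank x := by
  decide +kernel

lemma fix_central : codes.all fun x => rank x != 0 || fix x == 2 ^ 22 - 1 := by
  decide +kernel

lemma rank_two_three : codes.all fun x => !(rank x == 2 || rank x == 3) ||
    (fix x &&& 127 != 0 && (fix x &&& 16256 != 0 && codes.all fun y =>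
      (fix x &&& 127 &&& fix y == fix x &&& 127 || fix x &&& 16256 &&& fix y == fix x &&& 16256) ||
      (decide (rank x < rank y) || (decide (rank x < rank (cmul x y)) ||
      (decide (rank x < rank (cmul (cmul (cmul y x) (cmul y x)) (cmul x y))) ||
      decide (rank x < rank (cmul (cmul (cmul y y) (cmul x y)) (cmul x y)))))))) := by
  decide +kernel

lemma rank_one : codes.all fun x => rank x != 1 || (fix x != 0 && codes.all fun y =>
    decide (1 < rank y) || (decide (1 < rank (cmul x y)) || (fix x &&& fix y == fix x ||
    (fix x &&& fix y != 0 && codes.all fun z => decide (1 < rank z) || (decide (1 < rank (cmul x z))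
    || (decide (1 < rank (cmul y z)) || (decide (1 < rank (cmul (cmul x y) z)) ||
      fix x &&& fix y &&& fix z == fix x &&& fix y))))))) := by
  decide +kernel

lemma sevens_conj : sevens.all fun x => fix x != 0 && codes.all fun y =>
    fix x &&& fix y == fix x || (rank (cmul (cmul y x) (cinv y)) == 4 &&
      fix (cmul (cmul y x) (cinv y)) != fix x) := by
  decide +kernel

/-- The powers of an element of order `7` or `14`. -/
def powers (x : Code) : List Code :=
  [x, cmul x x, cmul (cmul x x) x, cmul (cmul x x) (cmul x x),
    cmul (cmul (cmul x x) (cmul x x)) x, cmul (cmul (cmul x x) (cmul x x)) (cmul x x)]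

lemma sevens_eq_power : sevens.all fun x => sevens.all fun y => fix x != fix y ||
    (powers x).any fun z => y == z || y == cneg z := by
  decide +kernel

lemma sevens_generate : (List.range 8).all fun i => (List.range 8).all fun j => i == j ||
    (List.range 8).all fun k => k == i || k == j ||
      sevens.any fun x => fix x == 2 ^ (14 + i) && sevens.any fun y => fix y == 2 ^ (14 + j) &&
        (rank (cmul (cmul x y) (cinv x)) == 4 &&
          fix (cmul (cmul x y) (cinv x)) == 2 ^ (14 + k)) := by
  decide +kernel

lemma fix_sevens : sevens.all fun x => (List.range 8).any fun i => fix x == 2 ^ (14 + i) := by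
  decide +kernel

lemma codes_eq_mul_sevens : codes.all fun x => sevens.any fun y => rank (cmul y x) == 4 := by
  decide +kernel

/-- The nodes which are fixed sets of single elements. -/
def cyclicNodes : List (Fin 134) :=
  (List.finRange 134).filter fun x => codes.any fun y => fix y == mask x

lemma fix_eq_mask : codes.all fun x => rank x == 0 || cyclicNodes.any fun y => fix x == mask y := by
  decide +kernel

lemma mask_land_mask : (List.finRange 134).all fun x => cyclicNodes.all fun y =>
    mask x &&& mask y == 0 || (List.finRange 134).any fun z => mask x &&& mask y == mask z := by
  decide +kernel

lemma foldr_fix : (List.finRange 134).all fun x =>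
    (codes.filter fun y => mask x &&& fix y == mask x).foldr (fun y k => k &&& fix y)
      (2 ^ 22 - 1) == mask x := by
  decide +kernel

lemma mask_proper : (List.finRange 134).all fun x =>
    (codes.any fun y => mask x &&& fix y == mask x && rank y != 0) &&
      codes.any fun y => mask x &&& fix y != mask x := by
  decide +kernel

lemma codes_det : codes.all fun x => decide (((x.1 : ZMod 7) * x.2.2.2 - x.2.1 * x.2.2.1 = 1) ∧
    x.1 < 7 ∧ x.2.1 < 7 ∧ x.2.2.1 < 7 ∧ x.2.2.2 < 7) := by
  decide +kernel

lemma mem_codes : (List.range 7).all fun a => (List.range 7).all fun b =>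
    (List.range 7).all fun c => (List.range 7).all fun d => a * d % 7 != (1 + b * c) % 7 || (codes.contains (a, b, c, d) ||
      codes.contains (cneg (a, b, c, d))) := by
  decide +kernel

open Matrix

/-- The group `SL(2, 𝔽₇)`. -/
abbrev SL27 : Type := SpecialLinearGroup (Fin 2) (ZMod 7)

/-- The code of a matrix. -/
def code (g : SL27) : Code := ((g 0 0).val, (g 0 1).val, (g 1 0).val, (g 1 1).val)

lemma code_mul (g h : SL27) : code (g * h) = cmul (code g) (code h) := by
  simp [code, cmul, Matrix.mul_apply, Fin.sum_univ_two, ZMod.val_add,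
    ZMod.val_mul]

lemma code_inv (g : SL27) : code g⁻¹ = cinv (code g) := by
  simp [code, cinv, Matrix.adjugate_fin_two, ZMod.neg_val']

lemma code_neg (g : SL27) : code (-g) = cneg (code g) := by
  simp [code, cneg, ZMod.neg_val']

lemma code_injective : Function.Injective code := by
  intro g h e
  simp only [code, Prod.mk.injEq, (ZMod.val_injective 7).eq_iff] at e
  ext i j
  fin_cases i <;> fin_cases j <;> simp [e]

lemma exists_code_eq {x : Code} (hx : x ∈ codes) : ∃ g, code g = x := by
  obtain ⟨h, h0, h1, h2, h3⟩ := of_decide_eq_true (List.all_eq_true.1 codes_det x hx)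
  refine ⟨⟨!![(x.1 : ZMod 7), x.2.1; x.2.2.1, x.2.2.2], by rw [det_fin_two_of, h]⟩, ?_⟩
  simp [code, ZMod.val_natCast, Nat.mod_eq_of_lt, *]

lemma code_mem_or (g : SL27) : code g ∈ codes ∨ code (-g) ∈ codes := by
  have h := List.all_eq_true.1 (List.all_eq_true.1 (List.all_eq_true.1 (List.all_eq_true.1 mem_codes
    _ (List.mem_range.2 (g 0 0).val_lt)) _ (List.mem_range.2 (g 0 1).val_lt)) _
    (List.mem_range.2 (g 1 0).val_lt)) _ (List.mem_range.2 (g 1 1).val_lt)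
  have hdet := g.det_coe
  rw [det_fin_two, sub_eq_iff_eq_add] at hdet
  have hv := congrArg ZMod.val hdet
  rw [ZMod.val_mul, ZMod.val_add, ZMod.val_mul] at hv
  have h1 : (1 : ZMod 7).val = 1 := rfl
  rw [h1, Nat.add_mod_mod] at hv
  rw [code_neg]
  simpa [hv, code] using h

@[elab_as_elim]
lemma code_induction {motive : SL27 → Prop} (neg : ∀ g, motive (-g) → motive g)
    (mem : ∀ g, code g ∈ codes → motive g) (g : SL27) : motive g :=
  (code_mem_or g).elim (mem g) fun hg => neg g (mem _ hg)

/-- The mask of the fixed points of a matrix. -/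
def fixed (g : SL27) : ℕ := fix (code g)

/-- The rank of a matrix. -/
def rk (g : SL27) : ℕ := rank (code g)

@[simp] lemma fix_code (g : SL27) : fix (code g) = fixed g := rfl

@[simp] lemma rank_code (g : SL27) : rank (code g) = rk g := rfl

lemma fixed_neg_and_rk_neg (g : SL27) : fixed (-g) = fixed g ∧ rk (-g) = rk g := by
  induction g using code_induction with
  | neg g h =>
    rw [neg_neg] at h
    exact ⟨h.1.symm, h.2.symm⟩
  | mem g h => simpa [← code_neg] using List.all_eq_true.1 fix_neg _ h

@[simp] lemma fixed_neg (g : SL27) : fixed (-g) = fixed g := (fixed_neg_and_rk_neg g).1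

@[simp] lemma rk_neg (g : SL27) : rk (-g) = rk g := (fixed_neg_and_rk_neg g).2

lemma fixed_mul (g h : SL27) : fixed g &&& fixed h &&& fixed (g * h) = fixed g &&& fixed h := by
  induction g using code_induction with
  | neg g hg => simpa using hg
  | mem g hg =>
    induction h using code_induction with
    | neg h hh => simpa using hh
    | mem h hh =>
      simpa [← code_mul] using List.all_eq_true.1 (List.all_eq_true.1 fix_mul _ hg) _ hh

lemma neg_inv_eq (g : SL27) : (-g)⁻¹ = -g⁻¹ :=
  inv_eq_of_mul_eq_one_left (by simp)

lemma fixed_inv (g : SL27) : fixed g⁻¹ = fixed g := by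
  induction g using code_induction with
  | neg g hg => simpa [neg_inv_eq] using hg
  | mem g hg => simpa [← code_inv] using List.all_eq_true.1 fix_inv _ hg

lemma fixed_of_rk_eq_zero {g : SL27} (hg : rk g = 0) : fixed g = 2 ^ 22 - 1 := by
  induction g using code_induction with
  | neg g h => simpa [hg] using h
  | mem g h =>
    have h := List.all_eq_true.1 fix_central _ h
    simpa [hg] using h

lemma rk_one : rk 1 = 0 := by decide

lemma rk_le (g : SL27) : rk g ≤ 4 := by
  have h : ∀ n < 7, 54666289 >>> (4 * n) % 16 ≤ 4 := by decide
  change (if _ then 0 else _) ≤ 4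
  split_ifs
  exacts [by omega, h _ (Nat.mod_lt _ (by omega))]

lemma eq_one_or_of_rk_eq_zero {g : SL27} (hg : rk g = 0) : g = 1 ∨ g = -1 := by
  have h : ∀ n < 7, 54666289 >>> (4 * n) % 16 ≠ 0 := by decide
  have hsq : ∀ x : ZMod 7, x * x = 1 → x = 1 ∨ x = -1 := by decide
  change (if _ ∧ _ ∧ _ then 0 else _) = 0 at hg
  split_ifs at hg with h'
  · simp only [ZMod.val_eq_zero, (ZMod.val_injective 7).eq_iff] at h'
    obtain ⟨h1, h2, h3⟩ := h'
    have hdet := g.det_coe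
    rw [det_fin_two, h1, h3, zero_mul, sub_zero] at hdet
    rcases hsq _ hdet with h4 | h4
    · left
      ext i j
      fin_cases i <;> fin_cases j <;> simp [h1, h2, h3, h4]
    · right
      ext i j
      fin_cases i <;> fin_cases j <;> simp [h1, h2, h3, h4]
  · exact absurd hg (h _ (Nat.mod_lt _ (by omega)))

/-- The set of positions of the nonzero bits. -/
def bits (k : ℕ) : Set (Fin 22) := {i | k.testBit i}

lemma bits_land (k l : ℕ) : bits (k &&& l) = bits k ∩ bits l := by
  ext i
  simp [bits]

lemma bits_subset_of_land_eq {k l : ℕ} (h : k &&& l = k) : bits k ⊆ bits l := by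
  rw [← h, bits_land]
  exact Set.inter_subset_right

lemma bits_full : bits (2 ^ 22 - 1) = Set.univ := by
  ext i
  simp only [bits, Set.mem_ofPred_eq, Set.mem_univ, Nat.testBit_two_pow_sub_one,
    decide_eq_true i.2]

lemma bits_injOn {k l : ℕ} (hk : k < 2 ^ 22) (hl : l < 2 ^ 22) (h : bits k = bits l) : k = l := by
  refine Nat.eq_of_testBit_eq fun i => ?_
  by_cases hi : i < 22
  · exact Bool.eq_iff_iff.2 (Set.ext_iff.1 h ⟨i, hi⟩)
  · have := Nat.pow_le_pow_right (n := 2) (by omega) (not_lt.1 hi)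
    rw [Nat.testBit_lt_two_pow (hk.trans_le this), Nat.testBit_lt_two_pow (hl.trans_le this)]

lemma bits_nonempty {k : ℕ} (hk : k < 2 ^ 22) (h : k ≠ 0) : (bits k).Nonempty := by
  rw [Set.nonempty_iff_ne_empty]
  exact fun h' => h (bits_injOn hk (by omega) (h'.trans (by ext; simp [bits])))

lemma land_eq_of_bits_subset {k l : ℕ} (hk : k < 2 ^ 22) (h : bits k ⊆ bits l) : k &&& l = k :=
  bits_injOn (Nat.and_le_left.trans_lt hk) hk
    (by rw [bits_land, Set.inter_eq_left.2 h])

lemma mask_lt (x : Fin 134) : mask x < 2 ^ 22 := Nat.mod_lt _ (by positivity)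

lemma fixed_lt (g : SL27) : fixed g < 2 ^ 22 := Nat.mod_lt _ (by positivity)

/-- The matrices which fix a set of points. -/
def fixer (s : Set (Fin 22)) : Subgroup SL27 where
  carrier := {g | s ⊆ bits (fixed g)}
  one_mem' := by
    change s ⊆ bits (fixed 1)
    rw [fixed_of_rk_eq_zero rk_one, bits_full]
    exact Set.subset_univ s
  mul_mem' {g h} hg hh := by
    have := bits_subset_of_land_eq (fixed_mul g h)
    rw [bits_land] at this
    exact (Set.subset_inter hg hh).trans this
  inv_mem' {g} hg := by simpa [fixed_inv] using hg

lemma mem_fixer {s : Set (Fin 22)} {g : SL27} : g ∈ fixer s ↔ s ⊆ bits (fixed g) := Iff.rfl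

lemma fixed_of_rk_eq_two_or_three {g : SL27} (hg : rk g = 2 ∨ rk g = 3) (h : SL27)
    (h1 : rk h ≤ rk g) (h2 : rk (g * h) ≤ rk g) (h3 : rk (h * g * (h * g) * (g * h)) ≤ rk g)
    (h4 : rk (h * h * (g * h) * (g * h)) ≤ rk g) :
    fixed g &&& 127 ≠ 0 ∧ fixed g &&& 16256 ≠ 0 ∧
      (fixed g &&& 127 &&& fixed h = fixed g &&& 127 ∨
        fixed g &&& 16256 &&& fixed h = fixed g &&& 16256) := by
  induction g using code_induction with
  | neg g ih =>
    simpa using ih (by simpa using hg) (by simpa using h1) (by simpa using h2) (by simpa using h3)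
      (by simpa using h4)
  | mem g mg =>
    induction h using code_induction with
    | neg h ih =>
      simpa using ih (by simpa using h1) (by simpa using h2) (by simpa using h3) (by simpa using h4)
    | mem h mh =>
      have h := List.all_eq_true.1 rank_two_three _ mg
      simp only [fix_code, rank_code, List.all_eq_true, Bool.or_eq_true, Bool.and_eq_true,
        Bool.not_eq_true', bne_iff_ne, beq_iff_eq, decide_eq_true_eq, Bool.or_eq_false_iff,
        beq_eq_false_iff_ne, ← not_le] at h
      have h' := h.resolve_left (by tauto)
      refine ⟨h'.1, h'.2.1, (h'.2.2 _ mh).resolve_right ?_⟩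
      simp only [← code_mul, rank_code, not_or, not_not]
      exact ⟨h1, h2, h3, h4⟩

lemma fixed_of_rk_eq_one {x : SL27} (hx : rk x = 1) : fixed x ≠ 0 ∧
    ∀ y, rk y ≤ 1 → rk (x * y) ≤ 1 → fixed x &&& fixed y = fixed x ∨ fixed x &&& fixed y ≠ 0 ∧
      ∀ z, rk z ≤ 1 → rk (x * z) ≤ 1 → rk (y * z) ≤ 1 → rk (x * y * z) ≤ 1 →
        fixed x &&& fixed y &&& fixed z = fixed x &&& fixed y := by
  induction x using code_induction with
  | neg x ih => simpa using ih (by simpa using hx)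
  | mem x mx =>
    have h := List.all_eq_true.1 rank_one _ mx
    simp only [fix_code, rank_code, List.all_eq_true, Bool.or_eq_true, Bool.and_eq_true,
      bne_iff_ne, beq_iff_eq, decide_eq_true_eq, ← not_le] at h
    have h' := h.resolve_left (by tauto)
    refine ⟨h'.1, fun y => ?_⟩
    induction y using code_induction with
    | neg y ih => simpa using ih
    | mem y my =>
      intro hy hxy
      have h3 := h'.2 _ my
      simp only [← code_mul, fix_code, rank_code] at h3
      refine ((h3.resolve_left (by tauto)).resolve_left (by tauto)).imp_right
        fun h2 => ⟨h2.1, fun z => ?_⟩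
      induction z using code_induction with
      | neg z ih => simpa using ih
      | mem z mz =>
        have := h2.2 _ mz
        simp only [← code_mul, fix_code, rank_code] at this
        tauto

lemma conj_of_rk_eq_four {x : SL27} (hx : rk x = 4) : fixed x ≠ 0 ∧ ∀ y,
    fixed x &&& fixed y = fixed x ∨ rk (y * x * y⁻¹) = 4 ∧ fixed (y * x * y⁻¹) ≠ fixed x := by
  induction x using code_induction with
  | neg x ih => simpa using ih (by simpa using hx)
  | mem x mx =>
    have h := List.all_eq_true.1 sevens_conj _ (List.mem_filter.2 ⟨mx, by simpa using hx⟩)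
    simp only [Bool.and_eq_true, Bool.or_eq_true, List.all_eq_true, bne_iff_ne, beq_iff_eq] at h
    refine ⟨h.1, fun y => ?_⟩
    induction y using code_induction with
    | neg y ih => simpa [neg_inv_eq] using ih
    | mem y my => simpa [← code_mul, ← code_inv] using h.2 _ my

lemma exists_fixed_eq_two_pow {x : SL27} (hx : rk x = 4) : ∃ i < 8, fixed x = 2 ^ (14 + i) := by
  induction x using code_induction with
  | neg x ih => simpa using ih (by simpa using hx)
  | mem x mx =>
    simpa using List.all_eq_true.1 fix_sevens _ (List.mem_filter.2 ⟨mx, by simpa using hx⟩)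

lemma mem_of_fixed_eq {H : Subgroup SL27} (hH : -1 ∈ H) {x y : SL27} (hx : rk x = 4) (hy : rk y = 4)
    (hxy : fixed x = fixed y) (hxH : x ∈ H) : y ∈ H := by
  have hneg : ∀ {z : SL27}, -z ∈ H ↔ z ∈ H := fun {z} => by
    rw [← neg_one_mul, H.mul_mem_cancel_left hH]
  induction x using code_induction with
  | neg x ih => exact ih (by simpa using hx) (by simpa using hxy) (hneg.2 hxH)
  | mem x mx =>
    induction y using code_induction with
    | neg y ih => exact hneg.1 (ih (by simpa using hy) (by simpa using hxy))
    | mem y my =>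
      have h := List.all_eq_true.1 (List.all_eq_true.1 sevens_eq_power _
        (List.mem_filter.2 ⟨mx, by simpa using hx⟩)) _ (List.mem_filter.2 ⟨my, by simpa using hy⟩)
      have hp : ∀ z ∈ powers (code x), ∃ g ∈ H, code g = z := by
        simp only [powers, ← code_mul, List.mem_cons, List.not_mem_nil, or_false]
        have h2 := H.mul_mem hxH hxH
        have h4 := H.mul_mem h2 h2
        rintro z (rfl | rfl | rfl | rfl | rfl | rfl)
        exacts [⟨_, hxH, rfl⟩, ⟨_, h2, rfl⟩, ⟨_, H.mul_mem h2 hxH, rfl⟩, ⟨_, h4, rfl⟩,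
          ⟨_, H.mul_mem h4 hxH, rfl⟩, ⟨_, H.mul_mem h4 h2, rfl⟩]
      have h0 : fix (code x) = fix (code y) := hxy
      simp only [h0, bne_self_eq_false, Bool.false_or, List.any_eq_true, Bool.or_eq_true,
        beq_iff_eq] at h
      obtain ⟨z, hz, h⟩ := h
      obtain ⟨g, hg, rfl⟩ := hp z hz
      rw [← code_neg, code_injective.eq_iff, code_injective.eq_iff] at h
      rcases h with rfl | rfl
      exacts [hg, hneg.2 hg]

lemma eq_top_of_rk_eq_four {H : Subgroup SL27} (hH : -1 ∈ H) {x y : SL27} (hx : rk x = 4)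
    (hy : rk y = 4) (hxy : fixed y ≠ fixed x) (hxH : x ∈ H) (hyH : y ∈ H) : H = ⊤ := by
  obtain ⟨i, hi, hxi⟩ := exists_fixed_eq_two_pow hx
  obtain ⟨j, hj, hyj⟩ := exists_fixed_eq_two_pow hy
  have hseven : ∀ {s}, s ∈ sevens → ∃ g, code g = s ∧ rk g = 4 := fun hs => by
    obtain ⟨hs, hs'⟩ := List.mem_filter.1 hs
    obtain ⟨g, rfl⟩ := exists_code_eq hs
    exact ⟨g, rfl, by simpa using hs'⟩
  have h4 : ∀ z, rk z = 4 → z ∈ H := by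
    intro z hz
    obtain ⟨k, hk, hzk⟩ := exists_fixed_eq_two_pow hz
    by_cases hki : k = i
    · exact mem_of_fixed_eq hH hx hz (by rw [hxi, hzk, hki]) hxH
    by_cases hkj : k = j
    · exact mem_of_fixed_eq hH hy hz (by rw [hyj, hzk, hkj]) hyH
    have hij : i ≠ j := fun h => hxy (by rw [hxi, hyj, h])
    have h := List.all_eq_true.1 (List.all_eq_true.1 sevens_generate _ (List.mem_range.2 hi)) _
      (List.mem_range.2 hj)
    rw [beq_eq_false_iff_ne.2 hij, Bool.false_or] at h
    have h := List.all_eq_true.1 h _ (List.mem_range.2 hk)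
    simp only [beq_eq_false_iff_ne.2 hki, beq_eq_false_iff_ne.2 hkj, Bool.false_or,
      List.any_eq_true, Bool.and_eq_true, beq_iff_eq] at h
    obtain ⟨s, hs, hsi, t, ht, htj, hr, hst⟩ := h
    obtain ⟨s, rfl, hs4⟩ := hseven hs
    obtain ⟨t, rfl, ht4⟩ := hseven ht
    rw [← code_mul, ← code_inv, ← code_mul] at hr hst
    have hsH := mem_of_fixed_eq hH hx hs4 (hxi.trans hsi.symm) hxH
    have htH := mem_of_fixed_eq hH hy ht4 (hyj.trans htj.symm) hyH
    exact mem_of_fixed_eq hH hr hz (hst.trans hzk.symm)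
      (H.mul_mem (H.mul_mem hsH htH) (H.inv_mem hsH))
  rw [eq_top_iff]
  rintro z -
  induction z using code_induction with
  | neg z hz => rwa [← neg_one_mul, H.mul_mem_cancel_left hH] at hz
  | mem z mz =>
    obtain ⟨s, hs, hsz⟩ := List.any_eq_true.1 (List.all_eq_true.1 codes_eq_mul_sevens _ mz)
    obtain ⟨s, rfl, hs4⟩ := hseven hs
    rw [beq_iff_eq, ← code_mul] at hsz
    exact (H.mul_mem_cancel_left (h4 s hs4)).1 (h4 _ hsz)

/-- A proper subgroup which contains a noncentral element and the center fixes some point. -/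
theorem exists_le_fixer {H : Subgroup SL27} (hH : -1 ∈ H) (hne : ∃ g ∈ H, rk g ≠ 0) (htop : H ≠ ⊤) :
    ∃ s : Set (Fin 22), s.Nonempty ∧ H ≤ fixer s := by
  obtain ⟨g, hg, hmax⟩ := Set.exists_max_image (H : Set SL27) rk (Set.toFinite _) ⟨1, H.one_mem⟩
  have hlt : ∀ g k, fixed g &&& k < 2 ^ 22 := fun g k => Nat.and_le_left.trans_lt (fixed_lt g)
  have hg0 : rk g ≠ 0 := fun h => by
    obtain ⟨h', hh, h0⟩ := hne
    exact h0 (Nat.le_zero.1 (h ▸ hmax h' hh))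
  have hg4 := rk_le g
  obtain h1 | h23 | h4 : rk g = 1 ∨ (rk g = 2 ∨ rk g = 3) ∨ rk g = 4 := by omega
  · obtain ⟨hg1, hg2⟩ := fixed_of_rk_eq_one h1
    rw [h1] at hmax
    by_cases hall : ∀ y ∈ H, fixed g &&& fixed y = fixed g
    · exact ⟨bits (fixed g), bits_nonempty (fixed_lt g) hg1, fun y hy =>
        bits_subset_of_land_eq (hall y hy)⟩
    · push Not at hall
      obtain ⟨y, hy, hgy⟩ := hall
      obtain ⟨h0, h⟩ := (hg2 y (hmax _ hy) (hmax _ (H.mul_mem hg hy))).resolve_left hgy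
      exact ⟨bits (fixed g &&& fixed y), bits_nonempty (hlt _ _) h0, fun z hz =>
        bits_subset_of_land_eq (h z (hmax _ hz) (hmax _ (H.mul_mem hg hz))
          (hmax _ (H.mul_mem hy hz)) (hmax _ (H.mul_mem (H.mul_mem hg hy) hz)))⟩
  · have key : ∀ h ∈ H, _ := fun h hh => fixed_of_rk_eq_two_or_three h23 h (hmax _ hh)
      (hmax _ (H.mul_mem hg hh))
      (hmax _ (H.mul_mem (H.mul_mem (H.mul_mem hh hg) (H.mul_mem hh hg)) (H.mul_mem hg hh)))
      (hmax _ (H.mul_mem (H.mul_mem (H.mul_mem hh hh) (H.mul_mem hg hh)) (H.mul_mem hg hh)))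
    obtain ⟨h1, h2, -⟩ := key g hg
    have hunion : (H : Set SL27) ⊆
        fixer (bits (fixed g &&& 127)) ∪ fixer (bits (fixed g &&& 16256)) := fun h hh =>
      (key h hh).2.2.imp bits_subset_of_land_eq bits_subset_of_land_eq
    rcases SubgroupClass.subset_union.1 hunion with h | h
    exacts [⟨_, bits_nonempty (hlt _ _) h1, h⟩, ⟨_, bits_nonempty (hlt _ _) h2, h⟩]
  · obtain ⟨hg1, hg2⟩ := conj_of_rk_eq_four h4
    refine ⟨bits (fixed g), bits_nonempty (fixed_lt g) hg1, fun y hy =>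
      bits_subset_of_land_eq ((hg2 y).resolve_right fun h => htop ?_)⟩
    exact eq_top_of_rk_eq_four hH h4 h.1 h.2 hg (H.mul_mem (H.mul_mem hy hg) (H.inv_mem hy))

lemma mask_ne_full : (List.finRange 134).all fun x => mask x != 2 ^ 22 - 1 := by
  decide +kernel

lemma rk_eq_zero_or_fixed_eq_mask (g : SL27) : rk g = 0 ∨ ∃ y ∈ cyclicNodes, fixed g = mask y := by
  induction g using code_induction with
  | neg g ih => simpa using ih
  | mem g mg => simpa using List.all_eq_true.1 fix_eq_mask _ mg

/-- The points fixed by finitely many matrices form a node, unless there are no such points or all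
matrices are central. -/
lemma exists_bits_mask_eq (T : Finset SL27) : {i | ∀ g ∈ T, i ∈ bits (fixed g)} = Set.univ ∨
    {i | ∀ g ∈ T, i ∈ bits (fixed g)} = ∅ ∨
      ∃ x, {i | ∀ g ∈ T, i ∈ bits (fixed g)} = bits (mask x) := by
  classical
  induction T using Finset.induction_on with
  | empty => simp
  | insert a T _ ih =>
    have hins : {i | ∀ g ∈ insert a T, i ∈ bits (fixed g)} =
        {i | ∀ g ∈ T, i ∈ bits (fixed g)} ∩ bits (fixed a) := by
      ext i
      simp [and_comm]
    rw [hins]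
    rcases rk_eq_zero_or_fixed_eq_mask a with ha | ⟨y, hy, ha⟩
    · rwa [fixed_of_rk_eq_zero ha, bits_full, Set.inter_univ]
    · rw [ha]
      rcases ih with h | h | ⟨x, h⟩ <;> rw [h]
      · exact Or.inr (Or.inr ⟨y, Set.univ_inter _⟩)
      · exact Or.inr (Or.inl (Set.empty_inter _))
      · have hxy := List.all_eq_true.1
          (List.all_eq_true.1 mask_land_mask x (List.mem_finRange x)) y hy
        simp only [Bool.or_eq_true, beq_iff_eq, List.any_eq_true] at hxy
        rw [← bits_land]
        rcases hxy with h0 | ⟨z, -, hz⟩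
        · exact Or.inr (Or.inl (by simp [h0, bits]))
        · exact Or.inr (Or.inr ⟨z, by rw [hz]⟩)

/-- The set of points fixed by a proper subgroup which contains a noncentral element and the center
is a node. -/
lemma exists_le_fixer_iff {H : Subgroup SL27} (hH : -1 ∈ H) (hne : ∃ g ∈ H, rk g ≠ 0)
    (htop : H ≠ ⊤) : ∃ x, ∀ s, H ≤ fixer s ↔ s ⊆ bits (mask x) := by
  have key : ∀ s, H ≤ fixer s ↔ s ⊆ {i | ∀ g ∈ (Set.toFinite (H : Set SL27)).toFinset,
      i ∈ bits (fixed g)} := fun s => by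
    simp only [Set.Finite.mem_toFinset, SetLike.mem_coe]
    exact ⟨fun h i hi g hg => h hg hi, fun h g hg i hi => h hi g hg⟩
  rcases exists_bits_mask_eq (Set.toFinite (H : Set SL27)).toFinset with h | h | ⟨x, h⟩
  · obtain ⟨g, hg, hg0⟩ := hne
    obtain ⟨y, -, hy⟩ := (rk_eq_zero_or_fixed_eq_mask g).resolve_left hg0
    have hy' := List.all_eq_true.1 mask_ne_full y (List.mem_finRange y)
    rw [bne_iff_ne] at hy'
    refine absurd (bits_injOn (mask_lt y) (by omega) ?_) hy'
    rw [bits_full, Set.eq_univ_iff_forall, ← hy]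
    exact fun i => (key Set.univ).2 h.ge hg trivial
  · obtain ⟨s, hs, hs'⟩ := exists_le_fixer hH hne htop
    exact absurd ((key s).1 hs') (by rw [h, Set.subset_empty_iff]; exact hs.ne_empty)
  · exact ⟨x, fun s => by rw [key, h]⟩

lemma subset_bits_foldr {s : Set (Fin 22)} (l : List Code) (h : ∀ y ∈ l, s ⊆ bits (fix y)) :
    s ⊆ bits (l.foldr (fun y k => k &&& fix y) (2 ^ 22 - 1)) := by
  induction l with
  | nil =>
    rw [List.foldr_nil, bits_full]
    exact Set.subset_univ s
  | cons y l ih =>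
    rw [List.foldr_cons, bits_land]
    exact Set.subset_inter (ih fun z hz => h z (List.mem_cons_of_mem y hz)) (h y List.mem_cons_self)

lemma fixer_bits_mask_le_iff (x : Fin 134) (s : Set (Fin 22)) :
    fixer (bits (mask x)) ≤ fixer s ↔ s ⊆ bits (mask x) := by
  refine ⟨fun h => ?_, fun h g hg => h.trans hg⟩
  have hx := List.all_eq_true.1 foldr_fix x (List.mem_finRange x)
  rw [beq_iff_eq] at hx
  rw [← hx]
  refine subset_bits_foldr _ fun y hy => ?_
  obtain ⟨hy, hxy⟩ := List.mem_filter.1 hy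
  obtain ⟨g, rfl⟩ := exists_code_eq hy
  exact h (bits_subset_of_land_eq (by simpa using hxy))

lemma comparable_iff {x y : Fin 134} : comparable x y ↔
    bits (mask x) ⊆ bits (mask y) ∨ bits (mask y) ⊆ bits (mask x) := by
  simp only [comparable, Bool.or_eq_true, beq_iff_eq]
  refine or_congr ⟨bits_subset_of_land_eq, land_eq_of_bits_subset (mask_lt x)⟩ ?_
  rw [Nat.land_comm]
  exact ⟨bits_subset_of_land_eq, land_eq_of_bits_subset (mask_lt y)⟩

lemma mem_center_iff {g : SL27} : g ∈ Subgroup.center SL27 ↔ rk g = 0 := by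
  refine ⟨fun hg => ?_, fun hg => ?_⟩
  · obtain ⟨r, -, hr⟩ := Matrix.SpecialLinearGroup.mem_center_iff.1 hg
    simp [rk, rank, code, ← hr]
  · rw [Subgroup.mem_center_iff]
    rcases eq_one_or_of_rk_eq_zero hg with rfl | rfl <;> simp

/-- The projection onto `PSL(2, 7)`. -/
def proj : SL27 →* PSL27 := QuotientGroup.mk' (Subgroup.center SL27)

lemma proj_surjective : Function.Surjective proj := QuotientGroup.mk'_surjective _

lemma mem_ker_proj {g : SL27} : g ∈ proj.ker ↔ rk g = 0 := by
  rw [← mem_center_iff, proj, QuotientGroup.ker_mk']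

lemma exists_comap_le_fixer_iff {H : Subgroup PSL27} (hH : H ∈ Lset PSL27) :
    ∃ x, ∀ s, H.comap proj ≤ fixer s ↔ s ⊆ bits (mask x) := by
  refine exists_le_fixer_iff ?_ ?_ fun h => hH.2.ne ?_
  · exact proj.ker_le_comap H (mem_ker_proj.2 (by rw [rk_neg, rk_one]))
  · obtain ⟨a, ha, ha1⟩ := H.bot_or_exists_ne_one.resolve_left hH.1.ne'
    obtain ⟨g, rfl⟩ := proj_surjective a
    exact ⟨g, ha, fun h => ha1 (mem_ker_proj.2 h)⟩
  · exact Subgroup.comap_injective proj_surjective (by rw [h, Subgroup.comap_top])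

open Classical in
/-- The node of a subgroup: the points fixed by its preimage. -/
noncomputable def toNode (H : Subgroup PSL27) : Fin 134 :=
  if h : ∃ x, ∀ s, H.comap proj ≤ fixer s ↔ s ⊆ bits (mask x) then h.choose else 0

lemma comap_le_fixer_iff {H : Subgroup PSL27} (h : H ∈ Lset PSL27) (s : Set (Fin 22)) :
    H.comap proj ≤ fixer s ↔ s ⊆ bits (mask (toNode H)) := by
  have hx := exists_comap_le_fixer_iff h
  rw [toNode, dif_pos hx]
  exact hx.choose_spec s

/-- The subgroup which fixes the points of a node. -/
def ofNode (x : Fin 134) : Subgroup PSL27 := (fixer (bits (mask x))).map proj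

lemma comap_ofNode (x : Fin 134) : (ofNode x).comap proj = fixer (bits (mask x)) := by
  refine Subgroup.comap_map_eq_self fun g hg => ?_
  rw [mem_fixer, fixed_of_rk_eq_zero (mem_ker_proj.1 hg), bits_full]
  exact Set.subset_univ _

lemma ofNode_mem (x : Fin 134) : ofNode x ∈ Lset PSL27 := by
  have h := List.all_eq_true.1 mask_proper x (List.mem_finRange x)
  simp only [Bool.and_eq_true, List.any_eq_true, beq_iff_eq, bne_iff_ne] at h
  obtain ⟨⟨y, hy, hxy, hy0⟩, z, hz, hxz⟩ := h
  obtain ⟨y, rfl⟩ := exists_code_eq hy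
  obtain ⟨z, rfl⟩ := exists_code_eq hz
  refine ⟨bot_lt_iff_ne_bot.2 fun h => hy0 ?_, lt_top_iff_ne_top.2 fun h => hxz ?_⟩
  · have hy : y ∈ (ofNode x).comap proj := by
      rw [comap_ofNode]
      exact bits_subset_of_land_eq hxy
    rw [h] at hy
    exact mem_ker_proj.1 hy
  · have hz : z ∈ (ofNode x).comap proj := by
      rw [h]
      trivial
    rw [comap_ofNode] at hz
    exact land_eq_of_bits_subset (mask_lt x) hz

lemma bits_mask_toNode_ofNode (x : Fin 134) : bits (mask (toNode (ofNode x))) = bits (mask x) := by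
  have h := fun s => comap_le_fixer_iff (ofNode_mem x) s
  simp only [comap_ofNode, fixer_bits_mask_le_iff] at h
  exact ((h _).2 subset_rfl).antisymm ((h _).1 subset_rfl)

lemma bits_mask_toNode_mono {H K : Subgroup PSL27} (hH : H ∈ Lset PSL27) (hK : K ∈ Lset PSL27)
    (h : H ≤ K) : bits (mask (toNode K)) ⊆ bits (mask (toNode H)) :=
  (comap_le_fixer_iff hH _).1
    ((Subgroup.comap_mono h).trans ((comap_le_fixer_iff hK _).2 subset_rfl))

lemma ofNode_mono {x y : Fin 134} (h : bits (mask x) ⊆ bits (mask y)) : ofNode y ≤ ofNode x :=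
  Subgroup.map_mono fun _ hg => h.trans hg

lemma le_ofNode_toNode {H : Subgroup PSL27} (h : H ∈ Lset PSL27) : H ≤ ofNode (toNode H) := by
  conv_lhs => rw [← Subgroup.map_comap_eq_self_of_surjective proj_surjective H]
  exact Subgroup.map_mono ((comap_le_fixer_iff h _).2 subset_rfl)

theorem nonempty_homotopyEquiv_cliques : Nonempty (ContinuousMap.HomotopyEquiv (ΔSp (Lset PSL27))
    (geom (geom.cliques comparable (List.finRange 134)))) := by
  have : Fintype (Subgroup PSL27) := Fintype.ofFinite _
  refine Nonempty.map (Homeomorph.setCongr (ocSet_eq_geom _)).toHomotopyEquiv.trans ?_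
  refine geom.nonempty_homotopyEquiv_of_closure (geom.isLowerSet_cliques _ _) toNode ofNode ?_ ?_ ?_
    (fun H _ => ofNode_mem _) ?_ fun H => le_ofNode_toNode
  · intro s hs hc
    refine ⟨fun _ _ => List.mem_finRange _, ?_⟩
    rintro _ ⟨H, hH, rfl⟩ _ ⟨K, hK, rfl⟩
    rw [comparable_iff]
    rcases hc.total hH hK with h | h
    · exact Or.inr (bits_mask_toNode_mono (hs hH) (hs hK) h)
    · exact Or.inl (bits_mask_toNode_mono (hs hK) (hs hH) h)
  · intro s hs
    refine ⟨by rintro _ ⟨x, -, rfl⟩; exact ofNode_mem x, ?_⟩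
    rintro _ ⟨x, hx, rfl⟩ _ ⟨y, hy, rfl⟩ -
    rcases comparable_iff.1 (hs.2 x hx y hy) with h | h
    exacts [Or.inr (ofNode_mono h), Or.inl (ofNode_mono h)]
  · intro s hs
    have key : ∀ x ∈ toNode '' (ofNode '' s) ∪ s, ∃ y ∈ s, bits (mask x) = bits (mask y) := by
      rintro _ (⟨_, ⟨x, hx, rfl⟩, rfl⟩ | hx)
      exacts [⟨x, hx, bits_mask_toNode_ofNode x⟩, ⟨_, hx, rfl⟩]
    refine ⟨fun _ _ => List.mem_finRange _, fun x hx y hy => ?_⟩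
    obtain ⟨x', hx', hx⟩ := key x hx
    obtain ⟨y', hy', hy⟩ := key y hy
    rw [comparable_iff, hx, hy, ← comparable_iff]
    exact hs.2 x' hx' y' hy'
  · intro H hH K hK h
    exact ofNode_mono (bits_mask_toNode_mono hH hK h)

end Lattice27

/-- The order complex of the proper part of the subgroup lattice of
`PSL(2,7)` is homotopy equivalent to a wedge of `48` circles and `48` two-spheres:
`Δ𝓛PSL(2,7) ≃ (⋁^{48} S¹) ∨ (⋁^{48} S²)`. -/
theorem psl27_subgroupLattice_homotopyEquiv :
    Nonempty (ContinuousMap.HomotopyEquiv (ΔSp (Lset PSL27))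
      (Wedge (BigWedge (fun _ : Fin 48 => Circle) fun _ => 1)
        (BigWedge (fun _ : Fin 48 => TwoSphere) fun _ => TwoSphere.pt)
        BigWedge.base BigWedge.base)) := by
  obtain ⟨e⟩ := Lattice27.nonempty_homotopyEquiv_cliques
  exact Lattice27.homotopyEquiv_wedge.map e.trans
end

section
/- Let P be a finite poset and m ∈ P. If the inclusion of the subcomplex Δ(P_{<m} ∪ P_{>m}) = ΔP_{<m} * ΔP_{>m} into ΔP_{≠m} is null-homotopic (i.e. Δ(P_{<m} ∪ P_{>m}) can be contracted to a point inside ΔP_{≠m}), then ΔP is homotopy equivalent to the wedge ΔP_{≠m} ∨ Σ(ΔP_{<m} * ΔP_{>m}), where Σ denotes suspension. -/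
namespace TopJoin

lemma mk_zero {X Y : Type} [TopologicalSpace X] [TopologicalSpace Y] (x : X) (y : Y) :
    (Quot.mk _ (Sum.inl (Sum.inr (x, 0, y))) : TopJoin X Y) = Quot.mk _ (Sum.inl (Sum.inl x)) :=
  Quot.sound (Or.inl ⟨x, y, rfl, rfl⟩)

lemma mk_one {X Y : Type} [TopologicalSpace X] [TopologicalSpace Y] (x : X) (y : Y) :
    (Quot.mk _ (Sum.inl (Sum.inr (x, 1, y))) : TopJoin X Y) = Quot.mk _ (Sum.inr y) :=
  Quot.sound (Or.inr ⟨x, y, rfl, rfl⟩)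

end TopJoin

open unitInterval in
/-- The mapping cone of `f : L → X`, with apex at parameter `0` and `X` glued at parameter `1`. -/
abbrev MappingCone {L X : Type} [TopologicalSpace L] [TopologicalSpace X] (f : C(L, X)) : Type :=
  Quot (fun a b : (L × I) ⊕ (Unit ⊕ X) =>
    (∃ l, a = Sum.inl (l, 0) ∧ b = Sum.inr (Sum.inl ())) ∨
    (∃ l, a = Sum.inl (l, 1) ∧ b = Sum.inr (Sum.inr (f l))))

namespace MappingCone

open unitInterval

variable {L X Y : Type} [TopologicalSpace L] [TopologicalSpace X] [TopologicalSpace Y]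
  {f g : C(L, X)}

/-- The apex of the mapping cone. -/
def apex (f : C(L, X)) : MappingCone f := Quot.mk _ (Sum.inr (Sum.inl ()))

/-- The cone part of the mapping cone. -/
def cone (f : C(L, X)) : C(L × I, MappingCone f) :=
  ⟨fun p => Quot.mk _ (Sum.inl p), continuous_quot_mk.comp continuous_inl⟩

/-- The inclusion of the target space in the mapping cone. -/
def base (f : C(L, X)) : C(X, MappingCone f) :=
  ⟨fun x => Quot.mk _ (Sum.inr (Sum.inr x)),
    continuous_quot_mk.comp (continuous_inr.comp continuous_inr)⟩

@[simp] lemma cone_zero (f : C(L, X)) (l : L) : cone f (l, 0) = apex f :=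
  Quot.sound (Or.inl ⟨l, rfl, rfl⟩)

@[simp] lemma cone_one (f : C(L, X)) (l : L) : cone f (l, 1) = base f (f l) :=
  Quot.sound (Or.inr ⟨l, rfl, rfl⟩)

@[elab_as_elim]
lemma ind {motive : MappingCone f → Prop} (h_apex : motive (apex f))
    (h_cone : ∀ l t, motive (cone f (l, t))) (h_base : ∀ x, motive (base f x)) (z) :
    motive z := by
  induction z using Quot.ind with
  | mk a =>
    rcases a with ⟨l, t⟩ | ⟨⟨⟩⟩ | x
    exacts [h_cone l t, h_apex, h_base x]

/-- The universal property of the mapping cone. -/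
def desc (p : Y) (c : C(L × I, Y)) (b : C(X, Y)) (h₀ : ∀ l, c (l, 0) = p)
    (h₁ : ∀ l, c (l, 1) = b (f l)) : C(MappingCone f, Y) where
  toFun := Quot.lift (Sum.elim c (Sum.elim (fun _ => p) b)) (by
    rintro _ _ (⟨l, rfl, rfl⟩ | ⟨l, rfl, rfl⟩)
    exacts [h₀ l, h₁ l])
  continuous_toFun := continuous_quot_lift _
    (c.continuous.sumElim (continuous_const.sumElim b.continuous))

section desc

variable (p : Y) (c : C(L × I, Y)) (b : C(X, Y)) (h₀ : ∀ l, c (l, 0) = p)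
  (h₁ : ∀ l, c (l, 1) = b (f l))

@[simp] lemma desc_apex : desc p c b h₀ h₁ (apex f) = p := rfl

@[simp] lemma desc_cone (q : L × I) : desc p c b h₀ h₁ (cone f q) = c q := rfl

@[simp] lemma desc_base (x : X) : desc p c b h₀ h₁ (base f x) = b x := rfl

end desc

/-- The path from the apex through the cone line over `l`, followed by the track of `l` under a
homotopy starting at `f`. -/
noncomputable def track (H : f.Homotopy g) : C(L × ℝ, MappingCone f) where
  toFun q := if q.2 ≤ 1 then cone f (q.1, Set.projIcc 0 1 zero_le_one q.2)
    else base f (H (Set.projIcc 0 1 zero_le_one (q.2 - 1), q.1))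
  continuous_toFun := by
    refine Continuous.if_le ?_ ?_ continuous_snd continuous_const ?_
    · exact (cone f).continuous.comp
        (continuous_fst.prodMk (continuous_projIcc.comp continuous_snd))
    · exact (base f).continuous.comp (H.continuous.comp
        ((continuous_projIcc.comp (continuous_snd.sub continuous_const)).prodMk continuous_fst))
    · rintro ⟨l, u⟩ (rfl : u = 1)
      simp

lemma track_of_le (H : f.Homotopy g) (l : L) {u : ℝ} (hu : u ≤ 1) :
    track H (l, u) = cone f (l, Set.projIcc 0 1 zero_le_one u) := if_pos hu

lemma track_of_ge (H : f.Homotopy g) (l : L) {u : ℝ} (hu : 1 ≤ u) :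
    track H (l, u) = base f (H (Set.projIcc 0 1 zero_le_one (u - 1), l)) := by
  rcases hu.eq_or_lt with rfl | hu
  · simp [track_of_le]
  · exact if_neg hu.not_ge

@[simp] lemma track_zero (H : f.Homotopy g) (l : L) : track H (l, 0) = apex f := by
  simp [track_of_le]

@[simp] lemma track_one (H : f.Homotopy g) (l : L) : track H (l, 1) = base f (f l) := by
  simp [track_of_le]

@[simp] lemma track_two (H : f.Homotopy g) (l : L) : track H (l, 2) = base f (g l) := by
  rw [track_of_ge H l one_le_two, Set.projIcc_of_right_le _ (by norm_num)]
  exact congrArg _ (H.apply_one l)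

/-- The map of mapping cones induced by a homotopy. -/
noncomputable def transport (H : f.Homotopy g) : C(MappingCone f, MappingCone g) :=
  desc (apex g) ((track H.symm).comp ⟨fun q => (q.1, 2 * (q.2 : ℝ)), by fun_prop⟩) (base g)
    (by simp) (by simp)

lemma transport_cone (H : f.Homotopy g) (l : L) (t : I) :
    transport H (cone f (l, t)) = track H.symm (l, 2 * (t : ℝ)) := rfl

lemma transport_symm_transport_cone (H : f.Homotopy g) (l : L) (t : I) :
    transport H.symm (transport H (cone f (l, t))) =
      track H (l, min (4 * (t : ℝ)) (3 - 2 * t)) := by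
  have ht₀ := t.2.1
  have ht₁ := t.2.2
  rw [transport_cone]
  rcases le_total (2 * (t : ℝ)) 1 with h | h
  · rw [track_of_le _ _ h, transport_cone, Set.projIcc_of_mem _ ⟨by linarith, h⟩,
      min_eq_left (by linarith), ContinuousMap.Homotopy.symm_symm]
    congr 2
    ring
  · rw [track_of_ge _ _ h, min_eq_right (by linarith), track_of_ge _ _ (by linarith)]
    refine congrArg (base f) ?_
    rw [ContinuousMap.Homotopy.symm_apply]
    congr 2
    ext
    rw [Set.projIcc_of_mem _ ⟨by linarith, by linarith⟩,
      Set.projIcc_of_mem _ ⟨by linarith, by linarith⟩, unitInterval.coe_symm_eq]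
    ring

lemma transport_symm_comp_homotopic (H : f.Homotopy g) :
    ((transport H.symm).comp (transport H)).Homotopic (ContinuousMap.id (MappingCone f)) := by
  let c : C((L × I) × I, MappingCone f) := (track H).comp
    ⟨fun q => (q.1.1, (1 - (q.2 : ℝ)) * min (4 * (q.1.2 : ℝ)) (3 - 2 * q.1.2) + q.2 * q.1.2),
      by fun_prop⟩
  let b : C(X × I, MappingCone f) := (base f).comp ContinuousMap.fst
  let F : C(MappingCone f, C(I, MappingCone f)) :=
    desc (ContinuousMap.const I (apex f)) c.curry b.curry
      (by intro l; ext s; simp [c])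
      (by intro l; ext s; norm_num [c, b])
  refine ⟨⟨⟨fun q => F q.2 q.1, by fun_prop⟩, ?_, ?_⟩⟩
  · refine ind rfl (fun l t => ?_) (fun x => rfl)
    rw [ContinuousMap.comp_apply, transport_symm_transport_cone]
    simp [F, c]
  · refine ind rfl (fun l t => ?_) (fun x => rfl)
    have ht := t.2.2
    simp [F, c, track_of_le _ _ ht]

/-- Homotopic maps have homotopy equivalent mapping cones. -/
noncomputable def homotopyEquivOfHomotopy (H : f.Homotopy g) :
    ContinuousMap.HomotopyEquiv (MappingCone f) (MappingCone g) where
  toFun := transport H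
  invFun := transport H.symm
  left_inv := transport_symm_comp_homotopic H
  right_inv := by simpa using transport_symm_comp_homotopic H.symm

end MappingCone

namespace Susp

/-- One of the two poles of the suspension. -/
def pole {L : Type} [TopologicalSpace L] (b : Bool) : Susp L := Quot.mk _ (Sum.inl (Sum.inl b))

end Susp

namespace MappingCone

open unitInterval

variable {L X : Type} [TopologicalSpace L] [TopologicalSpace X]

/-- The cone line over `l` as a path between the two poles of the suspension. -/
noncomputable def suspLine : C(L × I, Susp L) where
  toFun q := if (q.2 : ℝ) ≤ 1 / 2
    then Quot.mk _ (Sum.inl (Sum.inr (false, Set.projIcc 0 1 zero_le_one (2 * q.2 : ℝ), q.1)))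
    else Quot.mk _ (Sum.inl (Sum.inr (true, Set.projIcc 0 1 zero_le_one (2 - 2 * q.2 : ℝ), q.1)))
  continuous_toFun := by
    refine Continuous.if_le ?_ ?_ (by fun_prop) continuous_const ?_
    · refine continuous_quot_mk.comp (continuous_inl.comp (continuous_inr.comp ?_))
      exact continuous_const.prodMk ((continuous_projIcc.comp (by fun_prop)).prodMk continuous_fst)
    · refine continuous_quot_mk.comp (continuous_inl.comp (continuous_inr.comp ?_))
      exact continuous_const.prodMk ((continuous_projIcc.comp (by fun_prop)).prodMk continuous_fst)
    · rintro ⟨l, u⟩ (hu : (u : ℝ) = 1 / 2)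
      norm_num [hu, TopJoin.mk_one]

lemma suspLine_of_le (l : L) {t : I} (ht : (t : ℝ) ≤ 1 / 2) : suspLine (l, t) =
    Quot.mk _ (Sum.inl (Sum.inr (false, Set.projIcc 0 1 zero_le_one (2 * t : ℝ), l))) :=
  if_pos ht

lemma suspLine_of_lt (l : L) {t : I} (ht : 1 / 2 < (t : ℝ)) : suspLine (l, t) =
    Quot.mk _ (Sum.inl (Sum.inr (true, Set.projIcc 0 1 zero_le_one (2 - 2 * t : ℝ), l))) :=
  if_neg ht.not_ge

lemma suspLine_zero (l : L) : suspLine (l, 0) = Susp.pole false := by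
  rw [suspLine_of_le l (by norm_num)]
  exact Quot.sound (Or.inl ⟨_, l, by simp, rfl⟩)

lemma suspLine_one (l : L) : suspLine (l, 1) = Susp.pole true := by
  rw [suspLine_of_lt l (by norm_num)]
  exact Quot.sound (Or.inl ⟨_, l, by simp, rfl⟩)

variable (L) in
/-- The map from the mapping cone of a constant map to the wedge with the suspension. -/
noncomputable def toWedge (x₀ : X) :
    C(MappingCone (ContinuousMap.const L x₀), Wedge X (Susp L) x₀ (Susp.pole true)) :=
  let i : C(X, Wedge X (Susp L) x₀ (Susp.pole true)) :=
    ⟨fun x => Quot.mk _ (Sum.inl x), continuous_quot_mk.comp continuous_inl⟩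
  let j : C(Susp L, Wedge X (Susp L) x₀ (Susp.pole true)) :=
    ⟨fun x => Quot.mk _ (Sum.inr x), continuous_quot_mk.comp continuous_inr⟩
  desc (j (Susp.pole false)) (j.comp suspLine) i (fun l => congrArg j (suspLine_zero l))
    (fun l => (congrArg j (suspLine_one l)).trans (Quot.sound ⟨rfl, rfl⟩).symm)

/-- The height function on one of the two cones of the suspension. -/
noncomputable def height : Bool × I → I
  | (false, t) => ⟨t / 2, by have := t.2; constructor <;> linarith [this.1, this.2]⟩
  | (true, t) => ⟨1 - t / 2, by have := t.2; constructor <;> linarith [this.1, this.2]⟩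

lemma continuous_height : Continuous height := by
  rw [continuous_prod_of_discrete_left]
  rintro (_ | _) <;> exact Continuous.subtype_mk (by fun_prop) _

lemma height_false_zero : height (false, 0) = 0 := Subtype.ext (by simp [height])

lemma height_true_zero : height (true, 0) = 1 := Subtype.ext (by simp [height])

lemma height_true_one : height (true, 1) = height (false, 1) :=
  Subtype.ext (by norm_num [height])

variable (L) in
/-- The map from the suspension to the mapping cone of a constant map. -/
noncomputable def ofSusp (x₀ : X) : C(Susp L, MappingCone (ContinuousMap.const L x₀)) where
  toFun := Quot.lift (Sum.elim (Sum.elim (fun b => bif b then base _ x₀ else apex _)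
      (fun q => cone _ (q.2.2, height (q.1, q.2.1)))) (fun l => cone _ (l, height (false, 1)))) (by
    rintro _ _ (⟨b, l, rfl, rfl⟩ | ⟨b, l, rfl, rfl⟩)
    · cases b
      · simp [height_false_zero]
      · simp [height_true_zero]
    · cases b
      · rfl
      · simp [height_true_one])
  continuous_toFun := by
    refine continuous_quot_lift _ (Continuous.sumElim (Continuous.sumElim
      continuous_of_discreteTopology ?_) (by fun_prop))
    exact (cone _).continuous.comp ((by fun_prop : Continuous _).prodMk
      (continuous_height.comp (by fun_prop)))

variable (L) in
/-- The mapping cone of a constant map is a wedge with the suspension. -/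
noncomputable def constHomeomorph (x₀ : X) :
    MappingCone (ContinuousMap.const L x₀) ≃ₜ Wedge X (Susp L) x₀ (Susp.pole true) where
  toFun := toWedge L x₀
  invFun := Quot.lift (Sum.elim (base _) (ofSusp L x₀)) (by rintro _ _ ⟨rfl, rfl⟩; rfl)
  left_inv := by
    refine ind rfl (fun l t => ?_) (fun x => rfl)
    change ofSusp L x₀ (suspLine (l, t)) = _
    have ht₀ := t.2.1
    have ht₁ := t.2.2
    rcases le_or_gt (t : ℝ) (1 / 2) with h | h
    · rw [suspLine_of_le l h, Set.projIcc_of_mem _ ⟨by linarith, by linarith⟩]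
      refine congrArg (fun s => cone _ (l, s)) (Subtype.ext ?_)
      simp [height]
    · rw [suspLine_of_lt l h, Set.projIcc_of_mem _ ⟨by linarith, by linarith⟩]
      refine congrArg (fun s => cone _ (l, s)) (Subtype.ext ?_)
      simp only [height]
      ring
  right_inv := by
    have key (b : Bool) (t : I) (l : L) : suspLine (l, height (b, t)) =
        Quot.mk _ (Sum.inl (Sum.inr (b, t, l))) := by
      have ht₀ := t.2.1
      have ht₁ := t.2.2
      cases b
      · rw [suspLine_of_le l (by simp only [height]; linarith)]
        congr 5
        simp [height, mul_div_cancel₀]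
      · rcases ht₁.eq_or_lt with h | h
        · obtain rfl : t = 1 := Subtype.ext h
          rw [height_true_one, suspLine_of_le l (by norm_num [height])]
          norm_num [height, TopJoin.mk_one]
        · rw [suspLine_of_lt l (by simp only [height]; linarith)]
          congr 5
          have : 2 - 2 * (height (true, t) : ℝ) = t := by simp only [height]; ring
          rw [this, Set.projIcc_val]
    rintro ⟨x | s⟩
    · rfl
    induction s using Quot.ind with | mk s
    rcases s with (b | ⟨b, t, l⟩) | l
    · cases b
      · rfl
      · exact Quot.sound ⟨rfl, rfl⟩
    · exact congrArg (fun s => Quot.mk _ (Sum.inr s)) (key b t l)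
    · exact congrArg (fun s => Quot.mk _ (Sum.inr s))
        ((key false 1 l).trans (TopJoin.mk_one false l))
  continuous_toFun := (toWedge L x₀).continuous
  continuous_invFun :=
    continuous_quot_lift _ ((base _).continuous.sumElim (ofSusp L x₀).continuous)

end MappingCone

section OrderComplex

open unitInterval

lemma indicator_convexCombination {P : Type} (S : Set P) (f g : P → ℝ) (a b : ℝ) :
    S.indicator (a • f + b • g) = a • S.indicator f + b • S.indicator g := by
  ext x
  by_cases hx : x ∈ S <;> simp [hx]

/-- The total weight that a function gives to a set. -/
noncomputable def mass {P : Type} [Fintype P] (S : Set P) (f : P → ℝ) : ℝ := ∑ x, S.indicator f x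

lemma mass_convexCombination {P : Type} [Fintype P] (S : Set P) (f g : P → ℝ)
    (a b : ℝ) :
    mass S (a • f + b • g) = a * mass S f + b * mass S g := by
  simp [mass, indicator_convexCombination, Finset.sum_add_distrib, Finset.mul_sum]

lemma mass_nonneg {P : Type} [Fintype P] (S : Set P) {f : P → ℝ} (hf : ∀ x, 0 ≤ f x) :
    0 ≤ mass S f :=
  Finset.sum_nonneg fun _ _ => Set.indicator_nonneg (fun x _ => hf x) _

variable {P : Type} [PartialOrder P] {S T : Set P} {f g : P → ℝ}

lemma apply_eq_zero_of_mem_ocSet (hf : f ∈ ocSet P S) {x : P} (hx : x ∉ S) : f x = 0 := by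
  by_contra h
  exact hx (hf.2.2.2.1 h)

lemma indicator_eq_self_of_mem_ocSet (hf : f ∈ ocSet P S) : S.indicator f = f :=
  Set.indicator_eq_self.2 hf.2.2.2.1

lemma indicator_eq_zero_of_mem_ocSet (hST : Disjoint S T) (hf : f ∈ ocSet P S) :
    T.indicator f = 0 :=
  Set.indicator_eq_zero'.2 (hST.mono_left hf.2.2.2.1)

lemma indicator_add_indicator_of_mem_ocSet (hST : Disjoint S T) (hf : f ∈ ocSet P (S ∪ T)) :
    S.indicator f + T.indicator f = f := by
  conv_rhs => rw [← indicator_eq_self_of_mem_ocSet hf]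
  exact (Set.indicator_union_of_disjoint hST f).symm

variable [Fintype P]

lemma mem_ocSet_iff : f ∈ ocSet P S ↔ (∀ x, 0 ≤ f x) ∧ ∑ x, f x = 1 ∧
    (∀ x, f x ≠ 0 → x ∈ S) ∧ ∀ x y, f x ≠ 0 → f y ≠ 0 → x ≤ y ∨ y ≤ x := by
  refine and_congr_right fun _ => ?_
  rw [finsum_eq_sum_of_fintype, and_iff_right (Set.toFinite _)]
  refine and_congr_right fun _ => and_congr_right fun _ => ⟨fun h x y hx hy => ?_, ?_⟩
  · exact h.total hx hy
  · exact fun h x hx y hy _ => h x y hx hy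

lemma sum_eq_one_of_mem_ocSet (hf : f ∈ ocSet P S) : ∑ x, f x = 1 := (mem_ocSet_iff.1 hf).2.1

lemma isCompact_ocSet (S : Set P) : IsCompact (ocSet P S) := by
  have hK : IsCompact (Set.univ.pi fun _ : P => Set.Icc (0 : ℝ) 1) :=
    isCompact_univ_pi fun _ => isCompact_Icc
  refine hK.of_isClosed_subset ?_ fun f hf x _ => ⟨hf.1 x, ?_⟩
  · have : ocSet P S = {f | (∀ x, 0 ≤ f x) ∧ ∑ x, f x = 1 ∧ (∀ x, x ∉ S → f x = 0) ∧
        ∀ x y, ¬(x ≤ y ∨ y ≤ x) → f x * f y = 0} := by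
      ext f
      rw [mem_ocSet_iff]
      refine and_congr_right fun _ => and_congr_right fun _ => and_congr ?_ ?_
      · exact forall_congr' fun x => not_imp_comm
      · refine forall₂_congr fun x y => ?_
        rw [not_imp_comm, mul_eq_zero]
        tauto
    rw [this]
    simp only [Set.ofPred_and, Set.ofPred_forall]
    refine (isClosed_iInter fun x => isClosed_le continuous_const (continuous_apply x)).inter
      ((isClosed_eq (by fun_prop) continuous_const).inter ((isClosed_iInter fun x =>
        isClosed_iInter fun _ => isClosed_eq (by fun_prop) continuous_const).inter
        (isClosed_iInter fun x => isClosed_iInter fun y => isClosed_iInter fun _ =>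
          isClosed_eq (by fun_prop) continuous_const)))
  · rw [← sum_eq_one_of_mem_ocSet hf]
    exact Finset.single_le_sum (fun y _ => hf.1 y) (Finset.mem_univ x)

instance (S : Set P) : CompactSpace (ΔSp S) := isCompact_iff_compactSpace.1 (isCompact_ocSet S)

lemma convexCombination_mem_ocSet (hST : ∀ x ∈ S, ∀ y ∈ T, x ≤ y ∨ y ≤ x) (hf : f ∈ ocSet P S)
    (hg : g ∈ ocSet P T) (t : I) : (1 - (t : ℝ)) • f + (t : ℝ) • g ∈ ocSet P (S ∪ T) := by
  rw [mem_ocSet_iff] at hf hg ⊢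
  obtain ⟨hf₀, hf₁, hfS, hfc⟩ := hf
  obtain ⟨hg₀, hg₁, hgT, hgc⟩ := hg
  have hne (x) (hx : ((1 - (t : ℝ)) • f + (t : ℝ) • g) x ≠ 0) : f x ≠ 0 ∨ g x ≠ 0 := by
    contrapose! hx
    simp [hx]
  refine ⟨fun x => ?_, ?_, fun x hx => (hne x hx).imp (hfS x) (hgT x), fun x y hx hy => ?_⟩
  · exact add_nonneg (mul_nonneg (sub_nonneg.2 t.2.2) (hf₀ x)) (mul_nonneg t.2.1 (hg₀ x))
  · simp [Finset.sum_add_distrib, ← Finset.mul_sum, hf₁, hg₁]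
  · rcases hne x hx with hx | hx <;> rcases hne y hy with hy | hy
    · exact hfc x y hx hy
    · exact hST x (hfS x hx) y (hgT y hy)
    · exact (hST y (hfS y hy) x (hgT x hx)).symm
    · exact hgc x y hx hy

lemma mass_eq_one (hf : f ∈ ocSet P S) : mass S f = 1 := by
  rw [mass, indicator_eq_self_of_mem_ocSet hf, sum_eq_one_of_mem_ocSet hf]

lemma mass_eq_zero (hST : Disjoint S T) (hf : f ∈ ocSet P S) : mass T f = 0 := by
  simp [mass, indicator_eq_zero_of_mem_ocSet hST hf]

lemma mass_add_mass (hST : Disjoint S T) (hf : f ∈ ocSet P (S ∪ T)) : mass S f + mass T f = 1 := by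
  rw [mass, mass, ← Finset.sum_add_distrib, ← sum_eq_one_of_mem_ocSet hf]
  exact Finset.sum_congr rfl fun x _ => congrFun (indicator_add_indicator_of_mem_ocSet hST hf) x

lemma mem_ocSet_of_mass_eq_zero (hf : f ∈ ocSet P (S ∪ T)) (h : mass T f = 0) :
    f ∈ ocSet P S := by
  refine ⟨hf.1, hf.2.1, hf.2.2.1, fun x hx => ?_, hf.2.2.2.2⟩
  refine (hf.2.2.2.1 hx).resolve_right fun hxT => hx ?_
  have := (Finset.sum_eq_zero_iff_of_nonneg
    fun x _ => Set.indicator_nonneg (fun x _ => hf.1 x) x).1 h x (Finset.mem_univ x)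
  rwa [Set.indicator_of_mem hxT] at this

lemma normalize_mem_ocSet (hf : f ∈ ocSet P T) (h : mass S f ≠ 0) :
    (mass S f)⁻¹ • S.indicator f ∈ ocSet P S := by
  rw [mem_ocSet_iff] at hf ⊢
  have hne (x) (hx : ((mass S f)⁻¹ • S.indicator f) x ≠ 0) : x ∈ S ∧ f x ≠ 0 := by
    have : S.indicator f x ≠ 0 := right_ne_zero_of_mul hx
    exact ⟨Set.mem_of_indicator_ne_zero this, fun h => this (by simp [Set.indicator, h])⟩
  refine ⟨fun x => ?_, ?_, fun x hx => (hne x hx).1,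
    fun x y hx hy => hf.2.2.2 x y (hne x hx).2 (hne y hy).2⟩
  · exact mul_nonneg (inv_nonneg.2 (mass_nonneg S hf.1))
      (Set.indicator_nonneg (fun x _ => hf.1 x) x)
  · simp only [Pi.smul_apply, smul_eq_mul, ← Finset.mul_sum]
    exact inv_mul_cancel₀ h

end OrderComplex

namespace TopJoin

open unitInterval

variable {X Y : Type} [TopologicalSpace X] [TopologicalSpace Y]

@[elab_as_elim]
lemma ind {motive : TopJoin X Y → Prop} (h_left : ∀ x, motive (Quot.mk _ (Sum.inl (Sum.inl x))))
    (h_mid : ∀ (x : X) (t : I) (y : Y), 0 < (t : ℝ) → (t : ℝ) < 1 →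
      motive (Quot.mk _ (Sum.inl (Sum.inr (x, t, y)))))
    (h_right : ∀ y, motive (Quot.mk _ (Sum.inr y))) (z) : motive z := by
  induction z using Quot.ind with | mk a
  rcases a with (x | ⟨x, t, y⟩) | y
  · exact h_left x
  · rcases t.2.1.eq_or_lt with h₀ | h₀
    · obtain rfl : 0 = t := Subtype.ext h₀
      have h := h_left x
      rwa [← mk_zero x y] at h
    · rcases t.2.2.eq_or_lt with h₁ | h₁
      · obtain rfl : t = 1 := Subtype.ext h₁
        have h := h_right y
        rwa [← mk_one x y] at h
      · exact h_mid x t y h₀ h₁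
  · exact h_right y

variable {P : Type} [PartialOrder P] [Fintype P] {S T : Set P}

/-- The map from the join of two order complexes to the order complex of the union. -/
noncomputable def toOrderComplex (hST : ∀ x ∈ S, ∀ y ∈ T, x ≤ y ∨ y ≤ x) :
    C(TopJoin (ΔSp S) (ΔSp T), ΔSp (S ∪ T)) where
  toFun := Quot.lift (Sum.elim (Sum.elim (ΔIncl Set.subset_union_left)
      (fun q => ⟨_, convexCombination_mem_ocSet hST q.1.2 q.2.2.2 q.2.1⟩))
      (ΔIncl Set.subset_union_right)) (by
    rintro _ _ (⟨x, y, rfl, rfl⟩ | ⟨x, y, rfl, rfl⟩) <;>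
    exact Subtype.ext (by simp [ΔIncl]))
  continuous_toFun := continuous_quot_lift _
    (((ContinuousMap.continuous _).sumElim (Continuous.subtype_mk (by fun_prop) _)).sumElim
      (ContinuousMap.continuous _))

lemma toOrderComplex_injective (hST : ∀ x ∈ S, ∀ y ∈ T, x ≤ y ∨ y ≤ x) (hd : Disjoint S T) :
    Function.Injective (toOrderComplex hST) := by
  have left (x : ΔSp S) :
      (toOrderComplex hST (Quot.mk _ (Sum.inl (Sum.inl x))) : P → ℝ) = x := rfl
  have mid (x : ΔSp S) (t : I) (y : ΔSp T) :
      (toOrderComplex hST (Quot.mk _ (Sum.inl (Sum.inr (x, t, y)))) : P → ℝ) =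
        (1 - (t : ℝ)) • (x : P → ℝ) + (t : ℝ) • (y : P → ℝ) := rfl
  have right (y : ΔSp T) :
      (toOrderComplex hST (Quot.mk _ (Sum.inr y)) : P → ℝ) = y := rfl
  have massS (x : ΔSp S) : mass T (x : P → ℝ) = 0 := mass_eq_zero hd x.2
  have massT (y : ΔSp T) : mass T (y : P → ℝ) = 1 := mass_eq_one y.2
  intro z z' h
  replace h := congrArg Subtype.val h
  have h_mass := congrArg (mass T) h
  induction z using ind <;> induction z' using ind <;>
    simp only [left, mid, right, mass_convexCombination, massS, massT] at h h_mass <;>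
    try (exfalso; linarith)
  case h_left.h_left x x' => rw [Subtype.ext h]
  case h_mid.h_mid x t y h₀ h₁ x' t' y' _ _ =>
    obtain rfl : t = t' := Subtype.ext (by linarith)
    have hS := congrArg S.indicator h
    have hT := congrArg T.indicator h
    simp only [indicator_convexCombination, indicator_eq_self_of_mem_ocSet x.2,
      indicator_eq_self_of_mem_ocSet x'.2, indicator_eq_zero_of_mem_ocSet hd.symm y.2,
      indicator_eq_zero_of_mem_ocSet hd.symm y'.2, smul_zero, add_zero] at hS
    simp only [indicator_convexCombination, indicator_eq_self_of_mem_ocSet y.2,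
      indicator_eq_self_of_mem_ocSet y'.2, indicator_eq_zero_of_mem_ocSet hd x.2,
      indicator_eq_zero_of_mem_ocSet hd x'.2, smul_zero, zero_add] at hT
    rw [Subtype.ext (smul_right_injective (P → ℝ) (sub_ne_zero.2 h₁.ne') hS),
      Subtype.ext (smul_right_injective (P → ℝ) h₀.ne' hT)]
  case h_right.h_right y y' => rw [Subtype.ext h]

lemma toOrderComplex_surjective (hST : ∀ x ∈ S, ∀ y ∈ T, x ≤ y ∨ y ≤ x) (hd : Disjoint S T) :
    Function.Surjective (toOrderComplex hST) := by
  rintro ⟨f, hf⟩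
  by_cases hT : mass T f = 0
  · exact ⟨Quot.mk _ (Sum.inl (Sum.inl ⟨f, mem_ocSet_of_mass_eq_zero hf hT⟩)), rfl⟩
  by_cases hS : mass S f = 0
  · exact ⟨Quot.mk _ (Sum.inr ⟨f, mem_ocSet_of_mass_eq_zero (Set.union_comm S T ▸ hf) hS⟩), rfl⟩
  have h := mass_add_mass hd hf
  have hS₀ := mass_nonneg S hf.1
  refine ⟨Quot.mk _ (Sum.inl (Sum.inr (⟨_, normalize_mem_ocSet hf hS⟩,
    ⟨mass T f, mass_nonneg T hf.1, by linarith⟩, ⟨_, normalize_mem_ocSet hf hT⟩))), ?_⟩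
  refine Subtype.ext ?_
  change (1 - mass T f) • (mass S f)⁻¹ • S.indicator f +
    mass T f • (mass T f)⁻¹ • T.indicator f = f
  rw [← eq_sub_iff_add_eq.2 h, smul_inv_smul₀ hS, smul_inv_smul₀ hT,
    indicator_add_indicator_of_mem_ocSet hd hf]

/-- The join of the order complexes of two disjoint, mutually comparable subsets is the order
complex of their union. -/
noncomputable def orderComplexHomeomorph (hST : ∀ x ∈ S, ∀ y ∈ T, x ≤ y ∨ y ≤ x)
    (hd : Disjoint S T) : TopJoin (ΔSp S) (ΔSp T) ≃ₜ ΔSp (S ∪ T) :=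
  (toOrderComplex hST).continuous.homeoOfEquivCompactToT2 (f := Equiv.ofBijective _
    ⟨toOrderComplex_injective hST hd, toOrderComplex_surjective hST hd⟩)

end TopJoin

namespace MappingCone

open unitInterval

@[elab_as_elim]
lemma ind_Ioo {L X : Type} [TopologicalSpace L] [TopologicalSpace X] {f : C(L, X)}
    {motive : MappingCone f → Prop} (h_apex : motive (apex f))
    (h_cone : ∀ l (t : I), 0 < (t : ℝ) → (t : ℝ) < 1 → motive (cone f (l, t)))
    (h_base : ∀ x, motive (base f x)) (z) : motive z := by
  refine ind h_apex (fun l t => ?_) h_base z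
  rcases t.2.1.eq_or_lt with h₀ | h₀
  · obtain rfl : 0 = t := Subtype.ext h₀
    simpa using h_apex
  · rcases t.2.2.eq_or_lt with h₁ | h₁
    · obtain rfl : t = 1 := Subtype.ext h₁
      simpa using h_base _
    · exact h_cone l t h₀ h₁

lemma comparable_of_mem {P : Type} [PartialOrder P] (m : P) :
    ∀ x ∈ ({m} : Set P), ∀ y ∈ Set.Iio m ∪ Set.Ioi m, x ≤ y ∨ y ≤ x := by
  rintro x rfl y (hy | hy)
  exacts [Or.inr hy.le, Or.inl hy.le]

variable {P : Type} [PartialOrder P] [Fintype P] (m : P) {L : Type} [TopologicalSpace L]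
  (e : L ≃ₜ ΔSp (Set.Iio m ∪ Set.Ioi m)) (hsub : Set.Iio m ∪ Set.Ioi m ⊆ ({m}ᶜ : Set P))

open Classical in
lemma single_mem_ocSet : (Pi.single m 1 : P → ℝ) ∈ ocSet P {m} := by
  have h (x : P) (hx : (Pi.single m 1 : P → ℝ) x ≠ 0) : x = m := by
    by_contra hxm
    simp [hxm] at hx
  refine mem_ocSet_iff.2 ⟨fun x => ?_, by simp, h, fun x y hx hy => ?_⟩
  · rw [Pi.single_apply]
    split_ifs <;> simp
  · rw [h x hx, h y hy]
    exact Or.inl le_rfl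

open Classical in
/-- The map from the mapping cone of the inclusion of the link of `m` to the order complex. -/
noncomputable def toOrderComplex :
    C(MappingCone ((ΔIncl hsub).comp (e : C(L, ΔSp (Set.Iio m ∪ Set.Ioi m)))),
      ΔSp (Set.univ : Set P)) :=
  desc ⟨_, ocSet_mono (Set.subset_univ _) (single_mem_ocSet m)⟩
    ⟨fun q => ⟨_, ocSet_mono (Set.subset_univ _)
      (convexCombination_mem_ocSet (comparable_of_mem m) (single_mem_ocSet m) (e q.1).2 q.2)⟩,
      Continuous.subtype_mk (by fun_prop) _⟩
    (ΔIncl (Set.subset_univ _)) (fun l => Subtype.ext (by simp))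
    (fun l => Subtype.ext (by simp [ΔIncl]))

lemma toOrderComplex_injective : Function.Injective (toOrderComplex m e hsub) := by
  classical
  have hm (f : ΔSp ({m}ᶜ : Set P)) : (f : P → ℝ) m = 0 :=
    apply_eq_zero_of_mem_ocSet f.2 (by simp)
  have hm' (f : ΔSp (Set.Iio m ∪ Set.Ioi m)) : (f : P → ℝ) m = 0 :=
    apply_eq_zero_of_mem_ocSet f.2 (by simp)
  have val_apex : (toOrderComplex m e hsub (apex _) : P → ℝ) = Pi.single m 1 := rfl
  have val_cone (l : L) (t : I) : (toOrderComplex m e hsub (cone _ (l, t)) : P → ℝ) =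
    (1 - (t : ℝ)) • Pi.single m 1 + (t : ℝ) • (e l : P → ℝ) := rfl
  have val_base (x) : (toOrderComplex m e hsub (base _ x) : P → ℝ) = x := rfl
  intro z z' h
  replace h := congrArg Subtype.val h
  have h_m := congrFun h m
  induction z using ind_Ioo <;> induction z' using ind_Ioo <;>
    simp only [val_apex, val_cone, val_base, hm, hm', Pi.add_apply, Pi.smul_apply, smul_eq_mul,
      Pi.single_eq_same] at h h_m <;>
    try (exfalso; linarith)
  case h_apex.h_apex => rfl
  case h_cone.h_cone l t h₀ _ l' t' _ _ =>
    obtain rfl : t = t' := Subtype.ext (by linarith)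
    rw [e.injective (Subtype.ext (smul_right_injective (P → ℝ) h₀.ne' (add_left_cancel h)))]
  case h_base.h_base x x' => rw [Subtype.ext h]

lemma toOrderComplex_surjective : Function.Surjective (toOrderComplex m e hsub) := by
  classical
  rintro ⟨f, hf⟩
  by_cases hm : f m = 0
  · exact ⟨base _ ⟨f, hf.1, hf.2.1, hf.2.2.1, fun x hx hxm => hx (hxm ▸ hm), hf.2.2.2.2⟩, rfl⟩
  have hf' : f ∈ ocSet P ({m} ∪ (Set.Iio m ∪ Set.Ioi m)) := by
    refine ⟨hf.1, hf.2.1, hf.2.2.1, fun x hx => ?_, hf.2.2.2.2⟩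
    rcases hf.2.2.2.2.total hx hm with h | h
    · exact h.eq_or_lt.imp id Or.inl
    · exact h.eq_or_lt.imp Eq.symm Or.inr
  obtain ⟨z, hz⟩ := TopJoin.toOrderComplex_surjective (comparable_of_mem m) (by simp) ⟨f, hf'⟩
  have eq_single (x : ΔSp ({m} : Set P)) : (x : P → ℝ) = Pi.single m 1 := by
    have hx (y) (hy : y ≠ m) : (x : P → ℝ) y = 0 := apply_eq_zero_of_mem_ocSet x.2 hy
    ext y
    rcases eq_or_ne y m with rfl | hy
    · rw [Pi.single_eq_same, ← sum_eq_one_of_mem_ocSet x.2]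
      exact (Finset.sum_eq_single _ (fun b _ hb => hx b hb) (by simp)).symm
    · rw [hx y hy, Pi.single_eq_of_ne hy]
  replace hz := congrArg Subtype.val hz
  induction z using TopJoin.ind with
  | h_left x => exact ⟨apex _, Subtype.ext ((eq_single x).symm.trans hz)⟩
  | h_mid x t y _ _ =>
    refine ⟨cone _ (e.symm y, t), Subtype.ext (Eq.trans ?_ hz)⟩
    change (1 - (t : ℝ)) • Pi.single m 1 + (t : ℝ) • (e (e.symm y) : P → ℝ) =
      (1 - (t : ℝ)) • (x : P → ℝ) + (t : ℝ) • (y : P → ℝ)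
    rw [eq_single x, e.apply_symm_apply]
  | h_right y => exact ⟨base _ (ΔIncl hsub y), Subtype.ext hz⟩

/-- The order complex is the mapping cone of the inclusion of the link of `m`. -/
noncomputable def orderComplexHomeomorph :
    MappingCone ((ΔIncl hsub).comp (e : C(L, ΔSp (Set.Iio m ∪ Set.Ioi m)))) ≃ₜ
      ΔSp (Set.univ : Set P) :=
  have : CompactSpace L := e.symm.compactSpace
  (toOrderComplex m e hsub).continuous.homeoOfEquivCompactToT2 (f := Equiv.ofBijective _
    ⟨toOrderComplex_injective m e hsub, toOrderComplex_surjective m e hsub⟩)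

end MappingCone

/-- Let `P` be a finite poset and `m ∈ P`. If the inclusion of the subcomplex
`Δ(P_{<m} ∪ P_{>m}) = ΔP_{<m} * ΔP_{>m}` into `ΔP_{≠m}` is null-homotopic, then
`ΔP ≃ ΔP_{≠m} ∨ Σ(ΔP_{<m} * ΔP_{>m})`. -/
theorem orderComplex_homotopyEquiv_wedge_of_nullhomotopic
    (P : Type) [PartialOrder P] [Finite P] (m : P)
    (hsub : Set.Iio m ∪ Set.Ioi m ⊆ ({m}ᶜ : Set P))
    (hnull : (ΔIncl hsub).Nullhomotopic) :
    ∃ (x0 : ΔSp ({m}ᶜ : Set P))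
      (y0 : Susp (TopJoin (ΔSp (Set.Iio m)) (ΔSp (Set.Ioi m)))),
      Nonempty (ContinuousMap.HomotopyEquiv (ΔSp (Set.univ : Set P))
        (Wedge (ΔSp ({m}ᶜ : Set P))
          (Susp (TopJoin (ΔSp (Set.Iio m)) (ΔSp (Set.Ioi m)))) x0 y0)) := by
  cases nonempty_fintype P
  let e := TopJoin.orderComplexHomeomorph (S := Set.Iio m) (T := Set.Ioi m)
    (fun x hx y hy => Or.inl (hx.trans hy).le)
    (Set.disjoint_left.2 fun x hx hx' => lt_asymm hx hx')
  obtain ⟨x₀, ⟨H⟩⟩ := hnull.comp_left (e : C(TopJoin (ΔSp (Set.Iio m)) (ΔSp (Set.Ioi m)),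
    ΔSp (Set.Iio m ∪ Set.Ioi m)))
  exact ⟨x₀, Susp.pole true, ⟨(MappingCone.orderComplexHomeomorph m e hsub).symm.toHomotopyEquiv
    |>.trans (MappingCone.homotopyEquivOfHomotopy H)
    |>.trans (MappingCone.constHomeomorph _ x₀).toHomotopyEquiv⟩⟩
end
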